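/- Let (c,u) be a travelling-wave solution of the one-species free-boundary problem such that u is globally Lipschitz, ∂ₓu < 0 on Ω = {u > 0}, the free boundary is Γ = {(φ(y), y) : y < 0} with φ real-analytic and locally Lipschitz, and φ'(y) converges to a finite limit -cotan α (with α ∈ (0,π/2)) as y → -∞. Then the second and third derivatives of φ tend to zero at infinity: lim_{y→-∞} φ''(y) = 0 and lim_{y→-∞} φ'''(y) = 0. -/

import Mathlib

open Real Filter Topology Set Asymptotics

noncomputable section

/-- Partial derivative in the first (horizontal) variable. -/
def pdx (u : ℝ → ℝ → ℝ) (x y : ℝ) : ℝ := deriv (fun t => u t y) x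

/-- Partial derivative in the second (vertical) variable. -/
def pdy (u : ℝ → ℝ → ℝ) (x y : ℝ) : ℝ := deriv (fun t => u x t) y

/-- Second partial derivative in the first variable. -/
def pdxx (u : ℝ → ℝ → ℝ) (x y : ℝ) : ℝ := deriv (fun t => pdx u t y) x

/-- Second partial derivative in the second variable. -/
def pdyy (u : ℝ → ℝ → ℝ) (x y : ℝ) : ℝ := deriv (fun t => pdy u x t) y

/-- The closed lower half-plane `H = {(x,y) : y ≤ 0}`. -/
def lowerH : Set (ℝ × ℝ) := {p | p.2 ≤ 0}

/-- The positivity set `Ω = {u > 0}` inside the closed lower half-plane. -/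
def posSet (u : ℝ → ℝ → ℝ) : Set (ℝ × ℝ) := {p | p.2 ≤ 0 ∧ 0 < u p.1 p.2}

/-- The free boundary `Γ = ∂Ω ∩ {y < 0}`. -/
def freeBdry (u : ℝ → ℝ → ℝ) : Set (ℝ × ℝ) :=
  frontier (posSet u) ∩ {p | p.2 < 0}

/-- A travelling-wave solution of the one-species free-boundary problem in the
lower half-plane, with diffusivities `d` (field), `D` (road), exchange parameter `μ`
and speed `c`. -/
structure OneSpeciesTW (d D μ c : ℝ) (u : ℝ → ℝ → ℝ) : Prop where
  c_pos : 0 < c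
  cont : ContinuousOn (fun p : ℝ × ℝ => u p.1 p.2) lowerH
  mem01 : ∀ x y : ℝ, y ≤ 0 → u x y ∈ Icc (0:ℝ) 1
  relOpen : ∃ V : Set (ℝ × ℝ), IsOpen V ∧ posSet u = V ∩ lowerH
  smooth : ContDiffOn ℝ 2 (fun p : ℝ × ℝ => u p.1 p.2) (posSet u ∩ {p | p.2 < 0})
  pde : ∀ p ∈ posSet u ∩ {p : ℝ × ℝ | p.2 < 0},
      -d * (pdxx u p.1 p.2 + pdyy u p.1 p.2) + c * pdx u p.1 p.2 = 0
  grad_ext : ∃ G₁ G₂ : ℝ × ℝ → ℝ,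
      ContinuousOn G₁ (posSet u ∪ freeBdry u) ∧
      ContinuousOn G₂ (posSet u ∪ freeBdry u) ∧
      (∀ p ∈ posSet u ∩ {p : ℝ × ℝ | p.2 < 0},
        G₁ p = pdx u p.1 p.2 ∧ G₂ p = pdy u p.1 p.2) ∧
      (∀ p ∈ freeBdry u, (G₁ p) ^ 2 + (G₂ p) ^ 2 = 1)
  road_diffx : ∀ x : ℝ, 0 < u x 0 → DifferentiableAt ℝ (fun t => u t 0) x
  road_diffxx : ∀ x : ℝ, 0 < u x 0 → DifferentiableAt ℝ (fun t => pdx u t 0) x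
  road_diffy : ∀ x : ℝ, 0 < u x 0 → DifferentiableAt ℝ (fun t => u x t) 0
  road : ∀ x : ℝ, 0 < u x 0 →
      -D * pdxx u x 0 + c * pdx u x 0 + (1/μ) * pdy u x 0 = 0
  lim_left : ∀ ε > 0, ∃ M : ℝ, ∀ x ≤ M, ∀ y ≤ (0:ℝ), |u x y - 1| < ε
  lim_right : ∀ y ≤ (0:ℝ), Tendsto (fun x => u x y) atTop (𝓝 0)

section ModA1
open MeasureTheory
open Complex (I)

def dbar (f : ℂ → ℂ) (z : ℂ) : ℂ := (fderiv ℝ f z 1 + I * fderiv ℝ f z I) / 2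

lemma clm_apply (L : ℂ →L[ℝ] ℂ) (v : ℂ) : L v = v.re * L 1 + v.im * L I := by
  have h : v = v.re • (1:ℂ) + v.im • I := by
    apply Complex.ext <;> simp
  conv_lhs => rw [h]
  rw [map_add, map_smul, map_smul]; simp

lemma cauchyPompeiu_zero (g : ℂ → ℂ) (hg : ContDiff ℝ 1 g) (hs : HasCompactSupport g) :
    ∫ z, dbar g z / z = -π * g 0 := by
  rw [← Complex.integral_comp_polarCoord_symm]
  have hD : Continuous (fderiv ℝ g) := hg.continuous_fderiv one_ne_zero
  have hdiff : Differentiable ℝ g := hg.differentiable one_ne_zero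
  set e : ℝ → ℂ := fun t => Complex.exp (t * I) with he
  have hec : Continuous e := by fun_prop
  have het : ∀ t, e t = Real.cos t + Real.sin t * I := by
    intro t; simp [he, Complex.exp_mul_I]
  have hed : ∀ t, HasDerivAt e (I * e t) t := by
    intro t
    have : HasDerivAt (fun t : ℝ => (t:ℂ) * I) (1 * I) t := (Complex.ofRealCLM.hasDerivAt (x := t)).mul_const I
    have := this.cexp
    convert this using 1; simp [he]; ring
  set P : ℝ × ℝ → ℂ := fun p => fderiv ℝ g (p.1 * e p.2) (e p.2) with hP
  set Q : ℝ × ℝ → ℂ := fun p => fderiv ℝ g (p.1 * e p.2) (I * e p.2) with hQ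
  have hPc : Continuous P := by
    refine Continuous.clm_apply (hD.comp ?_) ?_ <;> fun_prop
  have hQc : Continuous Q := by
    refine Continuous.clm_apply (hD.comp ?_) ?_ <;> fun_prop
  obtain ⟨R, hR0, hR⟩ : ∃ R > 0, ∀ z : ℂ, R ≤ ‖z‖ → g =ᶠ[𝓝 z] 0 := by
    obtain ⟨R, hR⟩ := hs.isCompact.isBounded.subset_closedBall 0
    refine ⟨max R 0 + 1, by positivity, fun z hz => ?_⟩
    rw [← notMem_tsupport_iff_eventuallyEq]
    intro h
    have := hR h
    simp at this
    have := le_max_left R 0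
    linarith
  have hne : ∀ t, ‖e t‖ = 1 := fun t => by simp [he, Complex.norm_exp_ofReal_mul_I]
  have hfd0 : ∀ (r : ℝ) t, R ≤ r → fderiv ℝ g (r * e t) = 0 := by
    intro r t hr
    have h1 : g =ᶠ[𝓝 (r * e t)] fun _ => 0 := hR _ (by rw [norm_mul, hne, mul_one]; simpa using hr.trans (le_abs_self r))
    rw [h1.fderiv_eq]; simp
  have hg0 : ∀ (r : ℝ) t, R ≤ r → g (r * e t) = 0 := by
    intro r t hr
    exact (hR _ (by rw [norm_mul, hne, mul_one]; simpa using hr.trans (le_abs_self r))).eq_of_nhds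
  have key : ∀ p ∈ Complex.polarCoord.target, p.1 • (dbar g (Complex.polarCoord.symm p) / Complex.polarCoord.symm p)
      = (P p + I * Q p) / 2 := by
    rintro ⟨r, t⟩ hp
    rw [Complex.polarCoord_target] at hp
    have hr : 0 < r := hp.1
    rw [Complex.polarCoord_symm_apply]
    simp only [hP, hQ, ← het]
    have h2 : (e t) ≠ 0 := by intro h; have := hne t; rw [h] at this; simp at this
    have hr' : (r:ℂ) ≠ 0 := by exact_mod_cast hr.ne'
    rw [clm_apply _ (e t), clm_apply _ (I * e t)]
    simp only [dbar, Complex.real_smul]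
    have h3 : ((e t).re : ℂ) = Real.cos t := by rw [het]; simp [-Complex.ofReal_cos, -Complex.ofReal_sin]
    have h4 : ((e t).im : ℂ) = Real.sin t := by rw [het]; simp [-Complex.ofReal_cos, -Complex.ofReal_sin]
    have h5 : ((I * e t).re : ℂ) = - Real.sin t := by rw [het]; simp [-Complex.ofReal_cos, -Complex.ofReal_sin]
    have h6 : ((I * e t).im : ℂ) = Real.cos t := by rw [het]; simp [-Complex.ofReal_cos, -Complex.ofReal_sin]
    rw [h3, h4, h5, h6]
    have h7 : (Real.cos t:ℂ)^2 + (Real.sin t:ℂ)^2 = 1 := by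
      exact_mod_cast Real.cos_sq_add_sin_sq t
    field_simp
    rw [het]
    generalize fderiv ℝ g (r * (Real.cos t + Real.sin t * I)) 1 = a
    generalize fderiv ℝ g (r * (Real.cos t + Real.sin t * I)) I = b
    generalize (Real.cos t : ℂ) = cc at *
    generalize (Real.sin t : ℂ) = ss at *
    linear_combination (-(a + I * b)) * h7 + (ss^2 * a - cc * ss * b) * Complex.I_sq
  have hmt : MeasurableSet Complex.polarCoord.target := by
    rw [Complex.polarCoord_target]; exact measurableSet_Ioi.prod measurableSet_Ioo
  change ∫ p in Complex.polarCoord.target, _ = _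
  rw [setIntegral_congr_fun hmt key, Complex.polarCoord_target]
  have hcut : ∫ p in Ioi (0:ℝ) ×ˢ Ioo (-π) π, (P p + I * Q p) / 2 = ∫ p in Ioc (0:ℝ) R ×ˢ Ioo (-π) π, (P p + I * Q p) / 2 := by
    apply setIntegral_eq_of_subset_of_forall_sdiff_eq_zero (measurableSet_Ioi.prod measurableSet_Ioo)
    · exact prod_mono Ioc_subset_Ioi_self subset_rfl
    · rintro ⟨r, t⟩ ⟨⟨h1, h2⟩, h3⟩
      have : R ≤ r := by
        by_contra h
        exact h3 ⟨⟨h1, (not_le.1 h).le⟩, h2⟩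
      simp [hP, hQ, hfd0 r t this]
  rw [hcut, Measure.volume_eq_prod]
  have hint : ∀ F : ℝ × ℝ → ℂ, Continuous F → IntegrableOn F (Ioc (0:ℝ) R ×ˢ Ioo (-π) π) (volume.prod volume) := by
    intro F hF
    apply IntegrableOn.mono_set (t := Icc (0:ℝ) R ×ˢ Icc (-π) π)
    · rw [← Measure.volume_eq_prod]
      exact hF.continuousOn.integrableOn_compact (isCompact_Icc.prod isCompact_Icc)
    · exact prod_mono Ioc_subset_Icc_self Ioo_subset_Icc_self
  rw [integral_div, integral_add (hint _ hPc) ((hint _ hQc).const_mul I)]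
  rw [integral_const_mul]
  have hQ0 : ∫ p in Ioc (0:ℝ) R ×ˢ Ioo (-π) π, Q p ∂(volume.prod volume) = 0 := by
    rw [setIntegral_prod _ (hint _ hQc)]
    apply setIntegral_eq_zero_of_forall_eq_zero
    intro r hr
    have hr' : (r:ℂ) ≠ 0 := by exact_mod_cast hr.1.ne'
    rw [← integral_Ioc_eq_integral_Ioo, ← intervalIntegral.integral_of_le (by linarith [pi_pos])]
    have hder : ∀ t : ℝ, HasDerivAt (fun t : ℝ => g (r * e t) / r) (Q (r, t)) t := by
      intro t
      have h1 := (hdiff (r * e t)).hasFDerivAt.comp_hasDerivAt t ((hed t).const_mul (r:ℂ))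
      have h2 := h1.div_const (r:ℂ)
      have h3 : Q (r, t) = fderiv ℝ g (r * e t) (r * (I * e t)) / r := by
        change fderiv ℝ g (r * e t) (I * e t) = _
        rw [eq_div_iff hr', mul_comm, ← Complex.real_smul, ← Complex.real_smul, ← map_smul]
        simp only [Complex.real_smul]
      rw [h3]; exact h2
    rw [intervalIntegral.integral_eq_sub_of_hasDerivAt (fun t _ => hder t)]
    · have : e π = e (-π) := by simp [het]
      rw [this]; ring
    · apply Continuous.intervalIntegrable
      exact hQc.comp (by fun_prop)
  have hP0 : ∫ p in Ioc (0:ℝ) R ×ˢ Ioo (-π) π, P p ∂(volume.prod volume) = -(2 * π) * g 0 := by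
    rw [← setIntegral_prod_swap]
    have : IntegrableOn (fun z : ℝ × ℝ => P z.swap) (Ioo (-π) π ×ˢ Ioc 0 R) (volume.prod volume) := (hint _ hPc).swap
    rw [setIntegral_prod _ this]
    have h1 : ∀ t ∈ Ioo (-π) π, ∫ r in Ioc 0 R, P (Prod.swap (t, r)) = - g 0 := by
      intro t _
      rw [← intervalIntegral.integral_of_le hR0.le]
      have hder : ∀ r : ℝ, HasDerivAt (fun r : ℝ => g (r * e t)) (P (r, t)) r := by
        intro r
        have h1 : HasDerivAt (fun r : ℝ => (r:ℂ) * e t) (1 * e t) r := (Complex.ofRealCLM.hasDerivAt (x := r)).mul_const _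
        have h2 := (hdiff (r * e t)).hasFDerivAt.comp_hasDerivAt r h1
        simpa [hP, Function.comp_def] using h2
      simp only [Prod.swap_prod_mk]
      rw [intervalIntegral.integral_eq_sub_of_hasDerivAt (fun r _ => hder r)]
      · rw [hg0 R t le_rfl]; simp
      · apply Continuous.intervalIntegrable
        exact hPc.comp (by fun_prop)
    rw [setIntegral_congr_fun measurableSet_Ioo h1]
    simp [Measure.real, pi_pos.le]
    left; ring
  rw [hQ0, hP0]; ring

lemma dbar_comp_add (f : ℂ → ℂ) (w z : ℂ) : dbar (fun z => f (z + w)) z = dbar f (z + w) := by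
  simp only [dbar, fderiv_comp_add_right]

theorem cauchyPompeiu (f : ℂ → ℂ) (hf : ContDiff ℝ 1 f) (hs : HasCompactSupport f) (w : ℂ) :
    ∫ z, dbar f z / (z - w) = -π * f w := by
  have := cauchyPompeiu_zero (fun z => f (z + w)) (hf.comp (by fun_prop))
    (hs.comp_homeomorph (Homeomorph.addRight w))
  rw [zero_add] at this
  rw [← this, ← integral_add_right_eq_self _ w]
  simp [dbar_comp_add]
end ModA1

section ModA3
open MeasureTheory
open Complex (I)

lemma rad_near (s ρ : ℝ) (hs : -2 < s) (hρ : 0 < ρ) :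
    Integrable (fun w : ℂ => (Iio ρ).indicator (fun y => y ^ s) ‖w‖) ∧
    ∫ w : ℂ, (Iio ρ).indicator (fun y => y ^ s) ‖w‖ = 2 * π * (ρ ^ (s+2) / (s+2)) := by
  have h1 : ∀ y ∈ Ioi (0:ℝ), y ^ (Module.finrank ℝ ℂ - 1) • (Iio ρ).indicator (fun y => y ^ s) y
      = (Iio ρ).indicator (fun y => y ^ (s+1)) y := by
    intro y hy
    have hy : (0:ℝ) < y := hy
    rw [Complex.finrank_real_complex]
    by_cases h : y < ρ
    · simp [h, Real.rpow_add_one hy.ne']; ring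
    · simp [h]
  have h2 : IntegrableOn (fun y : ℝ => y ^ (s+1)) (Ioc 0 ρ) := by
    rw [← intervalIntegrable_iff_integrableOn_Ioc_of_le hρ.le]
    exact intervalIntegral.intervalIntegrable_rpow' (by linarith)
  have hset : Ioi (0:ℝ) ∩ Iio ρ = Ioo 0 ρ := rfl
  constructor
  · rw [integrable_fun_norm_addHaar volume (f := (Iio ρ).indicator (fun y => y ^ s)),
      integrableOn_congr_fun h1 measurableSet_Ioi, IntegrableOn, integrable_indicator_iff measurableSet_Iio,
      IntegrableOn, Measure.restrict_restrict measurableSet_Iio, inter_comm, hset]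
    exact h2.mono_set Ioo_subset_Ioc_self
  · rw [integral_fun_norm_addHaar volume ((Iio ρ).indicator (fun y => y ^ s)),
      setIntegral_congr_fun measurableSet_Ioi h1, setIntegral_indicator measurableSet_Iio, hset,
      ← integral_Ioc_eq_integral_Ioo, ← intervalIntegral.integral_of_le hρ.le,
      integral_rpow (Or.inl (by linarith))]
    have : (0:ℝ) ^ (s+1+1) = 0 := Real.zero_rpow (by linarith)
    rw [this]
    simp [Measure.real, Complex.finrank_real_complex]
    rw [show s + 1 + 1 = s + 2 by ring]
    ring

lemma rad_far (s ρ : ℝ) (hs : s < -2) (hρ : 0 < ρ) :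
    Integrable (fun w : ℂ => (Ioi ρ).indicator (fun y => y ^ s) ‖w‖) ∧
    ∫ w : ℂ, (Ioi ρ).indicator (fun y => y ^ s) ‖w‖ = 2 * π * (ρ ^ (s+2) / (-(s+2))) := by
  have h1 : ∀ y ∈ Ioi (0:ℝ), y ^ (Module.finrank ℝ ℂ - 1) • (Ioi ρ).indicator (fun y => y ^ s) y
      = (Ioi ρ).indicator (fun y => y ^ (s+1)) y := by
    intro y hy
    have hy : (0:ℝ) < y := hy
    rw [Complex.finrank_real_complex]
    by_cases h : ρ < y
    · simp [h, Real.rpow_add_one hy.ne']; ring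
    · simp [h]
  have hset : Ioi (0:ℝ) ∩ Ioi ρ = Ioi ρ := by
    rw [inter_eq_right]; exact Ioi_subset_Ioi hρ.le
  constructor
  · rw [integrable_fun_norm_addHaar volume (f := (Ioi ρ).indicator (fun y => y ^ s)),
      integrableOn_congr_fun h1 measurableSet_Ioi, IntegrableOn, integrable_indicator_iff measurableSet_Ioi,
      IntegrableOn, Measure.restrict_restrict measurableSet_Ioi, inter_comm, hset]
    exact integrableOn_Ioi_rpow_of_lt (by linarith) hρ
  · rw [integral_fun_norm_addHaar volume ((Ioi ρ).indicator (fun y => y ^ s)),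
      setIntegral_congr_fun measurableSet_Ioi h1, setIntegral_indicator measurableSet_Ioi, hset,
      integral_Ioi_rpow_of_lt (by linarith) hρ]
    simp [Measure.real, Complex.finrank_real_complex]
    rw [show s + 1 + 1 = s + 2 by ring]
    have : s + 2 ≠ 0 := by linarith
    rw [show -2 + -s = -(s+2) by ring]
    field_simp

lemma kernel_bound : ∃ C > 0, ∀ ω : ℂ, ω ≠ 0 →
    Integrable (fun w : ℂ => ‖w‖ ^ (-(3/2):ℝ) / ‖w - ω‖) ∧
    ∫ w : ℂ, ‖w‖ ^ (-(3/2):ℝ) / ‖w - ω‖ ≤ C * ‖ω‖ ^ (-(1/2):ℝ) := by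
  refine ⟨2*π*(2 * (2:ℝ)^(1/2:ℝ)) + 2 * π * 8 * (2:ℝ)^(1/2:ℝ) + 2*π * 16, by positivity, fun ω hω => ?_⟩
  have hn : 0 < ‖ω‖ := norm_pos_iff.2 hω
  set ρ := ‖ω‖/2 with hρd
  have hρ : 0 < ρ := by positivity
  obtain ⟨i1, e1⟩ := rad_near (-(3/2)) ρ (by norm_num) hρ
  obtain ⟨i2, e2⟩ := rad_near (-1) (4*ρ) (by norm_num) (by positivity)
  obtain ⟨i3, e3⟩ := rad_far (-(5/2)) (3*ρ) (by norm_num) (by positivity)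
  have i2' := i2.comp_sub_right ω
  have i3' := i3.comp_sub_right ω
  have e2' := integral_sub_right_eq_self (μ := volume) (fun w : ℂ => (Iio (4*ρ)).indicator (fun y : ℝ => y ^ (-1:ℝ)) ‖w‖) ω
  have e3' := integral_sub_right_eq_self (μ := volume) (fun w : ℂ => (Ioi (3*ρ)).indicator (fun y : ℝ => y ^ (-(5/2):ℝ)) ‖w‖) ω
  have hb : ∀ w : ℂ, ‖w‖ ^ (-(3/2):ℝ) / ‖w - ω‖ ≤ ρ⁻¹ * (Iio ρ).indicator (fun y => y ^ (-(3/2):ℝ)) ‖w‖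
      + ρ ^ (-(3/2):ℝ) * (Iio (4*ρ)).indicator (fun y => y ^ (-1:ℝ)) ‖w - ω‖
      + 4 * (Ioi (3*ρ)).indicator (fun y => y ^ (-(5/2):ℝ)) ‖w - ω‖ := by
    intro w
    have t1 : ‖ω‖ ≤ ‖w‖ + ‖w - ω‖ := by
      have := norm_sub_le w (w - ω); simpa using this
    have t2 : ‖w - ω‖ ≤ ‖w‖ + ‖ω‖ := norm_sub_le _ _
    have p1 : 0 ≤ ρ⁻¹ * (Iio ρ).indicator (fun y => y ^ (-(3/2):ℝ)) ‖w‖ :=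
      mul_nonneg (by positivity) (indicator_apply_nonneg fun _ => by positivity)
    have p2 : 0 ≤ ρ ^ (-(3/2):ℝ) * (Iio (4*ρ)).indicator (fun y => y ^ (-1:ℝ)) ‖w - ω‖ :=
      mul_nonneg (by positivity) (indicator_apply_nonneg fun _ => by positivity)
    have p3 : 0 ≤ 4 * (Ioi (3*ρ)).indicator (fun y => y ^ (-(5/2):ℝ)) ‖w - ω‖ :=
      mul_nonneg (by positivity) (indicator_apply_nonneg fun _ => by positivity)
    by_cases h1 : ‖w‖ < ρ
    · have : ‖w‖ ^ (-(3/2):ℝ) / ‖w - ω‖ ≤ ρ⁻¹ * (Iio ρ).indicator (fun y => y ^ (-(3/2):ℝ)) ‖w‖ := by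
        rw [indicator_of_mem (show ‖w‖ ∈ Iio ρ from h1), div_eq_inv_mul]
        gcongr
        linarith
      linarith
    · push Not at h1
      by_cases h2 : ‖w - ω‖ < 4 * ρ
      · have : ‖w‖ ^ (-(3/2):ℝ) / ‖w - ω‖ ≤ ρ ^ (-(3/2):ℝ) * (Iio (4*ρ)).indicator (fun y => y ^ (-1:ℝ)) ‖w - ω‖ := by
          rw [indicator_of_mem (show ‖w-ω‖ ∈ Iio (4*ρ) from h2), div_eq_mul_inv, Real.rpow_neg_one]
          gcongr ?_ * _
          exact Real.rpow_le_rpow_of_nonpos hρ h1 (by norm_num)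
        linarith
      · push Not at h2
        have : ‖w‖ ^ (-(3/2):ℝ) / ‖w - ω‖ ≤ 4 * (Ioi (3*ρ)).indicator (fun y => y ^ (-(5/2):ℝ)) ‖w - ω‖ := by
          have hm : 3 * ρ < ‖w - ω‖ := by linarith
          have hp : 0 < ‖w - ω‖ := by linarith
          have h2 : ‖w - ω‖ / 2 ≤ ‖w‖ := by linarith
          rw [indicator_of_mem (show ‖w-ω‖ ∈ Ioi (3*ρ) from hm)]
          have h3 := Real.rpow_le_rpow_of_nonpos (by positivity) h2 (show (-(3/2):ℝ) ≤ 0 by norm_num)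
          rw [Real.div_rpow hp.le (by norm_num)] at h3
          have h4 : (2:ℝ)^(-(3/2):ℝ) ≥ 1/4 := by
            have : (2:ℝ)^(-(3/2):ℝ) ≥ 2^(-2:ℝ) := Real.rpow_le_rpow_of_exponent_le (by norm_num) (by norm_num)
            have e : (2:ℝ)^(-2:ℝ) = 1/4 := by rw [Real.rpow_neg (by norm_num)]; norm_num
            linarith
          have h5 : ‖w - ω‖ ^ (-(5/2):ℝ) = ‖w - ω‖ ^ (-(3/2):ℝ) / ‖w - ω‖ := by
            rw [← Real.rpow_sub_one hp.ne']; norm_num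
          rw [h5, ← mul_div_assoc]
          gcongr
          refine h3.trans ?_
          rw [div_le_iff₀ (by positivity)]
          have : 0 ≤ ‖w - ω‖ ^ (-(3/2):ℝ) := by positivity
          nlinarith
        linarith
  have iS := ((i1.const_mul ρ⁻¹).add (i2'.const_mul (ρ ^ (-(3/2):ℝ)))).add (i3'.const_mul 4)
  have hI : Integrable (fun w : ℂ => ‖w‖ ^ (-(3/2):ℝ) / ‖w - ω‖) := by
    refine iS.mono' ?_ (Eventually.of_forall fun w => ?_)
    · apply Measurable.aestronglyMeasurable; fun_prop
    · rw [Real.norm_of_nonneg (by positivity)]; exact hb w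
  refine ⟨hI, (integral_mono hI iS hb).trans ?_⟩
  simp only [Pi.add_apply]
  rw [integral_add, integral_add, integral_const_mul, integral_const_mul, integral_const_mul, e1, e2', e2, e3', e3]
  rotate_left
  · exact i1.const_mul _
  · exact i2'.const_mul _
  · exact (i1.const_mul _).add (i2'.const_mul _)
  · exact i3'.const_mul _
  have a1 : ‖ω‖ ^ (-(1/2):ℝ) = (2*ρ) ^ (-(1/2):ℝ) := by rw [hρd]; congr 1; ring
  rw [a1, Real.mul_rpow (x := 2) (y := ρ) (z := -(1/2)) (by norm_num) hρ.le]
  set q := ρ ^ (-(1/2):ℝ) with hq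
  have b1 : ρ⁻¹ * ρ ^ ((-(3/2):ℝ)+2) = q := by
    rw [← Real.rpow_neg_one, ← Real.rpow_add hρ]; norm_num
    rw [hq]
  have b2 : ρ ^ (-(3/2):ℝ) * ρ = q := by
    rw [← Real.rpow_add_one hρ.ne']; norm_num [hq]
  have b3 : (3*ρ) ^ ((-(5/2):ℝ)+2) ≤ q := by
    rw [hq, show (-(5/2):ℝ)+2 = -(1/2) by norm_num]
    exact Real.rpow_le_rpow_of_nonpos hρ (by linarith) (by norm_num)
  have b4 : (2:ℝ)^(1/2:ℝ) * (2:ℝ)^(-(1/2):ℝ) = 1 := by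
    rw [← Real.rpow_add (by norm_num)]; norm_num
  have b5 : (4*ρ) ^ ((-1:ℝ)+2) = 4 * ρ := by norm_num
  have hq0 : 0 ≤ q := by positivity
  have hC : 0 ≤ (2:ℝ)^(-(1/2):ℝ) := by positivity
  have b6 : (2:ℝ)^(-(1/2):ℝ) ≥ 1/2 := by
    have : (2:ℝ)^(-(1/2):ℝ) ≥ 2^(-1:ℝ) := Real.rpow_le_rpow_of_exponent_le (by norm_num) (by norm_num)
    have e : (2:ℝ)^(-1:ℝ) = 1/2 := by rw [Real.rpow_neg_one]; norm_num
    linarith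
  have key : ρ⁻¹ * (2 * π * (ρ ^ ((-(3/2):ℝ)+2) / ((-(3/2):ℝ)+2))) +
      ρ ^ (-(3/2):ℝ) * (2 * π * ((4*ρ) ^ ((-1:ℝ)+2) / ((-1:ℝ)+2))) +
      4 * (2 * π * ((3*ρ) ^ ((-(5/2):ℝ)+2) / (-((-(5/2):ℝ)+2)))) ≤ 2 * π * 2 * q + 2 * π * 4 * q + 2 * π * 8 * q := by
    rw [b5]
    have k1 : ρ⁻¹ * (2 * π * (ρ ^ ((-(3/2):ℝ)+2) / ((-(3/2):ℝ)+2))) = 2 * π * 2 * q := by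
      rw [← b1]; ring
    have k2 : ρ ^ (-(3/2):ℝ) * (2 * π * ((4*ρ) / ((-1:ℝ)+2))) = 2 * π * 4 * q := by
      rw [← b2]; ring
    have k3 : 4 * (2 * π * ((3*ρ) ^ ((-(5/2):ℝ)+2) / (-((-(5/2):ℝ)+2)))) ≤ 2 * π * 8 * q := by
      have : 4 * (2 * π * ((3*ρ) ^ ((-(5/2):ℝ)+2) / (-((-(5/2):ℝ)+2)))) = 2 * π * 8 * (3*ρ) ^ ((-(5/2):ℝ)+2) := by ring
      rw [this]; gcongr
    linarith
  refine key.trans ?_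
  have : (2 * π * (2 * (2:ℝ)^(1/2:ℝ)) + 2 * π * 8 * (2:ℝ)^(1/2:ℝ) + 2 * π * 16) * ((2:ℝ)^(-(1/2):ℝ) * q)
     = 2 * π * 2 * q * ((2:ℝ)^(1/2:ℝ) * (2:ℝ)^(-(1/2):ℝ)) + 2 * π * 8 * q * ((2:ℝ)^(1/2:ℝ) * (2:ℝ)^(-(1/2):ℝ)) + 2 * π * 16 * q * (2:ℝ)^(-(1/2):ℝ) := by ring
  rw [this, b4]
  have : 0 ≤ π * q := by positivity
  nlinarith
end ModA3

section ModA2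
open MeasureTheory
open Complex (I)

lemma integrable_div_sub (h : ℂ → ℂ) (hm : AEStronglyMeasurable h) (M R : ℝ) (hM : ∀ w, ‖h w‖ ≤ M)
    (hR : ∀ w, R < ‖w‖ → h w = 0) (ω : ℂ) : Integrable (fun w => h w / (w - ω)) := by
  have hM0 : 0 ≤ M := (norm_nonneg _).trans (hM 0)
  set ρ := |R| + ‖ω‖ + 1
  obtain ⟨i, -⟩ := rad_near (-1) ρ (by norm_num) (by positivity)
  have i' := (i.comp_sub_right ω).const_mul M
  refine i'.mono' ?_ (Eventually.of_forall fun w => ?_)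
  · simp only [div_eq_mul_inv]
    refine hm.mul ?_
    apply Measurable.aestronglyMeasurable; fun_prop
  · rw [norm_div]
    by_cases hw : ‖w - ω‖ < ρ
    · rw [indicator_of_mem (show ‖w-ω‖ ∈ Iio ρ from hw), Real.rpow_neg_one, div_eq_mul_inv]
      gcongr; exact hM w
    · have : R < ‖w‖ := by
        have := norm_sub_le w ω
        have := le_abs_self R
        push Not at hw
        simp only [ρ] at hw; linarith
      rw [hR w this]; simp
      exact mul_nonneg hM0 (indicator_apply_nonneg fun _ => by positivity)

lemma setIntegral_im (S : Set ℝ) (hS : MeasurableSet S) (g : ℂ → ℂ) (hg : Continuous g) (hgs : HasCompactSupport g) :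
    IntegrableOn (fun p : ℝ × ℝ => g (p.1 + p.2 * I)) (univ ×ˢ S) (volume.prod volume) ∧
    ∫ z in {z : ℂ | z.im ∈ S}, g z = ∫ p in (univ : Set ℝ) ×ˢ S, g (p.1 + p.2 * I) ∂(volume.prod volume) := by
  have h1 := Complex.volume_preserving_equiv_real_prod
  have hI : Integrable g := hg.integrable_of_hasCompactSupport hgs
  have he : ∀ p : ℝ × ℝ, g (p.1 + p.2 * I) = g (Complex.measurableEquivRealProd.symm p) := by
    intro p; congr 1
    apply Complex.ext <;> simp [Complex.measurableEquivRealProd]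
  simp only [he]
  constructor
  · apply Integrable.integrableOn
    rw [← Measure.volume_eq_prod]
    exact h1.symm.integrable_comp_of_integrable hI
  · rw [← Measure.volume_eq_prod, ← h1.setIntegral_preimage_emb Complex.measurableEquivRealProd.measurableEmbedding]
    simp [Complex.measurableEquivRealProd_apply, preimage]

lemma line_x (f : ℂ → ℂ) (hf : ContDiff ℝ 1 f) (x y : ℝ) :
   HasDerivAt (fun x : ℝ => f (x + y * I)) (fderiv ℝ f (x + y * I) 1) x := by
  have h1 : HasDerivAt (fun x : ℝ => (x:ℂ) + y * I) 1 x := (Complex.ofRealCLM.hasDerivAt (x := x)).add_const _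
  exact ((hf.differentiable one_ne_zero) (x + y * I)).hasFDerivAt.comp_hasDerivAt x h1

lemma line_y (f : ℂ → ℂ) (hf : ContDiff ℝ 1 f) (x y : ℝ) :
   HasDerivAt (fun y : ℝ => f (x + y * I)) (fderiv ℝ f (x + y * I) I) y := by
  have h1 : HasDerivAt (fun y : ℝ => (x:ℂ) + y * I) (1 * I) y := ((Complex.ofRealCLM.hasDerivAt (x := y)).mul_const I).const_add _
  rw [one_mul] at h1
  exact ((hf.differentiable one_ne_zero) (x + y * I)).hasFDerivAt.comp_hasDerivAt y h1

lemma ofReal_closedEmb : IsClosedEmbedding (fun x : ℝ => (x:ℂ)) := Complex.isometry_ofReal.isClosedEmbedding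

lemma contDiff_ofReal' {n : WithTop ℕ∞} : ContDiff ℝ n (fun x : ℝ => (x:ℂ)) := Complex.ofRealCLM.contDiff

lemma contDiff_vert (x : ℝ) : ContDiff ℝ 1 fun y : ℝ => (x:ℂ) + y * I :=
  contDiff_const.add (contDiff_ofReal'.mul contDiff_const)

lemma cs_x (f : ℂ → ℂ) (hs : HasCompactSupport f) (y : ℝ) : HasCompactSupport (fun x : ℝ => f (x + y * I)) := by
  refine hs.comp_isClosedEmbedding (g := fun x : ℝ => (x:ℂ) + y * I) ?_
  exact (Homeomorph.addRight (y * I : ℂ)).isClosedEmbedding.comp ofReal_closedEmb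

lemma cs_y (f : ℂ → ℂ) (hs : HasCompactSupport f) (x : ℝ) : HasCompactSupport (fun y : ℝ => f (x + y * I)) := by
  refine hs.comp_isClosedEmbedding (g := fun y : ℝ => (x:ℂ) + y * I) ?_
  refine (Homeomorph.addLeft (x : ℂ)).isClosedEmbedding.comp (((Homeomorph.mulRight₀ I Complex.I_ne_zero)).isClosedEmbedding.comp ofReal_closedEmb)

lemma integral_dbar_im (S : Set ℝ) (hS : MeasurableSet S) (f : ℂ → ℂ) (hf : ContDiff ℝ 1 f) (hs : HasCompactSupport f) :
    ∫ z in {z : ℂ | z.im ∈ S}, dbar f z = (I / 2) * ∫ x : ℝ, ∫ y in S, deriv (fun y : ℝ => f (x + y * I)) y := by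
  have hD : Continuous (fderiv ℝ f) := hf.continuous_fderiv one_ne_zero
  have hDs : HasCompactSupport (fderiv ℝ f) := hs.fderiv ℝ
  have c1 : Continuous (fun z => fderiv ℝ f z 1) := hD.clm_apply continuous_const
  have cI : Continuous (fun z => fderiv ℝ f z I) := hD.clm_apply continuous_const
  have s1 : HasCompactSupport (fun z => fderiv ℝ f z 1) := hDs.comp_left (g := fun L : ℂ →L[ℝ] ℂ => L 1) (by simp)
  have sI : HasCompactSupport (fun z => fderiv ℝ f z I) := hDs.comp_left (g := fun L : ℂ →L[ℝ] ℂ => L I) (by simp)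
  obtain ⟨i1, e1⟩ := setIntegral_im S hS _ c1 s1
  obtain ⟨iI, eI⟩ := setIntegral_im S hS _ cI sI
  simp only [dbar]
  rw [integral_div, integral_add (c1.integrable_of_hasCompactSupport s1).integrableOn ((cI.integrable_of_hasCompactSupport sI).integrableOn.const_mul I),
    integral_const_mul, e1, eI]
  have z1 : ∫ p in (univ : Set ℝ) ×ˢ S, fderiv ℝ f (p.1 + p.2 * I) 1 ∂(volume.prod volume) = 0 := by
    rw [← setIntegral_prod_swap]
    have : IntegrableOn (fun z : ℝ × ℝ => fderiv ℝ f (z.swap.1 + z.swap.2 * I) 1) (S ×ˢ univ) (volume.prod volume) := i1.swap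
    rw [setIntegral_prod _ this]
    apply setIntegral_eq_zero_of_forall_eq_zero
    intro y hy
    simp only [Measure.restrict_univ, Prod.swap_prod_mk]
    have := integral_of_hasDerivAt_of_tendsto (f := fun x : ℝ => f (x + y * I)) (m := 0) (n := 0) (line_x f hf · y) ?_ ?_ ?_
    · simpa using this
    · exact (c1.comp (by fun_prop : Continuous fun x : ℝ => (x:ℂ) + y * I)).integrable_of_hasCompactSupport (cs_x _ s1 y)
    · have := cs_x f hs y
      rw [hasCompactSupport_iff_eventuallyEq, Filter.coclosedCompact_eq_cocompact] at this
      exact this.filter_mono _root_.atBot_le_cocompact |>.tendsto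
    · have := cs_x f hs y
      rw [hasCompactSupport_iff_eventuallyEq, Filter.coclosedCompact_eq_cocompact] at this
      exact this.filter_mono _root_.atTop_le_cocompact |>.tendsto
  rw [z1, setIntegral_prod _ iI]
  simp only [Measure.restrict_univ, (line_y f hf _ _).deriv]
  ring

lemma green_up (f : ℂ → ℂ) (hf : ContDiff ℝ 1 f) (hs : HasCompactSupport f) :
    ∫ z in {z : ℂ | 0 < z.im}, dbar f z = -(I / 2) * ∫ x : ℝ, f x := by
  have := integral_dbar_im (Ioi 0) measurableSet_Ioi f hf hs
  simp only [mem_Ioi] at this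
  rw [this]
  have : ∀ x : ℝ, ∫ y in Ioi (0:ℝ), deriv (fun y : ℝ => f (x + y * I)) y = - f x := by
    intro x
    rw [HasCompactSupport.integral_Ioi_deriv_eq (f := fun y : ℝ => f (x + y * I)) (hf.comp (contDiff_vert x)) (cs_y f hs x)]
    simp
  simp only [this, integral_neg]; ring

lemma green_low (f : ℂ → ℂ) (hf : ContDiff ℝ 1 f) (hs : HasCompactSupport f) :
    ∫ z in {z : ℂ | z.im ≤ 0}, dbar f z = (I / 2) * ∫ x : ℝ, f x := by
  have := integral_dbar_im (Iic 0) measurableSet_Iic f hf hs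
  simp only [mem_Iic] at this
  rw [this]
  have : ∀ x : ℝ, ∫ y in Iic (0:ℝ), deriv (fun y : ℝ => f (x + y * I)) y = f x := by
    intro x
    rw [HasCompactSupport.integral_Iic_deriv_eq (f := fun y : ℝ => f (x + y * I)) (hf.comp (contDiff_vert x)) (cs_y f hs x)]
    simp
  simp only [this]

/-- a smooth version of the Cauchy kernel -/
lemma exists_kernel (ω : ℂ) (ρ : ℝ) (hρ : 0 < ρ) : ∃ g : ℂ → ℂ, ContDiff ℝ 1 g ∧ ∀ w, ρ < ‖w - ω‖ → g w = (w - ω)⁻¹ := by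
  let b : ContDiffBump ω := ⟨ρ/2, ρ, by positivity, by linarith⟩
  refine ⟨fun w => (1 - b w : ℝ) * (w - ω)⁻¹, ?_, fun w hw => ?_⟩
  · rw [contDiff_iff_contDiffAt]
    intro w
    by_cases h : w = ω
    · have : (fun w => ((1 - b w : ℝ):ℂ) * (w - ω)⁻¹) =ᶠ[𝓝 w] fun _ => 0 := by
        rw [h]
        filter_upwards [b.eventuallyEq_one] with z hz
        simp [hz]
      exact contDiffAt_const.congr_of_eventuallyEq this
    · apply ContDiffAt.mul
      · exact Complex.ofRealCLM.contDiff.contDiffAt.comp w ((contDiff_const.sub b.contDiff).contDiffAt)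
      · exact ContDiffAt.inv (f := fun x => x - ω) (by fun_prop) (sub_ne_zero.2 h)
  · have : b w = 0 := b.zero_of_le_dist (by rw [dist_eq_norm]; exact hw.le)
    simp [this]

lemma dbar_mul (f g : ℂ → ℂ) (z : ℂ) (hf : DifferentiableAt ℝ f z) (hg : DifferentiableAt ℝ g z) :
    dbar (fun z => f z * g z) z = dbar f z * g z + f z * dbar g z := by
  simp only [dbar]
  rw [fderiv_fun_mul hf hg]
  simp
  ring

lemma dbar_holo (f : ℂ → ℂ) (z : ℂ) (hf : DifferentiableAt ℂ f z) : dbar f z = 0 := by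
  have h := hf.hasFDerivAt.restrictScalars ℝ
  simp only [dbar, h.fderiv]
  have : (fderiv ℂ f z) I = I * fderiv ℂ f z 1 := by
    rw [← smul_eq_mul, ← map_smul]; simp
  rw [ContinuousLinearMap.coe_restrictScalars', this]
  linear_combination (fderiv ℂ f z 1) /2 * Complex.I_sq

lemma dbar_congr {f g : ℂ → ℂ} {z : ℂ} (h : f =ᶠ[𝓝 z] g) : dbar f z = dbar g z := by
  simp only [dbar, h.fderiv_eq]

lemma kernel_prod (β : ℂ → ℂ) (hβ : ContDiff ℝ 1 β) (hs : HasCompactSupport β) (ω : ℂ) (ρ : ℝ) (hρ : 0 < ρ) :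
    ∃ f : ℂ → ℂ, ContDiff ℝ 1 f ∧ HasCompactSupport f ∧ ∀ w, ρ < ‖w - ω‖ →
      f w = β w / (w - ω) ∧ dbar f w = dbar β w / (w - ω) := by
  obtain ⟨g, hg, hg2⟩ := exists_kernel ω ρ hρ
  refine ⟨fun w => β w * g w, hβ.mul hg, hs.mul_right, fun w hw => ⟨by simp only [hg2 w hw]; rfl, ?_⟩⟩
  rw [dbar_mul _ _ _ (hβ.differentiable one_ne_zero _) (hg.differentiable one_ne_zero _), hg2 w hw]
  have h1 : g =ᶠ[𝓝 w] fun w => (w - ω)⁻¹ := by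
    have : ∀ᶠ z in 𝓝 w, ρ < ‖z - ω‖ :=
      (isOpen_lt continuous_const (by fun_prop : Continuous fun z => ‖z - ω‖)).mem_nhds hw
    filter_upwards [this] with z hz using hg2 z hz
  have hne : w - ω ≠ 0 := by
    intro h; rw [h] at hw; simp at hw; linarith
  rw [dbar_congr h1, dbar_holo (fun w => (w - ω)⁻¹) _ (by fun_prop (disch := assumption))]
  rw [div_eq_mul_inv]; ring

theorem halfplane_formula (β : ℂ → ℂ) (hβ : ContDiff ℝ 1 β) (hs : HasCompactSupport β) (ω : ℂ) (hω : 0 < ω.im) :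
    -π * β ω = (∫ w in {w : ℂ | 0 < w.im}, (dbar β w / (w - ω) + (starRingEnd ℂ) (dbar β w / (w - starRingEnd ℂ ω))))
      - ∫ x : ℝ, ((β x).im : ℂ) / (x - ω) := by
  have hmeas : MeasurableSet {z : ℂ | 0 < z.im} := measurableSet_lt measurable_const Complex.measurable_im
  have hmeas' : MeasurableSet {z : ℂ | z.im ≤ 0} := measurableSet_le Complex.measurable_im measurable_const
  have hD : Continuous (fderiv ℝ β) := hβ.continuous_fderiv one_ne_zero
  have cd : Continuous (dbar β) := by
    unfold dbar
    have c1 : Continuous (fun z => fderiv ℝ β z 1) := hD.clm_apply continuous_const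
    have cI : Continuous (fun z => fderiv ℝ β z I) := hD.clm_apply continuous_const
    fun_prop
  have sd : HasCompactSupport (dbar β) := (hs.fderiv ℝ).comp_left (g := fun L : ℂ →L[ℝ] ℂ => (L 1 + I * L I)/2) (by simp)
  obtain ⟨M, hM⟩ := sd.exists_bound_of_continuous cd
  obtain ⟨R, hR⟩ := sd.isCompact.isBounded.subset_closedBall 0
  have hR' : ∀ w, R < ‖w‖ → dbar β w = 0 := by
    intro w hw
    apply image_eq_zero_of_notMem_tsupport
    intro h; have := hR h; simp at this; linarith
  have int : ∀ ω, Integrable (fun w => dbar β w / (w - ω)) := integrable_div_sub _ cd.aestronglyMeasurable M R hM hR'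
  obtain ⟨f, hf, hfs, hfp⟩ := kernel_prod β hβ hs ω (ω.im/2) (by positivity)
  obtain ⟨f', hf', hfs', hfp'⟩ := kernel_prod β hβ hs (starRingEnd ℂ ω) (ω.im/2) (by positivity)
  have d1 : ∀ w : ℂ, w.im ≤ 0 → ω.im/2 < ‖w - ω‖ := by
    intro w hw
    have := Complex.abs_im_le_norm (w - ω)
    have h2 := neg_abs_le (w - ω).im
    simp only [Complex.sub_im] at *
    linarith
  have d2 : ∀ w : ℂ, 0 ≤ w.im → ω.im/2 < ‖w - starRingEnd ℂ ω‖ := by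
    intro w hw
    have := Complex.abs_im_le_norm (w - starRingEnd ℂ ω)
    have h2 := le_abs_self (w - starRingEnd ℂ ω).im
    simp only [Complex.sub_im, Complex.conj_im] at *
    linarith
  have G1 := green_low f hf hfs
  rw [setIntegral_congr_fun hmeas' (fun w hw => (hfp w (d1 w hw)).2)] at G1
  have G2 := green_up f' hf' hfs'
  rw [setIntegral_congr_fun hmeas (fun w hw => (hfp' w (d2 w (le_of_lt hw))).2)] at G2
  have c1 : ∀ x : ℝ, f x = β x / (x - ω) := fun x => (hfp x (d1 x (by simp))).1
  have c2 : ∀ x : ℝ, f' x = β x / (x - starRingEnd ℂ ω) := fun x => (hfp' x (d2 x (by simp))).1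
  have if1 : Integrable (fun x : ℝ => f x) :=
    (hf.continuous.comp Complex.continuous_ofReal).integrable_of_hasCompactSupport (hfs.comp_isClosedEmbedding ofReal_closedEmb)
  have if2 : Integrable (fun x : ℝ => f' x) :=
    (hf'.continuous.comp Complex.continuous_ofReal).integrable_of_hasCompactSupport (hfs'.comp_isClosedEmbedding ofReal_closedEmb)
  have CP := cauchyPompeiu β hβ hs ω
  have split := integral_add_compl hmeas (int ω)
  have hcompl : {z : ℂ | 0 < z.im}ᶜ = {z : ℂ | z.im ≤ 0} := by ext z; simp
  rw [hcompl, CP, G1] at split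
  have G2' : ∫ w in {w : ℂ | 0 < w.im}, (starRingEnd ℂ) (dbar β w / (w - starRingEnd ℂ ω)) = (I/2) * ∫ x : ℝ, (starRingEnd ℂ) (f' x) := by
    rw [integral_conj, G2, integral_conj]; simp [map_ofNat]; ring
  rw [integral_add (int ω).integrableOn, G2', ← split]
  · have : ∫ x : ℝ, ((β x).im : ℂ) / (x - ω) = (I/2) * (∫ x : ℝ, (starRingEnd ℂ) (f' x)) - (I/2) * ∫ x : ℝ, f x := by
      have if2' : Integrable (fun x : ℝ => (starRingEnd ℂ) (f' x)) := by
        have := (Complex.conjCLE : ℂ →L[ℝ] ℂ).integrable_comp if2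
        simpa using this
      rw [← mul_sub, ← integral_sub if2' if1, ← integral_const_mul]
      congr 1; ext x
      rw [c1, c2]
      have hne : (x:ℂ) - ω ≠ 0 := by
        intro h; have := congrArg Complex.im h; simp at this; linarith
      simp only [map_div₀, map_sub, Complex.conj_conj, Complex.conj_ofReal]
      rw [← sub_div, ← mul_div_assoc]
      congr 1
      have h2 : (β x) - starRingEnd ℂ (β x) = 2 * (β x).im * I := by
        rw [Complex.sub_conj]; push_cast; ring
      linear_combination (I/2) * h2 + (β x).im * Complex.I_sq
    rw [this]; ring
  · have := (Complex.conjCLE : ℂ →L[ℝ] ℂ).integrable_comp (int (starRingEnd ℂ ω))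
    have h3 : Integrable (fun w => (starRingEnd ℂ) (dbar β w / (w - starRingEnd ℂ ω))) := by
      simpa using this
    exact h3.integrableOn
end ModA2

section ModA4
open MeasureTheory
open Complex (I)

/-- upper half disc -/
def hDisc (r : ℝ) : Set ℂ := {w | ‖w‖ < r ∧ 0 < w.im}

lemma isOpen_hDisc (r : ℝ) : IsOpen (hDisc r) :=
  (isOpen_lt continuous_norm continuous_const).inter (isOpen_lt continuous_const Complex.continuous_im)

lemma shift_mem {r ε : ℝ} {w : ℂ} (hε : 0 < ε) (hε' : ε < r/4) (hw : ‖w‖ < 3*r/4) (him : -ε < w.im) :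
    w + ε * I ∈ hDisc r := by
  constructor
  · have := norm_add_le w (ε * I)
    have h2 : ‖(ε:ℂ) * I‖ = ε := by simp [abs_of_pos hε]
    linarith
  · simp; linarith

lemma continuousOn_dbar {f : ℂ → ℂ} {U : Set ℂ} (hU : IsOpen U) (hf : ContDiffOn ℝ 1 f U) : ContinuousOn (dbar f) U := by
  have h := hf.continuousOn_fderiv_of_isOpen hU le_rfl
  have c1 : ContinuousOn (fun z => fderiv ℝ f z 1) U := h.clm_apply continuousOn_const
  have cI : ContinuousOn (fun z => fderiv ℝ f z I) U := h.clm_apply continuousOn_const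
  unfold dbar
  fun_prop

lemma rep_lemma (r : ℝ) (hr : 0 < r) : ∃ C > 0, ∀ (b : ℂ → ℂ) (M : ℝ), ContDiffOn ℝ 1 b (hDisc r) →
    (∀ w ∈ hDisc r, ‖b w‖ ≤ M ∧ ‖dbar b w‖ ≤ M) →
    (∀ x : ℝ, |x| < r → Tendsto (fun ε : ℝ => (b (x + ε * I)).im) (𝓝[>] 0) (𝓝 0)) →
    ∃ h : ℂ → ℂ, AEStronglyMeasurable h ∧ (∀ w, ‖h w‖ ≤ C * M) ∧ (∀ w, r/2 < ‖w‖ → h w = 0) ∧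
      (∀ w, w ∉ hDisc r → h w = 0) ∧
      (∀ w ∈ hDisc (r/4), h w = dbar b w) ∧
      ∀ ω ∈ hDisc (r/4), -π * b ω = ∫ w, (h w / (w - ω) + (starRingEnd ℂ) (h w / (w - starRingEnd ℂ ω))) := by
  let ηb : ContDiffBump (0:ℂ) := ⟨r/4, r/2, by positivity, by linarith⟩
  set η : ℂ → ℂ := fun w => (ηb w : ℝ) with hη
  have ηc : ContDiff ℝ 1 η := contDiff_ofReal'.comp ηb.contDiff
  have ηs : HasCompactSupport η := ηb.hasCompactSupport.comp_left (g := fun x : ℝ => (x:ℂ)) (by simp)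
  have ηle : ∀ w, ‖η w‖ ≤ 1 := by
    intro w; simp only [hη, Complex.norm_real, Real.norm_of_nonneg ηb.nonneg]; exact ηb.le_one
  have η0 : ∀ w, r/2 ≤ ‖w‖ → η w = 0 := by
    intro w hw; simp only [hη]; rw [ηb.zero_of_le_dist (by simpa using hw)]; simp
  have η0' : ∀ w, r/2 < ‖w‖ → η =ᶠ[𝓝 w] fun _ => 0 := by
    intro w hw
    filter_upwards [(isOpen_lt continuous_const continuous_norm).mem_nhds hw] with z hz using η0 z (le_of_lt hz)
  have η1 : ∀ w, ‖w‖ < r/4 → η =ᶠ[𝓝 w] fun _ => 1 := by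
    intro w hw
    filter_upwards [(isOpen_lt continuous_norm continuous_const).mem_nhds hw] with z hz
    simp only [hη]; rw [ηb.one_of_mem_closedBall (by simpa using le_of_lt hz)]; simp
  have dηc : Continuous (dbar η) := by
    have := continuousOn_dbar isOpen_univ ηc.contDiffOn
    rwa [← continuousOn_univ]
  have dη0 : ∀ w, r/2 < ‖w‖ → dbar η w = 0 := by
    intro w hw; rw [dbar_congr (η0' w hw)]; simp [dbar]
  have dηs : HasCompactSupport (dbar η) := by
    refine HasCompactSupport.of_support_subset_isCompact (isCompact_closedBall (0:ℂ) (r/2)) ?_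
    intro w hw
    by_contra h
    exact hw (dη0 w (by simpa using h))
  obtain ⟨C0, hC0⟩ := dηs.exists_bound_of_continuous dηc
  have hC00 : 0 ≤ C0 := (norm_nonneg _).trans (hC0 0)
  refine ⟨C0 + 1, by positivity, fun b M hb hM hlim => ?_⟩
  have hU := isOpen_hDisc r
  have hM0 : 0 ≤ M := by
    have : ((r/2 : ℝ) * I : ℂ) ∈ hDisc r := by
      constructor
      · simp [abs_of_pos hr]; linarith
      · simp; linarith
    exact (norm_nonneg _).trans (hM _ this).1
  set h0 : ℂ → ℂ := fun w => dbar η w * b w + η w * dbar b w with hh0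
  have h0c : ContinuousOn h0 (hDisc r) :=
    (dηc.continuousOn.mul hb.continuousOn).add (ηc.continuous.continuousOn.mul (continuousOn_dbar hU hb))
  set h : ℂ → ℂ := (hDisc r).indicator h0 with hh
  have hmeas : AEStronglyMeasurable h :=
    (aestronglyMeasurable_indicator_iff hU.measurableSet).2 (h0c.aestronglyMeasurable hU.measurableSet)
  have hbd : ∀ w, ‖h w‖ ≤ (C0 + 1) * M := by
    intro w
    by_cases hw : w ∈ hDisc r
    · rw [hh, indicator_of_mem hw]
      calc ‖dbar η w * b w + η w * dbar b w‖ ≤ ‖dbar η w‖ * ‖b w‖ + ‖η w‖ * ‖dbar b w‖ := by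
            refine (norm_add_le _ _).trans ?_; simp
        _ ≤ C0 * M + 1 * M := by
            gcongr
            · exact hC0 w
            · exact (hM w hw).1
            · exact ηle w
            · exact (hM w hw).2
        _ = _ := by ring
    · rw [hh, indicator_of_notMem hw]; simp; positivity
  have hz : ∀ w, r/2 < ‖w‖ → h w = 0 := by
    intro w hw
    by_cases hw' : w ∈ hDisc r
    · rw [hh, indicator_of_mem hw']; simp [hh0, dη0 w hw, η0 w hw.le]
    · rw [hh, indicator_of_notMem hw']
  refine ⟨h, hmeas, hbd, hz, fun w hw => by rw [hh, indicator_of_notMem hw], ?_, ?_⟩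
  · intro w hw
    have hw' : w ∈ hDisc r := ⟨by linarith [hw.1], hw.2⟩
    rw [hh, indicator_of_mem hw']
    have e := η1 w hw.1
    simp only [hh0]
    rw [dbar_congr e, e.eq_of_nhds]; simp [dbar]
  intro ω hω
  set ε : ℕ → ℝ := fun n => r / (8 * (n+1)) with hε
  have εpos : ∀ n, 0 < ε n := fun n => by positivity
  have εlt : ∀ n, ε n < r/4 := by
    intro n; simp only [hε]
    rw [div_lt_div_iff₀ (by positivity) (by norm_num)]
    have : (0:ℝ) ≤ n := Nat.cast_nonneg n
    nlinarith [mul_nonneg hr.le this]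
  have ε0 : Tendsto ε atTop (𝓝[>] 0) := by
    rw [tendsto_nhdsWithin_iff]
    refine ⟨?_, Eventually.of_forall εpos⟩
    have := (tendsto_one_div_add_atTop_nhds_zero_nat (𝕜 := ℝ)).const_mul (r/8)
    simp only [mul_zero] at this
    refine this.congr fun n => ?_
    simp only [hε]; field_simp
  set χ : ℕ → ℂ → ℂ := fun n w => ((Real.smoothTransition (4 * w.im / ε n + 2) : ℝ) : ℂ) with hχ
  have χc : ∀ n, ContDiff ℝ 1 (χ n) := by
    intro n
    refine contDiff_ofReal'.comp (Real.smoothTransition.contDiff.comp ?_)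
    have : ContDiff ℝ 1 (fun w : ℂ => w.im) := Complex.imCLM.contDiff
    fun_prop
  have χ1 : ∀ n (w : ℂ), -ε n/4 ≤ w.im → χ n w = 1 := by
    intro n w hw
    simp only [hχ]
    rw [Real.smoothTransition.one_of_one_le]; · simp
    have : -1 ≤ 4 * w.im / ε n := by rw [le_div_iff₀ (εpos n)]; linarith
    linarith
  have χ0 : ∀ n (w : ℂ), w.im ≤ -ε n/2 → χ n w = 0 := by
    intro n w hw
    simp only [hχ]
    rw [Real.smoothTransition.zero_of_nonpos]; · simp
    have : 4 * w.im / ε n ≤ -2 := by rw [div_le_iff₀ (εpos n)]; linarith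
    linarith
  set β : ℕ → ℂ → ℂ := fun n w => η w * (χ n w * b (w + ε n * I)) with hβ
  have bsh : ∀ n w, ‖w‖ < 3*r/4 → -ε n < w.im → ContDiffAt ℝ 1 (fun w : ℂ => b (w + ε n * I)) w := by
    intro n w h1 h2
    have hm := shift_mem (εpos n) (εlt n) h1 h2
    exact (hb.contDiffAt (hU.mem_nhds hm)).comp w (by fun_prop)
  have βc : ∀ n, ContDiff ℝ 1 (β n) := by
    intro n
    rw [contDiff_iff_contDiffAt]
    intro w
    by_cases h1 : r/2 < ‖w‖
    · have : β n =ᶠ[𝓝 w] fun _ => 0 := by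
        filter_upwards [η0' w h1] with z hz; simp [hβ, hz]
      exact contDiffAt_const.congr_of_eventuallyEq this
    by_cases h2 : w.im < -ε n / 2
    · have : β n =ᶠ[𝓝 w] fun _ => 0 := by
        filter_upwards [(isOpen_lt Complex.continuous_im continuous_const).mem_nhds h2] with z hz
        simp [hβ, χ0 n z (le_of_lt hz)]
      exact contDiffAt_const.congr_of_eventuallyEq this
    push Not at h1 h2
    exact ηc.contDiffAt.mul ((χc n).contDiffAt.mul (bsh n w (by linarith) (by linarith [εpos n])))
  have βs : ∀ n, HasCompactSupport (β n) := fun n => ηs.mul_right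
  have F := fun n => halfplane_formula (β n) (βc n) (βs n) ω hω.2
  have χe : ∀ n (w : ℂ), 0 ≤ w.im → χ n =ᶠ[𝓝 w] fun _ => 1 := by
    intro n w hw
    have : -ε n /4 < w.im := by linarith [εpos n]
    filter_upwards [(isOpen_lt continuous_const Complex.continuous_im).mem_nhds this] with z hz using χ1 n z (le_of_lt hz)
  have dβ : ∀ n w, 0 < w.im → ‖w‖ < 3*r/4 → dbar (β n) w = dbar η w * b (w + ε n * I) + η w * dbar b (w + ε n * I) := by
    intro n w h1 h2
    have e : β n =ᶠ[𝓝 w] fun w => η w * b (w + ε n * I) := by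
      filter_upwards [χe n w h1.le] with z hz; simp [hβ, hz]
    rw [dbar_congr e, dbar_mul _ _ _ (ηc.differentiable one_ne_zero _) ((bsh n w h2 (by linarith [εpos n])).differentiableAt one_ne_zero), dbar_comp_add]
  have dβ0 : ∀ n w, r/2 < ‖w‖ → dbar (β n) w = 0 := by
    intro n w h1
    have : β n =ᶠ[𝓝 w] fun _ => 0 := by
        filter_upwards [η0' w h1] with z hz; simp [hβ, hz]
    rw [dbar_congr this]; simp [dbar]
  have dβb : ∀ n w, 0 < w.im → ‖dbar (β n) w‖ ≤ (Metric.closedBall (0:ℂ) (r/2)).indicator (fun _ => (C0+1)*M) w := by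
    intro n w h1
    by_cases h2 : r/2 < ‖w‖
    · rw [dβ0 n w h2]; simp; exact indicator_apply_nonneg fun _ => by positivity
    · push Not at h2
      rw [indicator_of_mem (by simpa using h2), dβ n w h1 (by linarith)]
      have hm := shift_mem (w := w) (εpos n) (εlt n) (by linarith) (by linarith [εpos n])
      calc _ ≤ ‖dbar η w‖ * ‖b (w + ε n * I)‖ + ‖η w‖ * ‖dbar b (w + ε n * I)‖ := by
            refine (norm_add_le _ _).trans ?_; simp
        _ ≤ C0 * M + 1 * M := by
            gcongr
            · exact hC0 w
            · exact (hM _ hm).1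
            · exact ηle w
            · exact (hM _ hm).2
        _ = _ := by ring
  have sh : ∀ w : ℂ, Tendsto (fun n => w + ε n * I) atTop (𝓝 w) := by
    intro w
    have h1 : Tendsto (fun n => (ε n : ℂ)) atTop (𝓝 ((0:ℝ):ℂ)) :=
      (Complex.continuous_ofReal.tendsto 0).comp (ε0.mono_right nhdsWithin_le_nhds)
    have := (h1.mul_const I).const_add w
    simpa using this
  have dβl : ∀ w, 0 < w.im → Tendsto (fun n => dbar (β n) w) atTop (𝓝 (h w)) := by
    intro w h1
    by_cases h2 : r/2 < ‖w‖
    · rw [hz w h2]; simp [dβ0 _ w h2]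
    · push Not at h2
      have hm : w ∈ hDisc r := ⟨by linarith, h1⟩
      rw [hh, indicator_of_mem hm]
      simp only [dβ _ w h1 (show ‖w‖ < 3*r/4 by linarith)]
      have cb := (hb.continuousOn.continuousAt (hU.mem_nhds hm)).tendsto.comp (sh w)
      have cdb := ((continuousOn_dbar hU hb).continuousAt (hU.mem_nhds hm)).tendsto.comp (sh w)
      exact (cb.const_mul _).add (cdb.const_mul _)
  have L1 : Tendsto (fun n => -π * β n ω) atTop (𝓝 (-π * b ω)) := by
    apply Tendsto.const_mul
    have hm : ω ∈ hDisc r := ⟨by linarith [hω.1], hω.2⟩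
    have cb := (hb.continuousOn.continuousAt (hU.mem_nhds hm)).tendsto.comp (sh ω)
    refine cb.congr fun n => ?_
    simp only [hβ, (χe n ω hω.2.le).eq_of_nhds, (η1 ω hω.1).eq_of_nhds]; simp
  have hUp : MeasurableSet {z : ℂ | 0 < z.im} := measurableSet_lt measurable_const Complex.measurable_im
  have intB : ∀ ω : ℂ, Integrable (fun w : ℂ => (Metric.closedBall (0:ℂ) (r/2)).indicator (fun _ => (C0+1)*M) w / ‖w - ω‖) := by
    intro ω
    have := integrable_div_sub (fun w => (((Metric.closedBall (0:ℂ) (r/2)).indicator (fun _ => (C0+1)*M) w : ℝ) : ℂ)) ?_ ((C0+1)*M) (r/2) ?_ ?_ ω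
    · refine this.norm.congr (Eventually.of_forall fun w => ?_)
      simp only [norm_div, Complex.norm_real]
      rw [Real.norm_of_nonneg (indicator_apply_nonneg fun _ => by positivity)]
    · apply Measurable.aestronglyMeasurable
      exact Complex.measurable_ofReal.comp (measurable_const.indicator measurableSet_closedBall)
    · intro w
      rw [Complex.norm_real, Real.norm_of_nonneg (indicator_apply_nonneg fun _ => by positivity)]
      exact indicator_apply_le' (fun _ => le_rfl) (fun _ => by positivity)
    · intro w hw
      rw [indicator_of_notMem (by simpa using hw)]; simp
  have L2 : Tendsto (fun n => ∫ w in {w : ℂ | 0 < w.im}, (dbar (β n) w / (w - ω) + (starRingEnd ℂ) (dbar (β n) w / (w - starRingEnd ℂ ω)))) atTop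
      (𝓝 (∫ w in {w : ℂ | 0 < w.im}, (h w / (w - ω) + (starRingEnd ℂ) (h w / (w - starRingEnd ℂ ω))))) := by
    apply tendsto_integral_of_dominated_convergence (fun w : ℂ => (Metric.closedBall (0:ℂ) (r/2)).indicator (fun _ => (C0+1)*M) w / ‖w - ω‖ + (Metric.closedBall (0:ℂ) (r/2)).indicator (fun _ => (C0+1)*M) w / ‖w - starRingEnd ℂ ω‖)
    · intro n
      have c : Measurable (dbar (β n)) := by
        have := continuousOn_dbar isOpen_univ (βc n).contDiffOn
        rw [continuousOn_univ] at this
        exact this.measurable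
      have c2 : Measurable (fun z : ℂ => starRingEnd ℂ z) := Complex.continuous_conj.measurable
      apply Measurable.aestronglyMeasurable
      exact (c.div (by fun_prop)).add (c2.comp (c.div (by fun_prop)))
    · exact ((intB _).add (intB _)).integrableOn
    · intro n
      filter_upwards [ae_restrict_mem hUp] with w hw
      refine (norm_add_le _ _).trans ?_
      rw [RCLike.norm_conj, norm_div, norm_div]
      gcongr <;> exact dβb n w hw
    · filter_upwards [ae_restrict_mem hUp] with w hw
      have := dβl w hw
      exact (this.div_const _).add ((Complex.continuous_conj.tendsto _).comp (this.div_const _))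
  have L3 : Tendsto (fun n => ∫ x : ℝ, ((β n x).im : ℂ) / (x - ω)) atTop (𝓝 (∫ x : ℝ, (0:ℂ))) := by
    apply tendsto_integral_of_dominated_convergence (fun x : ℝ => (Icc (-(r/2)) (r/2)).indicator (fun _ => M / ω.im) x)
    · intro n
      apply Measurable.aestronglyMeasurable
      have : Measurable (β n) := (βc n).continuous.measurable
      fun_prop
    · rw [integrable_indicator_iff measurableSet_Icc]
      exact integrableOn_const (by simp)
    · intro n
      refine Eventually.of_forall fun x => ?_
      by_cases hx : x ∈ Icc (-(r/2)) (r/2)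
      · rw [indicator_of_mem hx, norm_div]
        have hx' : ‖(x:ℂ)‖ ≤ r/2 := by simpa using abs_le.2 hx
        have h1 : ω.im ≤ ‖(x:ℂ) - ω‖ := by
          have := Complex.abs_im_le_norm ((x:ℂ) - ω)
          simp at this; exact (le_abs_self _).trans this
        have hm := shift_mem (w := (x:ℂ)) (εpos n) (εlt n) (by linarith) (by simp; exact εpos n)
        have h2 : ‖((β n x).im : ℂ)‖ ≤ M := by
          rw [Complex.norm_real]
          refine (Complex.abs_im_le_norm _).trans ?_
          simp only [hβ, (χe n x (by simp)).eq_of_nhds, one_mul, norm_mul]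
          calc _ ≤ 1 * M := by
                gcongr
                · exact ηle _
                · exact (hM _ hm).1
            _ = M := one_mul M
        have := hω.2
        gcongr
      · rw [indicator_of_notMem hx]
        have hx' : r/2 ≤ ‖(x:ℂ)‖ := by
          have : ¬ |x| ≤ r/2 := fun h => hx (abs_le.1 h)
          simp; linarith
        simp [hβ, η0 _ hx']
    · refine Eventually.of_forall fun x => ?_
      by_cases hx : |x| < r
      · have h1 : Tendsto (fun n => (β n x).im) atTop (𝓝 0) := by
          have := ((hlim x hx).comp ε0).const_mul (ηb x)
          rw [mul_zero] at this
          refine this.congr fun n => ?_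
          simp only [hβ, (χe n x (by simp)).eq_of_nhds, one_mul, hη, Complex.re_ofReal_mul, Complex.im_ofReal_mul, Function.comp]
        have h2 := ((Complex.continuous_ofReal.tendsto 0).comp h1).div_const ((x:ℂ) - ω)
        simpa using h2
      · have hx' : r/2 ≤ ‖(x:ℂ)‖ := by
          simp; linarith
        simp [hβ, η0 _ hx']
  have L := tendsto_nhds_unique L1 ((L2.sub L3).congr fun n => (F n).symm)
  rw [L, integral_zero, sub_zero]
  apply setIntegral_eq_integral_of_forall_compl_eq_zero
  intro w hw
  have : w ∉ hDisc r := fun h => hw h.2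
  rw [hh, indicator_of_notMem this]; simp
end ModA4

section ModA4b
open MeasureTheory
open Complex (I)

lemma geom_kernel (N : ℕ) (w ω : ℂ) (hw : w ≠ 0) (h : w ≠ ω) :
    1 / (w - ω) = (∑ j ∈ Finset.range N, ω ^ j / w ^ (j+1)) + ω ^ N / (w ^ N * (w - ω)) := by
  have h' : w - ω ≠ 0 := sub_ne_zero.2 h
  induction N with
  | zero => simp
  | succ n ih =>
    rw [ih, Finset.sum_range_succ, add_assoc]
    congr 1
    field_simp
    ring

lemma step_lemma (r : ℝ) (hr : 0 < r) (hr1 : r ≤ 1) (N : ℕ) (hN : 1 ≤ N) (hN3 : N ≤ 3) :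
    ∃ C > 0, ∀ (b : ℂ → ℂ) (M : ℝ), ContDiffOn ℝ 1 b (hDisc r) →
    (∀ w ∈ hDisc r, ‖b w‖ ≤ M ∧ ‖dbar b w‖ ≤ M) →
    (∀ w ∈ hDisc r, ‖dbar b w‖ ≤ M * ‖w‖ ^ ((N:ℝ) - 3/2)) →
    (∀ x : ℝ, |x| < r → Tendsto (fun ε : ℝ => (b (x + ε * I)).im) (𝓝[>] 0) (𝓝 0)) →
    ∃ c : ℕ → ℝ, (∀ j < N, |c j| ≤ C * M) ∧
      ∀ ω ∈ hDisc (r/4), ‖b ω - ∑ j ∈ Finset.range N, (c j : ℂ) * ω ^ j‖ ≤ C * M * ‖ω‖ ^ ((N:ℝ) - 1/2) := by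
  obtain ⟨C0, hC0, rep⟩ := rep_lemma r hr
  obtain ⟨C3, hC3, ker⟩ := kernel_bound
  set C1 := max 1 (C0 * (4/r)^2) with hC1
  have hC1p : 0 < C1 := lt_of_lt_of_le one_pos (le_max_left _ _)
  refine ⟨8 * C1 + 2 * C1 * C3, by positivity, fun b M hb hM hM2 hlim => ?_⟩
  obtain ⟨h, hmeas, hbd, hz, hzU, heq, hrep⟩ := rep b M hb hM hlim
  have hU := isOpen_hDisc r
  have hM0 : 0 ≤ M := by
    have : ((r/2 : ℝ) * I : ℂ) ∈ hDisc r := by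
      constructor
      · simp [abs_of_pos hr]; linarith
      · simp; linarith
    exact (norm_nonneg _).trans (hM _ this).1
  have hNr : (1:ℝ) ≤ N := by exact_mod_cast hN
  have hNr3 : (N:ℝ) ≤ 3 := by exact_mod_cast hN3
  have hb2 : ∀ w, w ≠ 0 → (w ∈ hDisc r ∨ h w = 0) → ‖h w‖ ≤ C1 * M * ‖w‖ ^ ((N:ℝ) - 3/2) := by
    intro w hw0 hw'
    have hwp : 0 < ‖w‖ := norm_pos_iff.2 hw0
    rcases hw' with hw' | hw'
    swap
    · rw [hw']; simp; positivity
    by_cases h1 : ‖w‖ < r/4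
    · rw [heq w ⟨h1, hw'.2⟩]
      refine (hM2 w hw').trans ?_
      rw [mul_assoc]
      exact le_mul_of_one_le_left (by positivity) (le_max_left _ _)
    · by_cases h2 : r/2 < ‖w‖
      · rw [hz w h2]; simp; positivity
      push Not at h1 h2
      have e1 : (r/4)^2 ≤ ‖w‖ ^ ((N:ℝ) - 3/2) := by
        calc (r/4)^2 ≤ ‖w‖^2 := by gcongr
          _ = ‖w‖ ^ (2:ℝ) := by norm_cast
          _ ≤ _ := Real.rpow_le_rpow_of_exponent_ge hwp (by linarith) (by linarith)
      calc ‖h w‖ ≤ C0 * M := hbd w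
        _ = (C0 * (4/r)^2) * M * (r/4)^2 := by field_simp
        _ ≤ C1 * M * ‖w‖ ^ ((N:ℝ) - 3/2) := by
          gcongr
          exact le_max_right _ _
  have hb3 : ∀ w, w ≠ 0 → ‖h w‖ ≤ C1 * M * ‖w‖ ^ ((N:ℝ) - 3/2) := by
    intro w hw
    apply hb2 w hw
    by_cases h' : w ∈ hDisc r
    · exact Or.inl h'
    · exact Or.inr (hzU w h')
  obtain ⟨i1, e1⟩ := rad_near (-(3/2)) 1 (by norm_num) one_pos
  have ne0 : ∀ᵐ w : ℂ, w ≠ 0 := Measure.ae_ne volume 0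
  have Tb : ∀ j < N, ∀ w : ℂ, w ≠ 0 → ‖h w / w ^ (j+1)‖ ≤ C1 * M * (Iio (1:ℝ)).indicator (fun y => y ^ (-(3/2):ℝ)) ‖w‖ := by
    intro j hj w hw
    have hwp : 0 < ‖w‖ := norm_pos_iff.2 hw
    by_cases h1 : ‖w‖ < 1
    · rw [indicator_of_mem (show ‖w‖ ∈ Iio (1:ℝ) from h1), norm_div, norm_pow, div_le_iff₀ (by positivity), mul_assoc,
        ← Real.rpow_natCast ‖w‖ (j+1), ← Real.rpow_add hwp]
      refine (hb3 w hw).trans ?_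
      gcongr ?_ * ?_
      apply Real.rpow_le_rpow_of_exponent_ge hwp h1.le
      have : (j:ℝ) + 1 ≤ N := by exact_mod_cast hj
      push_cast; linarith
    · rw [hz w (by linarith)]; simp
      exact mul_nonneg (by positivity) (indicator_apply_nonneg fun _ => by positivity)
  have Tm : ∀ j, AEStronglyMeasurable (fun w => h w / w ^ (j+1)) := by
    intro j
    simp only [div_eq_mul_inv]
    exact hmeas.mul (Measurable.aestronglyMeasurable (by fun_prop))
  have Ti : ∀ j < N, Integrable (fun w => h w / w ^ (j+1)) := by
    intro j hj
    refine (i1.const_mul (C1 * M)).mono' (Tm j) ?_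
    filter_upwards [ne0] with w hw using Tb j hj w hw
  have TI : ∀ j < N, ‖∫ w, h w / w ^ (j+1)‖ ≤ C1 * M * (2 * π * 2) := by
    intro j hj
    calc _ ≤ ∫ w : ℂ, C1 * M * (Iio (1:ℝ)).indicator (fun y => y ^ (-(3/2):ℝ)) ‖w‖ := by
          refine norm_integral_le_of_norm_le (i1.const_mul _) ?_
          filter_upwards [ne0] with w hw using Tb j hj w hw
      _ = _ := by rw [integral_const_mul, e1]; norm_num
  have Sb : ∀ ω w : ℂ, w ≠ 0 → ‖h w / (w ^ N * (w - ω))‖ ≤ C1 * M * (‖w‖ ^ (-(3/2):ℝ) / ‖w - ω‖) := by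
    intro ω w hw
    have hwp : 0 < ‖w‖ := norm_pos_iff.2 hw
    rw [norm_div, norm_mul, norm_pow, ← div_div, ← mul_div_assoc]
    gcongr
    rw [div_le_iff₀ (by positivity), mul_assoc, ← Real.rpow_natCast ‖w‖ N, ← Real.rpow_add hwp]
    refine (hb3 w hw).trans (le_of_eq ?_)
    congr 2; ring
  have Sm : ∀ ω : ℂ, AEStronglyMeasurable (fun w => h w / (w ^ N * (w - ω))) := by
    intro ω
    simp only [div_eq_mul_inv]
    exact hmeas.mul (Measurable.aestronglyMeasurable (by fun_prop))
  have Si : ∀ ω : ℂ, ω ≠ 0 → Integrable (fun w => h w / (w ^ N * (w - ω))) := by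
    intro ω hω
    refine ((ker ω hω).1.const_mul (C1 * M)).mono' (Sm ω) ?_
    filter_upwards [ne0] with w hw using Sb ω w hw
  have SI : ∀ ω : ℂ, ω ≠ 0 → ‖∫ w, h w / (w ^ N * (w - ω))‖ ≤ C1 * M * (C3 * ‖ω‖ ^ (-(1/2):ℝ)) := by
    intro ω hω
    calc _ ≤ ∫ w : ℂ, C1 * M * (‖w‖ ^ (-(3/2):ℝ) / ‖w - ω‖) := by
          refine norm_integral_le_of_norm_le ((ker ω hω).1.const_mul _) ?_
          filter_upwards [ne0] with w hw using Sb ω w hw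
      _ ≤ _ := by rw [integral_const_mul]; gcongr; exact (ker ω hω).2
  set t : ℕ → ℂ := fun j => ∫ w, h w / w ^ (j+1) with ht
  refine ⟨fun j => -(2 / π) * (t j).re, fun j hj => ?_, fun ω hω => ?_⟩
  · have h1 := (Complex.abs_re_le_norm (t j)).trans (TI j hj)
    rw [abs_mul, abs_neg, abs_of_pos (by positivity : 0 < 2/π)]
    calc 2/π * |(t j).re| ≤ 2/π * (C1 * M * (2 * π * 2)) := by gcongr
      _ = 8 * C1 * M := by field_simp; ring
      _ ≤ _ := by
        have : 0 ≤ 2 * C1 * C3 * M := by positivity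
        linarith
  have hω0 : ω ≠ 0 := by
    intro h; have := hω.2; rw [h] at this; simp at this
  have hω0' : starRingEnd ℂ ω ≠ 0 := by simpa using hω0
  have key : ∀ ω : ℂ, ω ≠ 0 → ∫ w, h w / (w - ω) = ∑ j ∈ Finset.range N, ω ^ j * t j + ω ^ N * ∫ w, h w / (w ^ N * (w - ω)) := by
    intro ω hω
    rw [← integral_const_mul]
    simp only [ht, ← integral_const_mul]
    rw [← integral_finset_sum, ← integral_add]
    · apply integral_congr_ae
      filter_upwards [ne0, Measure.ae_ne volume ω] with w hw hw'
      rw [div_eq_mul_one_div, geom_kernel N w ω hw hw', mul_add, Finset.mul_sum]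
      congr 1
      · apply Finset.sum_congr rfl; intro j _; ring
      · ring
    · apply integrable_finset_sum; intro j hj
      exact (Ti j (Finset.mem_range.1 hj)).const_mul _
    · exact (Si ω hω).const_mul _
    · intro j hj
      exact (Ti j (Finset.mem_range.1 hj)).const_mul _
  have iK : ∀ ω : ℂ, Integrable (fun w => h w / (w - ω)) := integrable_div_sub h hmeas _ _ hbd hz
  have R := hrep ω hω
  have ic : Integrable (fun w => starRingEnd ℂ (h w / (w - starRingEnd ℂ ω))) := by
    have := (Complex.conjCLE : ℂ →L[ℝ] ℂ).integrable_comp (iK (starRingEnd ℂ ω))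
    simpa using this
  rw [integral_add (iK ω) ic, integral_conj, key ω hω0, key _ hω0'] at R
  have hπ : (π:ℂ) ≠ 0 := by exact_mod_cast pi_ne_zero
  have D : b ω - ∑ j ∈ Finset.range N, ((-(2 / π) * (t j).re : ℝ) : ℂ) * ω ^ j =
      -(1/π) * (ω ^ N * ((∫ w, h w / (w ^ N * (w - ω))) + starRingEnd ℂ (∫ w, h w / (w ^ N * (w - starRingEnd ℂ ω))))) := by
    have e : b ω = -(1/π) * (-π * b ω) := by field_simp
    rw [e, R]
    simp only [map_add, map_mul, map_sum, map_pow, Complex.conj_conj]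
    have : ∑ j ∈ Finset.range N, ((-(2 / π) * (t j).re : ℝ) : ℂ) * ω ^ j = -(1/π) * (∑ j ∈ Finset.range N, ω ^ j * t j + ∑ j ∈ Finset.range N, ω ^ j * starRingEnd ℂ (t j)) := by
      rw [← Finset.sum_add_distrib, Finset.mul_sum]
      apply Finset.sum_congr rfl; intro j _
      rw [← mul_add, Complex.add_conj]; push_cast; ring
    rw [this]; ring
  rw [D, norm_mul, norm_mul, norm_pow]
  have n1 : ‖-(1/(π:ℂ))‖ ≤ 1 := by
    rw [norm_neg, norm_div, Complex.norm_real, Real.norm_of_nonneg pi_pos.le]; simp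
    exact inv_le_one_of_one_le₀ (by linarith [pi_gt_three])
  have hωp : 0 < ‖ω‖ := norm_pos_iff.2 hω0
  have e2 : ‖ω‖ ^ ((N:ℝ) - 1/2) = ‖ω‖ ^ N * ‖ω‖ ^ (-(1/2):ℝ) := by
    rw [← Real.rpow_natCast, ← Real.rpow_add hωp]; congr 1
  calc _ ≤ 1 * (‖ω‖ ^ N * (C1 * M * (C3 * ‖ω‖ ^ (-(1/2):ℝ)) + C1 * M * (C3 * ‖ω‖ ^ (-(1/2):ℝ)))) := by
        gcongr
        refine (norm_add_le _ _).trans ?_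
        rw [RCLike.norm_conj]
        have s2 := SI _ hω0'
        rw [RCLike.norm_conj] at s2
        exact add_le_add (SI ω hω0) s2
    _ = 2 * C1 * C3 * M * ‖ω‖ ^ ((N:ℝ) - 1/2) := by rw [e2]; ring
    _ ≤ _ := by
      gcongr
      nlinarith
end ModA4b

section ModA5
open MeasureTheory
open Complex (I)

lemma exists_cutoff (a b : ℝ) (ha : 0 < a) (hab : a < b) : ∃ η : ℂ → ℂ, ContDiff ℝ 2 η ∧ (∀ w, ‖η w‖ ≤ 1) ∧
    (∀ w, ‖w‖ ≤ a → η w = 1) ∧ (∀ w, b ≤ ‖w‖ → η w = 0) := by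
  let ηb : ContDiffBump (0:ℂ) := ⟨a, b, ha, hab⟩
  refine ⟨fun w => (ηb w : ℝ), ?_, fun w => ?_, fun w hw => ?_, fun w hw => ?_⟩
  · exact Complex.ofRealCLM.contDiff.comp ηb.contDiff
  · simp only [Complex.norm_real, Real.norm_of_nonneg ηb.nonneg]; exact ηb.le_one
  · simp only []; rw [ηb.one_of_mem_closedBall (by simpa using hw)]; simp
  · simp only []; rw [ηb.zero_of_le_dist (by simpa using hw)]; simp

lemma dbar_const (z c : ℂ) : dbar (fun _ => c) z = 0 := by simp [dbar]

lemma contDiff_dbar {η : ℂ → ℂ} (h : ContDiff ℝ 2 η) : ContDiff ℝ 1 (dbar η) := by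
  have h1 : ContDiff ℝ 1 (fderiv ℝ η) := h.fderiv_right (by norm_num)
  unfold dbar
  fun_prop

lemma grad_unit : ∃ C > 0, ∀ (e : ℂ → ℂ) (S L : ℝ), ContDiffOn ℝ 1 e (Metric.ball 0 2) →
    (∀ z ∈ Metric.ball (0:ℂ) 2, ‖e z‖ ≤ S) →
    (∀ z ∈ Metric.ball (0:ℂ) 2, ∀ z' ∈ Metric.ball (0:ℂ) 2, ‖dbar e z - dbar e z'‖ ≤ L * ‖z - z'‖) →
    ‖fderiv ℝ e 0‖ ≤ C * (S + L) := by
  obtain ⟨η, ηc, ηle, η1, η0⟩ := exists_cutoff (1/4) (1/2) (by norm_num) (by norm_num)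
  obtain ⟨χ, χc, χle, χ1, χ0⟩ := exists_cutoff (7/4) (15/8) (by norm_num) (by norm_num)
  have ηd := contDiff_dbar ηc
  have dη0 : ∀ w, 1/2 < ‖w‖ → dbar η w = 0 := by
    intro w hw
    have : η =ᶠ[𝓝 w] fun _ => 0 := by
      filter_upwards [(isOpen_lt continuous_const continuous_norm).mem_nhds hw] with z hz using η0 z (le_of_lt hz)
    rw [dbar_congr this, dbar_const]
  have dη1 : ∀ w, ‖w‖ < 1/4 → dbar η w = 0 := by
    intro w hw
    have : η =ᶠ[𝓝 w] fun _ => 1 := by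
      filter_upwards [(isOpen_lt continuous_norm continuous_const).mem_nhds hw] with z hz using η1 z (le_of_lt hz)
    rw [dbar_congr this, dbar_const]
  have Kc : ContDiff ℝ 1 (fun w => dbar η w / w) := by
    rw [contDiff_iff_contDiffAt]
    intro w
    by_cases hw : ‖w‖ < 1/4
    · refine (contDiffAt_const (c := (0:ℂ))).congr_of_eventuallyEq ?_
      filter_upwards [(isOpen_lt continuous_norm continuous_const).mem_nhds hw] with z hz
      rw [dη1 z hz]; simp
    · have hw0 : w ≠ 0 := by rintro rfl; simp at hw
      simp only [div_eq_mul_inv]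
      exact ηd.contDiffAt.mul ((contDiffAt_inv ℂ hw0).restrict_scalars ℝ)
  have Ks : HasCompactSupport (fun w => dbar η w / w) := by
    refine HasCompactSupport.of_support_subset_isCompact (isCompact_closedBall (0:ℂ) (1/2)) ?_
    intro w hw
    by_contra h
    exact hw (by simp only; rw [dη0 w (by simpa using h)]; simp)
  obtain ⟨CK, hCK⟩ := Kc.lipschitzWith_of_hasCompactSupport Ks one_ne_zero
  have int1 : Integrable (fun w => η w / w) := by
    simpa using integrable_div_sub η ηc.continuous.aestronglyMeasurable 1 1 ηle (fun w hw => η0 w (by linarith)) 0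
  set I1 := ∫ w, ‖η w / w‖ with hI1
  have hI10 : 0 ≤ I1 := integral_nonneg fun _ => norm_nonneg _
  set V := (volume (Metric.ball (0:ℂ) 2)).toReal with hV
  have hV0 : 0 ≤ V := ENNReal.toReal_nonneg
  refine ⟨(CK * V + I1 + 1), by positivity, fun e S L he hS hL => ?_⟩
  have hS0 : 0 ≤ S := (norm_nonneg _).trans (hS 0 (by simp))
  have hL0 : 0 ≤ L := by
    have := (norm_nonneg _).trans (hL 1 (by simp) 0 (by simp))
    simpa using this
  set g : ℂ → ℂ := fun w => χ w * e w with hg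
  have gc : ContDiff ℝ 1 g := by
    rw [contDiff_iff_contDiffAt]
    intro w
    by_cases hw : ‖w‖ < 2
    · exact (χc.contDiffAt.of_le (by norm_num)).mul (he.contDiffAt (Metric.isOpen_ball.mem_nhds (by simpa using hw)))
    · refine (contDiffAt_const (c := (0:ℂ))).congr_of_eventuallyEq ?_
      have hw : 15/8 < ‖w‖ := by linarith
      filter_upwards [(isOpen_lt continuous_const continuous_norm).mem_nhds hw] with z hz
      simp only [hg]; rw [χ0 z (le_of_lt hz)]; simp
  have g0 : ∀ w, 2 ≤ ‖w‖ → g w = 0 := fun w hw => by simp only [hg]; rw [χ0 w (by linarith)]; simp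
  have gS : ∀ w, ‖g w‖ ≤ S := by
    intro w
    by_cases hw : ‖w‖ < 2
    · rw [hg, norm_mul]
      calc _ ≤ 1 * S := mul_le_mul (χle w) (hS w (by simpa using hw)) (norm_nonneg _) (by norm_num)
        _ = S := one_mul S
    · rw [g0 w (by linarith)]; simpa using hS0
  have ge : ∀ w, ‖w‖ < 7/4 → g =ᶠ[𝓝 w] e := by
    intro w hw
    filter_upwards [(isOpen_lt continuous_norm continuous_const).mem_nhds hw] with z hz
    simp only [hg]; rw [χ1 z (le_of_lt hz), one_mul]
  have gdc : Continuous (dbar g) := by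
    have := continuousOn_dbar isOpen_univ gc.contDiffOn
    rwa [← continuousOn_univ]
  have gs : HasCompactSupport g := by
    refine HasCompactSupport.of_support_subset_isCompact (isCompact_closedBall (0:ℂ) 2) ?_
    intro w hw
    by_contra h
    exact hw (g0 w (by have : 2 < ‖w‖ := (by simpa using h)
                       linarith))
  have int2 : ∀ s : ℂ, Integrable (fun w => dbar η w / w * g (w + s)) := fun s =>
    (Kc.continuous.mul (gc.continuous.comp (by fun_prop))).integrable_of_hasCompactSupport Ks.mul_right
  have int3 : ∀ s : ℂ, Integrable (fun w => η w / w * dbar g (w + s)) := by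
    intro s
    have cc : Continuous (fun w => η w * dbar g (w + s)) := ηc.continuous.mul (gdc.comp (by fun_prop))
    have cs : HasCompactSupport (fun w => η w * dbar g (w + s)) := by
      refine HasCompactSupport.of_support_subset_isCompact (isCompact_closedBall (0:ℂ) (1/2)) ?_
      intro w hw
      by_contra h
      have h : 1/2 < ‖w‖ := by simpa using h
      exact hw (by simp only; rw [η0 w h.le]; simp)
    obtain ⟨M, hM⟩ := cs.exists_bound_of_continuous cc
    have := integrable_div_sub _ cc.aestronglyMeasurable M 1 hM (fun w hw => by rw [η0 w (by linarith)]; simp) 0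
    refine this.congr (Eventually.of_forall fun w => ?_)
    simp only [sub_zero]; ring
  have rep : ∀ s : ℂ, -π * g s = (∫ w, dbar η w / w * g (w + s)) + ∫ w, η w / w * dbar g (w + s) := by
    intro s
    have h1 := cauchyPompeiu_zero (fun w => η w * g (w + s)) ((ηc.of_le (by norm_num)).mul (gc.comp (by fun_prop))) (by
      refine HasCompactSupport.of_support_subset_isCompact (isCompact_closedBall (0:ℂ) (1/2)) ?_
      intro w hw
      by_contra h
      have h : 1/2 < ‖w‖ := by simpa using h
      exact hw (by simp only; rw [η0 w h.le]; simp))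
    rw [η1 0 (by simp), one_mul, zero_add] at h1
    rw [← h1, ← integral_add (int2 s) (int3 s)]
    have gw : ∀ w, DifferentiableAt ℝ (fun w => g (w + s)) w := fun w =>
      DifferentiableAt.comp (g := g) w (gc.differentiable one_ne_zero _) (by fun_prop)
    congr 1; ext w
    rw [dbar_mul _ _ _ (ηc.differentiable (by norm_num) _) (gw w), dbar_comp_add]
    ring
  have tr : ∀ s : ℂ, (∫ w, dbar η w / w * g (w + s)) = ∫ w, dbar η (w - s) / (w - s) * g w := by
    intro s
    rw [← integral_sub_right_eq_self _ s]
    simp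
  have key : ∀ s : ℂ, ‖s‖ < 1 → ‖g s - g 0‖ ≤ ((CK * V + I1 + 1) * (S + L)) * ‖s‖ := by
    intro s hs
    have r1 := rep s
    have r0 := rep 0
    have i0 := int2 0
    have j0 := int3 0
    simp only [add_zero] at r0 i0 j0
    have is : Integrable (fun w => dbar η (w - s) / (w - s) * g w) := by
      have := (int2 s).comp_sub_right s
      simpa using this
    rw [tr s] at r1
    have e1 : -π * (g s - g 0) = (∫ w, (dbar η (w - s) / (w - s) - dbar η w / w) * g w) + ∫ w, η w / w * (dbar g (w + s) - dbar g w) := by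
      simp only [sub_mul, mul_sub]
      rw [r1, r0, integral_sub is i0, integral_sub (int3 s) j0]; ring
    have b1 : ‖∫ w, (dbar η (w - s) / (w - s) - dbar η w / w) * g w‖ ≤ CK * ‖s‖ * S * V := by
      rw [← setIntegral_eq_integral_of_forall_compl_eq_zero (s := Metric.ball (0:ℂ) 2) (fun w hw => by
        rw [g0 w (by simpa using hw), mul_zero])]
      refine norm_setIntegral_le_of_norm_le_const measure_ball_lt_top (fun w _ => ?_)
      rw [norm_mul]
      have := hCK.dist_le_mul (w - s) w
      rw [dist_eq_norm, dist_eq_norm] at this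
      simp only [sub_sub_cancel_left, norm_neg] at this
      exact mul_le_mul this (gS w) (norm_nonneg _) (by positivity)
    have b2 : ‖∫ w, η w / w * (dbar g (w + s) - dbar g w)‖ ≤ L * ‖s‖ * I1 := by
      rw [hI1, ← integral_const_mul]
      refine norm_integral_le_of_norm_le (int1.norm.const_mul _) (Eventually.of_forall fun w => ?_)
      rw [norm_mul, mul_comm]
      by_cases hw : ‖w‖ < 1/2
      · gcongr
        have hws : ‖w + s‖ < 7/4 := (norm_add_le _ _).trans_lt (by linarith)
        rw [dbar_congr (ge _ hws), dbar_congr (ge w (by linarith))]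
        refine (hL _ (by simp; linarith) _ (by simp; linarith)).trans (by simp)
      · rw [η0 w (by linarith)]; simp
    have b3 : π * ‖g s - g 0‖ ≤ CK * ‖s‖ * S * V + L * ‖s‖ * I1 := by
      calc π * ‖g s - g 0‖ = ‖(-π : ℂ) * (g s - g 0)‖ := by rw [norm_mul]; simp [abs_of_pos pi_pos]
        _ ≤ _ := by rw [e1]; exact (norm_add_le _ _).trans (add_le_add b1 b2)
    have b4 : ‖g s - g 0‖ ≤ π * ‖g s - g 0‖ := le_mul_of_one_le_left (norm_nonneg _) (by linarith [pi_gt_three])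
    have p1 : 0 ≤ CK * V * L * ‖s‖ := by positivity
    have p2 : 0 ≤ I1 * S * ‖s‖ := by positivity
    have p3 : 0 ≤ (S + L) * ‖s‖ := by positivity
    nlinarith
  rw [← (ge 0 (by norm_num)).fderiv_eq]
  refine norm_fderiv_le_of_lip' ℝ (by positivity) ?_
  filter_upwards [Metric.ball_mem_nhds (0:ℂ) one_pos] with s hs
  simpa using key s (by simpa using hs)

lemma dbar_comp_affine (f : ℂ → ℂ) (w : ℂ) (t : ℝ) (z : ℂ) (hf : DifferentiableAt ℝ f (w + t * z)) :
    HasFDerivAt (fun z => f (w + t * z)) (t • fderiv ℝ f (w + t * z)) z ∧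
    dbar (fun z => f (w + t * z)) z = t * dbar f (w + t * z) := by
  have h : HasFDerivAt (fun z => f (w + t * z)) (t • fderiv ℝ f (w + t * z)) z := by
    have h1 : HasFDerivAt (fun z : ℂ => w + t * z) (t • ContinuousLinearMap.id ℝ ℂ) z := by
      have := ((hasFDerivAt_id (𝕜 := ℝ) z).const_smul t).const_add w
      simpa using this
    have := hf.hasFDerivAt.comp z h1
    rw [ContinuousLinearMap.comp_smul, ContinuousLinearMap.comp_id] at this
    exact this
  refine ⟨h, ?_⟩
  simp only [dbar, h.fderiv]
  simp
  ring

lemma grad_scaled : ∃ C > 0, ∀ (e : ℂ → ℂ) (S L : ℝ) (z0 : ℂ) (δ : ℝ), 0 < δ → ContDiffOn ℝ 1 e (Metric.ball z0 δ) →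
    (∀ z ∈ Metric.ball z0 δ, ‖e z‖ ≤ S) →
    (∀ z ∈ Metric.ball z0 δ, ∀ z' ∈ Metric.ball z0 δ, ‖dbar e z - dbar e z'‖ ≤ L * ‖z - z'‖) →
    δ * ‖fderiv ℝ e z0‖ ≤ C * (S + δ ^ 2 * L) := by
  obtain ⟨C, hC, h⟩ := grad_unit
  refine ⟨2 * C, by positivity, fun e S L z0 δ hδ he hS hL => ?_⟩
  set t := δ / 2 with ht
  have tp : 0 < t := by positivity
  have mem : ∀ z ∈ Metric.ball (0:ℂ) 2, z0 + t * z ∈ Metric.ball z0 δ := by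
    intro z hz
    simp at hz
    simp [abs_of_pos tp]
    calc t * ‖z‖ < t * 2 := by gcongr
      _ = δ := by rw [ht]; ring
  have df : ∀ z ∈ Metric.ball (0:ℂ) 2, DifferentiableAt ℝ e (z0 + t * z) := fun z hz =>
    (he.differentiableOn one_ne_zero).differentiableAt (Metric.isOpen_ball.mem_nhds (mem z hz))
  have h0 : (0:ℂ) ∈ Metric.ball (0:ℂ) 2 := by simp
  have hL0 : 0 ≤ L := by
    have := (norm_nonneg _).trans (hL _ (mem 1 (by simp)) _ (mem 0 h0))
    simp at this
    have tt : 0 < |t| := abs_pos.2 tp.ne'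
    exact nonneg_of_mul_nonneg_left this tt
  have := h (fun z => e (z0 + t * z)) S (t ^ 2 * L) (he.comp (by fun_prop) mem) (fun z hz => hS _ (mem z hz)) (by
    intro z hz z' hz'
    rw [(dbar_comp_affine e z0 t z (df z hz)).2, (dbar_comp_affine e z0 t z' (df z' hz')).2, ← mul_sub, norm_mul]
    have := hL _ (mem z hz) _ (mem z' hz')
    rw [add_sub_add_left_eq_sub, ← mul_sub, norm_mul] at this
    simp only [Complex.norm_real, Real.norm_eq_abs, abs_of_pos tp] at this ⊢
    calc _ ≤ t * (L * (t * ‖z - z'‖)) := by gcongr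
      _ = _ := by ring)
  rw [(dbar_comp_affine e z0 t 0 (df 0 h0)).1.fderiv, norm_smul] at this
  simp only [mul_zero, add_zero, Real.norm_eq_abs, abs_of_pos tp] at this
  have e1 : δ = 2 * t := by rw [ht]; ring
  rw [e1]
  have : 0 ≤ C * (t ^ 2 * L) := by positivity
  nlinarith

lemma grad_absorb : ∃ C > 0, ∀ (e : ℂ → ℂ) (S κ M : ℝ) (z0 : ℂ) (ρ : ℝ), 0 < ρ → ContDiffOn ℝ 1 e (Metric.ball z0 ρ) →
    (∀ z ∈ Metric.ball z0 ρ, ‖e z‖ ≤ S) → 0 ≤ κ → 0 ≤ M →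
    (∀ z ∈ Metric.ball z0 ρ, ∀ z' ∈ Metric.ball z0 ρ, ‖dbar e z - dbar e z'‖ ≤ κ * ‖e z - e z'‖ + M * ‖z - z'‖) →
    C * κ * ρ ≤ 1 →
    ρ * ‖fderiv ℝ e z0‖ ≤ C * (S + ρ ^ 2 * M) := by
  obtain ⟨C, hC, h⟩ := grad_scaled
  refine ⟨8 * C, by positivity, fun e S κ M z0 ρ hρ he hS hκ hM hL hρs => ?_⟩
  set ρ' := ρ / 2 with hρ'
  have hρ'p : 0 < ρ' := by positivity
  have Dc := he.continuousOn_fderiv_of_isOpen Metric.isOpen_ball le_rfl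
  have sub : Metric.closedBall z0 ρ' ⊆ Metric.ball z0 ρ := Metric.closedBall_subset_ball (by linarith)
  obtain ⟨z1, hz1, hmax⟩ := (isCompact_closedBall z0 ρ').exists_isMaxOn ⟨z0, by simp [hρ'p.le]⟩
    (f := fun z => (ρ' - ‖z - z0‖) * ‖fderiv ℝ e z‖)
    (((continuous_const.sub (continuous_norm.comp (continuous_id.sub continuous_const))).continuousOn).mul (Dc.mono sub).norm)
  have hm0 := hmax (by simp [hρ'p.le] : z0 ∈ Metric.closedBall z0 ρ')
  simp only [mem_ofPred_eq, sub_self, norm_zero, sub_zero] at hm0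
  set G := ‖fderiv ℝ e z1‖ with hG
  have hG0 : 0 ≤ G := norm_nonneg _
  have hS0 : 0 ≤ S := (norm_nonneg _).trans (hS z0 (by simp [hρ]))
  by_cases hd : ‖z1 - z0‖ = ρ'
  · rw [hd, sub_self, zero_mul] at hm0
    have : 0 ≤ C * (S + ρ^2 * M) := by positivity
    have e2 : ρ = 2 * ρ' := by rw [hρ']; ring
    have a3 : ρ * ‖fderiv ℝ e z0‖ = 2 * (ρ' * ‖fderiv ℝ e z0‖) := by rw [mul_comm 2, mul_right_comm, ← mul_comm 2, ← e2]
    linarith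
  have hz1' : ‖z1 - z0‖ ≤ ρ' := by simpa [dist_eq_norm] using hz1
  set δ := (ρ' - ‖z1 - z0‖)/2 with hδ
  have hδp : 0 < δ := by
    have := lt_of_le_of_ne hz1' hd
    rw [hδ]; linarith
  have nb : ∀ z ∈ Metric.ball z1 δ, δ ≤ ρ' - ‖z - z0‖ := by
    intro z hz
    have h1 : ‖z - z1‖ < δ := by simpa [dist_eq_norm] using hz
    have : ‖z - z0‖ ≤ ‖z - z1‖ + ‖z1 - z0‖ := norm_sub_le_norm_sub_add_norm_sub _ _ _
    linarith
  have sb : Metric.ball z1 δ ⊆ Metric.ball z0 ρ := by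
    intro z hz
    have := nb z hz
    rw [Metric.mem_ball, dist_eq_norm]; linarith
  have gb : ∀ z ∈ Metric.ball z1 δ, ‖fderiv ℝ e z‖ ≤ 2 * G := by
    intro z hz
    have h1 := nb z hz
    have h2 := hmax (by rw [Metric.mem_closedBall, dist_eq_norm]; linarith : z ∈ Metric.closedBall z0 ρ')
    simp only [mem_ofPred_eq] at h2
    have e1 : ρ' - ‖z1 - z0‖ = 2 * δ := by rw [hδ]; ring
    rw [e1] at h2
    have h3 : δ * ‖fderiv ℝ e z‖ ≤ δ * (2 * G) := by
      calc _ ≤ (ρ' - ‖z - z0‖) * ‖fderiv ℝ e z‖ := by gcongr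
        _ ≤ _ := h2
        _ = _ := by ring
    exact le_of_mul_le_mul_left h3 hδp
  have lip : ∀ z ∈ Metric.ball z1 δ, ∀ z' ∈ Metric.ball z1 δ, ‖e z - e z'‖ ≤ 2 * G * ‖z - z'‖ := by
    intro z hz z' hz'
    exact (convex_ball z1 δ).norm_image_sub_le_of_norm_fderiv_le (𝕜 := ℝ)
      (fun w hw => (he.differentiableOn one_ne_zero).differentiableAt (Metric.isOpen_ball.mem_nhds (sb hw))) gb hz' hz
  have := h e S (κ * (2 * G) + M) z1 δ hδp (he.mono sb) (fun z hz => hS z (sb hz)) (by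
    intro z hz z' hz'
    refine (hL z (sb hz) z' (sb hz')).trans ?_
    have := lip z hz z' hz'
    calc _ ≤ κ * (2 * G * ‖z - z'‖) + M * ‖z - z'‖ := by gcongr
      _ = _ := by ring)
  have hδρ : δ ≤ ρ := by rw [hδ, hρ']; linarith [norm_nonneg (z1 - z0)]
  have a1 : C * (δ ^ 2 * (κ * (2 * G))) ≤ δ * G / 4 := by
    have : 8 * C * κ * δ ≤ 1 := le_trans (by gcongr) hρs
    calc C * (δ ^ 2 * (κ * (2 * G))) = (8 * C * κ * δ) * (δ * G / 4) := by ring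
      _ ≤ 1 * (δ * G / 4) := by gcongr
      _ = _ := one_mul _
  have a2 : C * (δ ^ 2 * M) ≤ C * (ρ ^ 2 * M) := by gcongr
  have e1 : ρ' - ‖z1 - z0‖ = 2 * δ := by rw [hδ]; ring
  rw [e1] at hm0
  have e2 : ρ = 2 * ρ' := by rw [hρ']; ring
  have a3 : ρ * ‖fderiv ℝ e z0‖ = 2 * (ρ' * ‖fderiv ℝ e z0‖) := by rw [e2]; ring
  rw [a3]
  have a4 : 0 ≤ C * (ρ^2 * M) := by positivity
  have a5 : 0 ≤ C * S := by positivity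
  nlinarith
end ModA5

section ModA6
open MeasureTheory
open Complex (I)

structure WSetup (k M r : ℝ) (CG : ℝ → ℝ) (a : ℂ → ℂ) : Prop where
  c1 : ContDiffOn ℝ 1 a (hDisc r)
  bd : ∀ w ∈ hDisc r, ‖a w‖ ≤ M
  eq : ∀ w ∈ hDisc r, dbar a w = -k * ((Complex.exp (-I * a w)).re : ℂ) -
    k * w.im * fderiv ℝ a w 1 * starRingEnd ℂ (Complex.exp (-I * a w))
  grad : ∀ M2 s p q : ℝ, |s| ≤ M2 → |p| ≤ M2 → |q| ≤ M2 → ∀ w ∈ hDisc (r/2), ∀ S : ℝ,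
    (∀ w' ∈ hDisc r, ‖w'‖ ≤ 2 * ‖w‖ → ‖a w' - (s + p * w' + q * w'.re)‖ ≤ S) →
    w.im * ‖fderiv ℝ a w 1 - (p + q)‖ ≤ CG M2 * (S + w.im ^ 2)
  bdry : ∀ x : ℝ, |x| < r → Tendsto (fun ε : ℝ => (a (x + ε * I)).im) (𝓝[>] 0) (𝓝 0)

lemma quad_hasFDeriv (r1 A B : ℂ) (w : ℂ) : ∃ L : ℂ →L[ℝ] ℂ,
    HasFDerivAt (fun w : ℂ => r1 * w.re + A * (w.re:ℂ) ^ 2 - I * B * (w.im:ℂ) ^ 2) L w ∧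
    (L 1 + I * L I) / 2 = r1 / 2 + A * w.re + B * w.im := by
  have hr : HasFDerivAt (fun w : ℂ => (w.re : ℂ)) (Complex.ofRealCLM.comp Complex.reCLM) w :=
    (Complex.ofRealCLM.comp Complex.reCLM).hasFDerivAt
  have hi : HasFDerivAt (fun w : ℂ => (w.im : ℂ)) (Complex.ofRealCLM.comp Complex.imCLM) w :=
    (Complex.ofRealCLM.comp Complex.imCLM).hasFDerivAt
  refine ⟨_, ((hr.const_mul r1).add ((hr.pow 2).const_mul A)).sub ((hi.pow 2).const_mul (I * B)), ?_⟩
  simp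
  linear_combination (-B * w.im) * Complex.I_sq

lemma dbar_sub_quad (a : ℂ → ℂ) (r1 A B : ℂ) (w : ℂ) (ha : DifferentiableAt ℝ a w) :
    dbar (fun w => a w - (r1 * w.re + A * (w.re:ℂ) ^ 2 - I * B * (w.im:ℂ) ^ 2)) w
      = dbar a w - (r1 / 2 + A * w.re + B * w.im) := by
  obtain ⟨L, hL, hL2⟩ := quad_hasFDeriv r1 A B w
  rw [← hL2]
  simp only [dbar]
  rw [(ha.hasFDerivAt.fun_sub hL).fderiv]
  simp; ring

lemma contDiff_quad (r1 A B : ℂ) : ContDiff ℝ 1 (fun w : ℂ => r1 * w.re + A * (w.re:ℂ) ^ 2 - I * B * (w.im:ℂ) ^ 2) := by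
  have hr : ContDiff ℝ 1 (fun w : ℂ => (w.re : ℂ)) := (Complex.ofRealCLM.comp Complex.reCLM).contDiff
  have hi : ContDiff ℝ 1 (fun w : ℂ => (w.im : ℂ)) := (Complex.ofRealCLM.comp Complex.imCLM).contDiff
  fun_prop

lemma hDisc_mono {r r' : ℝ} (h : r ≤ r') : hDisc r ⊆ hDisc r' := fun _ hw => ⟨hw.1.trans_le h, hw.2⟩

lemma exp_bd (M : ℝ) (z : ℂ) (hz : ‖z‖ ≤ M) : ‖Complex.exp (-I * z)‖ ≤ rexp M := by
  refine (Complex.norm_exp_le_exp_norm _).trans (Real.exp_le_exp.2 ?_)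
  simpa using hz

lemma exp_tay1 (M : ℝ) (z s : ℂ) (hz : ‖z‖ ≤ M) (hs : ‖s‖ ≤ M) :
    ‖Complex.exp (-I * z) - Complex.exp (-I * s)‖ ≤ rexp (3 * M) * ‖z - s‖ := by
  have h := Complex.norm_exp_sub_sum_le_norm_mul_exp (-I * (z - s)) 1
  have e1 : Complex.exp (-I * z) = Complex.exp (-I * s) * Complex.exp (-I * (z - s)) := by
    rw [← Complex.exp_add]; ring_nf
  have e2 : ‖-I * (z - s)‖ = ‖z - s‖ := by simp
  rw [e2] at h
  simp only [Finset.sum_range_one, pow_zero, Nat.factorial_zero, Nat.cast_one, div_one, pow_one] at h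
  have h3 : ‖z - s‖ ≤ 2 * M := (norm_sub_le _ _).trans (by linarith)
  calc _ = ‖Complex.exp (-I * s)‖ * ‖Complex.exp (-I * (z - s)) - 1‖ := by rw [e1, ← norm_mul]; ring_nf
    _ ≤ rexp M * (‖z - s‖ * rexp (2 * M)) := by
      gcongr
      · exact exp_bd M s hs
      · exact h.trans (by gcongr)
    _ = _ := by
      have : rexp (3 * M) = rexp M * rexp (2 * M) := by rw [← Real.exp_add]; ring_nf
      rw [this]; ring

lemma exp_tay2 (M : ℝ) (z s : ℂ) (hz : ‖z‖ ≤ M) (hs : ‖s‖ ≤ M) :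
    ‖Complex.exp (-I * z) - Complex.exp (-I * s) * (1 - I * (z - s))‖ ≤ rexp (3 * M) * ‖z - s‖ ^ 2 := by
  have h := Complex.norm_exp_sub_sum_le_norm_mul_exp (-I * (z - s)) 2
  have e1 : Complex.exp (-I * z) = Complex.exp (-I * s) * Complex.exp (-I * (z - s)) := by
    rw [← Complex.exp_add]; ring_nf
  have e2 : ‖-I * (z - s)‖ = ‖z - s‖ := by simp
  rw [e2] at h
  simp only [Finset.sum_range_succ, Finset.sum_range_zero, zero_add, pow_zero, Nat.factorial_zero, Nat.cast_one, div_one, pow_one, Nat.factorial_one] at h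
  have h3 : ‖z - s‖ ≤ 2 * M := (norm_sub_le _ _).trans (by linarith)
  calc _ = ‖Complex.exp (-I * s)‖ * ‖Complex.exp (-I * (z - s)) - (1 + -I * (z - s))‖ := by rw [e1, ← norm_mul]; ring_nf
    _ ≤ rexp M * (‖z - s‖ ^ 2 * rexp (2 * M)) := by
      gcongr
      · exact exp_bd M s hs
      · exact h.trans (by gcongr)
    _ = _ := by
      have : rexp (3 * M) = rexp M * rexp (2 * M) := by rw [← Real.exp_add]; ring_nf
      rw [this]; ring

lemma pow_le_one_of {x s : ℝ} (h0 : 0 < x) (h1 : x ≤ 1) (hs : s ≤ 0) : 1 ≤ x ^ s :=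
  Real.one_le_rpow_of_pos_of_le_one_of_nonpos h0 h1 hs

lemma hDisc_pos {r : ℝ} {w : ℂ} (h : w ∈ hDisc r) : 0 < ‖w‖ := by
  rw [norm_pos_iff]; rintro rfl; exact lt_irrefl _ h.2

lemma step0 (k M r : ℝ) (CG : ℝ → ℝ) (hk : 0 < k) (hM : 0 ≤ M) (hr : 0 < r) (hr1 : r ≤ 1) (hCG : ∀ x, 0 ≤ CG x) :
    ∃ C > 0, ∀ a, WSetup k M r CG a → ∃ θ : ℝ, |θ| ≤ C ∧ ∀ w ∈ hDisc (r/8), ‖a w - θ‖ ≤ C * ‖w‖ ^ (1/2:ℝ) := by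
  obtain ⟨C, hC, h⟩ := step_lemma (r/2) (by positivity) (by linarith) 1 le_rfl (by norm_num)
  set M' := M + k * rexp M + k * (CG 0 * (M + 1)) * rexp M with hM'
  have hG := hCG 0
  refine ⟨C * (M' + 1), by positivity, fun a ha => ?_⟩
  have sub : hDisc (r/2) ⊆ hDisc r := hDisc_mono (by linarith)
  have db : ∀ w ∈ hDisc (r/2), ‖dbar a w‖ ≤ M' := by
    intro w hw
    have g := ha.grad 0 0 0 0 (by simp) (by simp) (by simp) w hw M (fun w' hw' _ => by simpa using ha.bd w' hw')
    have hE := exp_bd M _ (ha.bd w (sub hw))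
    have him := hw.2
    have him1 : w.im ≤ 1 := ((Complex.abs_im_le_norm w).trans' (le_abs_self _)).trans (by linarith [hw.1])
    rw [ha.eq w (sub hw)]
    refine (norm_sub_le _ _).trans ?_
    simp only [norm_mul, norm_neg, Complex.norm_real, RCLike.norm_conj, Real.norm_eq_abs, abs_of_pos hk, abs_of_pos him]
    have h1 : |(Complex.exp (-I * a w)).re| ≤ rexp M := (Complex.abs_re_le_norm _).trans hE
    have h2 : w.im * ‖fderiv ℝ a w 1‖ ≤ CG 0 * (M + 1) := by
      simp only [Complex.ofReal_zero, add_zero, sub_zero] at g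
      refine g.trans ?_
      gcongr
      nlinarith
    calc _ = k * |(Complex.exp (-I * a w)).re| + k * (w.im * ‖fderiv ℝ a w 1‖) * ‖Complex.exp (-I * a w)‖ := by ring
      _ ≤ k * rexp M + k * (CG 0 * (M + 1)) * rexp M := by gcongr
      _ ≤ _ := by rw [hM']; linarith
  have MM : M ≤ M' := by
    have : 0 ≤ k * rexp M + k * (CG 0 * (M + 1)) * rexp M := by positivity
    rw [hM']; linarith
  have M'0 : 0 ≤ M' := hM.trans MM
  obtain ⟨c, hc, hc2⟩ := h a M' (ha.c1.mono sub) (fun w hw => ⟨(ha.bd w (sub hw)).trans MM, db w hw⟩)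
    (fun w hw => (db w hw).trans (le_mul_of_one_le_right M'0 (pow_le_one_of (hDisc_pos hw) (by linarith [hw.1]) (by norm_num))))
    (fun x hx => ha.bdry x (by linarith))
  refine ⟨c 0, (hc 0 one_pos).trans (by gcongr; linarith), fun w hw => ?_⟩
  have := hc2 w (by convert hw using 1; congr 1; ring)
  simp only [Finset.sum_range_one, pow_zero, mul_one, Nat.cast_one] at this
  refine this.trans ?_
  norm_num
  gcongr; linarith
end ModA6

section ModA6b
open MeasureTheory
open Complex (I)

lemma wim_le {r : ℝ} {w : ℂ} (h : w ∈ hDisc r) : w.im ≤ ‖w‖ := (le_abs_self _).trans (Complex.abs_im_le_norm w)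

lemma step1 (k M r C0 : ℝ) (CG : ℝ → ℝ) (hk : 0 < k) (hM : 0 ≤ M) (hr : 0 < r) (hr1 : r ≤ 1) (hCG : ∀ x, 0 ≤ CG x) (hC0 : 0 < C0) :
    ∃ C > 0, ∀ a, WSetup k M r CG a → ∀ θ : ℝ, |θ| ≤ C0 → (∀ w ∈ hDisc (r/8), ‖a w - θ‖ ≤ C0 * ‖w‖ ^ (1/2:ℝ)) →
    ∃ s p q : ℝ, |s| ≤ C ∧ |p| ≤ C ∧ |q| ≤ C ∧ ∀ w ∈ hDisc (r/64), ‖a w - (s + p * w + q * w.re)‖ ≤ C * ‖w‖ ^ (3/2:ℝ) := by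
  obtain ⟨C, hC, h⟩ := step_lemma (r/16) (by positivity) (by linarith) 2 (by norm_num) (by norm_num)
  set M3 := M + C0 with hM3
  have hG := hCG C0
  set D := k * (rexp (3 * M3) * C0) + k * (CG C0 * (2 * C0 + 1)) * rexp M with hD
  have hD0 : 0 ≤ D := by positivity
  set M' := M + 2 * k * rexp M3 + D with hM'
  refine ⟨C * M' + 2 * k * rexp M3, by positivity, fun a ha θ hθ hest => ?_⟩
  have sub : hDisc (r/16) ⊆ hDisc r := hDisc_mono (by linarith)
  set E0 := Complex.exp (-I * θ) with hE0
  have E0b : ‖E0‖ ≤ rexp M3 := exp_bd M3 _ (by simp; linarith)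
  have E0r : |E0.re| ≤ rexp M3 := (Complex.abs_re_le_norm _).trans E0b
  set r1 : ℝ := -2 * k * E0.re with hr1'
  have hr1b : |r1| ≤ 2 * k * rexp M3 := by
    rw [hr1', abs_mul, abs_mul, abs_of_pos hk]; norm_num; gcongr
  set b : ℂ → ℂ := fun w => a w - ((r1:ℂ) * w.re + 0 * (w.re:ℂ) ^ 2 - I * 0 * (w.im:ℂ) ^ 2) with hb
  have db : ∀ w ∈ hDisc (r/16), ‖dbar b w‖ ≤ D * ‖w‖ ^ (1/2:ℝ) := by
    intro w hw
    have wp := hDisc_pos hw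
    have w1 : ‖w‖ ≤ 1 := by linarith [hw.1]
    set t := ‖w‖ ^ (1/2:ℝ) with ht
    have t0 : 0 ≤ t := by positivity
    have g := ha.grad C0 θ 0 0 hθ (by simpa using hC0.le) (by simpa using hC0.le) w (hDisc_mono (by linarith) hw) (C0 * (2 * t)) (by
      intro w' hw' hle
      have := hest w' ⟨by linarith [hw.1], hw'.2⟩
      simp only [Complex.ofReal_zero, zero_mul, add_zero]
      refine this.trans ?_
      gcongr
      calc ‖w'‖ ^ (1/2:ℝ) ≤ (2 * ‖w‖) ^ (1/2:ℝ) := by gcongr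
        _ = 2 ^ (1/2:ℝ) * t := Real.mul_rpow (by norm_num) wp.le
        _ ≤ 2 * t := by
          gcongr
          calc (2:ℝ) ^ (1/2:ℝ) ≤ 2 ^ (1:ℝ) := Real.rpow_le_rpow_of_exponent_le (by norm_num) (by norm_num)
            _ = 2 := Real.rpow_one 2)
    have hE := exp_bd M _ (ha.bd w (sub hw))
    have him := hw.2
    have him1 : w.im ^ 2 ≤ t := by
      calc w.im ^ 2 ≤ ‖w‖ ^ 2 := by gcongr; exact wim_le hw
        _ = ‖w‖ ^ (2:ℝ) := by norm_cast
        _ ≤ t := Real.rpow_le_rpow_of_exponent_ge wp w1 (by norm_num)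
    have aw : DifferentiableAt ℝ a w := (ha.c1.differentiableOn one_ne_zero).differentiableAt ((isOpen_hDisc r).mem_nhds (sub hw))
    have tay := exp_tay1 M3 (a w) θ ((ha.bd w (sub hw)).trans (by linarith)) (by simp; linarith)
    have est := hest w (hDisc_mono (by linarith) hw)
    rw [hb, dbar_sub_quad a _ _ _ w aw, ha.eq w (sub hw)]
    simp only [Complex.ofReal_zero, add_zero, sub_zero] at g
    have h2 : w.im * ‖fderiv ℝ a w 1‖ ≤ CG C0 * (2 * C0 + 1) * t := by
      calc _ ≤ _ := g
        _ ≤ CG C0 * (C0 * (2 * t) + t) := by gcongr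
        _ = _ := by ring
    have e1 : -k * ((Complex.exp (-I * a w)).re : ℂ) - k * w.im * fderiv ℝ a w 1 * starRingEnd ℂ (Complex.exp (-I * a w))
        - ((r1:ℂ)/2 + 0 * w.re + 0 * w.im) = -k * ((Complex.exp (-I * a w) - E0).re : ℂ) - k * w.im * fderiv ℝ a w 1 * starRingEnd ℂ (Complex.exp (-I * a w)) := by
      rw [hr1']; push_cast [Complex.sub_re]; ring
    rw [e1]
    refine (norm_sub_le _ _).trans ?_
    simp only [norm_mul, norm_neg, Complex.norm_real, RCLike.norm_conj, Real.norm_eq_abs, abs_of_pos hk, abs_of_pos him]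
    have h1 : |(Complex.exp (-I * a w) - E0).re| ≤ rexp (3 * M3) * (C0 * t) := by
      refine (Complex.abs_re_le_norm _).trans (tay.trans ?_)
      gcongr
    calc _ = k * |(Complex.exp (-I * a w) - E0).re| + k * (w.im * ‖fderiv ℝ a w 1‖) * ‖Complex.exp (-I * a w)‖ := by ring
      _ ≤ k * (rexp (3 * M3) * (C0 * t)) + k * (CG C0 * (2 * C0 + 1) * t) * rexp M := by gcongr
      _ = _ := by rw [hD]; ring
  have DM : D ≤ M' := by
    have : 0 ≤ M + 2 * k * rexp M3 := by positivity
    rw [hM']; linarith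
  obtain ⟨c, hc, hc2⟩ := h b M' ((ha.c1.mono sub).sub (contDiff_quad _ _ _).contDiffOn) (by
      intro w hw
      have w1 : ‖w‖ ≤ 1 := by linarith [hw.1]
      constructor
      · simp only [hb]
        refine (norm_sub_le _ _).trans ?_
        have : ‖(r1:ℂ) * w.re‖ ≤ 2 * k * rexp M3 := by
          rw [norm_mul, Complex.norm_real, Complex.norm_real]
          calc _ ≤ (2 * k * rexp M3) * 1 := by
                gcongr
                · exact hr1b
                · exact (Complex.abs_re_le_norm _).trans w1
            _ = _ := mul_one _
        simp only [zero_mul, mul_zero, add_zero, sub_zero]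
        have := ha.bd w (sub hw)
        rw [hM']; linarith
      · refine (db w hw).trans ((mul_le_of_le_one_right hD0 ?_).trans DM)
        exact Real.rpow_le_one (norm_nonneg _) w1 (by norm_num)) (by
      intro w hw
      refine (db w hw).trans ?_
      norm_num
      gcongr) (by
      intro x hx
      have := ha.bdry x (by linarith)
      simpa [hb] using this)
  have kM : 0 ≤ 2 * k * rexp M3 := by positivity
  have CM : 0 ≤ C * M' := by positivity
  refine ⟨c 0, c 1, r1, (hc 0 two_pos).trans (by linarith), (hc 1 one_lt_two).trans (by linarith), hr1b.trans (by linarith), fun w hw => ?_⟩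
  have := hc2 w (by convert hw using 1; congr 1; ring)
  simp only [Finset.sum_range_succ, Finset.sum_range_zero, zero_add, pow_zero, mul_one, pow_one, hb] at this
  have e1 : a w - (↑(c 0) + ↑(c 1) * w + ↑r1 * ↑w.re) = a w - ((r1:ℂ) * w.re + 0 * (w.re:ℂ) ^ 2 - I * 0 * (w.im:ℂ) ^ 2) - (↑(c 0) + ↑(c 1) * w) := by ring
  rw [e1]
  refine this.trans ?_
  norm_num
  gcongr
  linarith

set_option maxHeartbeats 2000000 in
lemma step2 (k M r C0 : ℝ) (CG : ℝ → ℝ) (hk : 0 < k) (hM : 0 ≤ M) (hr : 0 < r) (hr1 : r ≤ 1) (hCG : ∀ x, 0 ≤ CG x) (hC0 : 0 < C0) :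
    ∃ C > 0, ∀ a, WSetup k M r CG a → ∀ s p q : ℝ, |s| ≤ C0 → |p| ≤ C0 → |q| ≤ C0 →
      (∀ w ∈ hDisc (r/64), ‖a w - (s + p * w + q * w.re)‖ ≤ C0 * ‖w‖ ^ (3/2:ℝ)) →
    ∃ q0 q1 q2 : ℝ, |q0| ≤ C ∧ |q1| ≤ C ∧ |q2| ≤ C ∧ ∀ w ∈ hDisc (r/512), ‖a w - (q0 + q1 * w.re + q2 * w.re ^ 2)‖ ≤ C * (‖w‖ ^ (5/2:ℝ) + w.im) := by
  obtain ⟨C, hC, h⟩ := step_lemma (r/128) (by positivity) (by linarith) 3 (by norm_num) (by norm_num)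
  set M3 := M + C0 with hM3
  have hG := hCG C0
  set D1 := rexp (3 * M3) * (3 * C0) ^ 2 + rexp M3 * C0 with hD1
  set D := k * D1 + k * (CG C0 * (4 * C0 + 1)) * rexp M + k * (2 * C0) * (rexp (3 * M3) * (3 * C0)) with hD
  have hD0 : 0 ≤ D := by positivity
  set RB := 2 * k * rexp M3 + k * (rexp M3 * (2 * C0)) + (k * (rexp M3 * C0) + k * (2 * C0) * rexp M3) with hRB
  have RB0 : 0 ≤ RB := by positivity
  set M' := M + RB + D with hM'
  refine ⟨4 * (C * M') + 3 * RB, by positivity, fun a ha s p q hs hp hq hest => ?_⟩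
  have sub : hDisc (r/128) ⊆ hDisc r := hDisc_mono (by linarith)
  set E0 := Complex.exp (-I * s) with hE0
  have E0b : ‖E0‖ ≤ rexp M3 := exp_bd M3 _ (by simp; linarith)
  have E0r : |E0.re| ≤ rexp M3 := (Complex.abs_re_le_norm _).trans E0b
  have pq : ‖(p:ℂ) + q‖ ≤ 2 * C0 := by
    refine (norm_add_le _ _).trans ?_
    simp only [Complex.norm_real, Real.norm_eq_abs]; linarith
  set α : ℝ := (-I * E0 * (p + q)).re with hα
  set β : ℝ := (E0 * p).re with hβ
  have hαb : |α| ≤ rexp M3 * (2 * C0) := by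
    refine (Complex.abs_re_le_norm _).trans ?_
    rw [norm_mul, norm_mul]; simp only [norm_neg, Complex.norm_I, one_mul]; gcongr
  have hβb : |β| ≤ rexp M3 * C0 := by
    refine (Complex.abs_re_le_norm _).trans ?_
    rw [norm_mul, Complex.norm_real, Real.norm_eq_abs]; gcongr
  set r1 : ℝ := -2 * k * E0.re with hr1'
  have hr1b : |r1| ≤ 2 * k * rexp M3 := by
    rw [hr1', abs_mul, abs_mul, abs_of_pos hk]; norm_num; gcongr
  set A : ℝ := -k * α with hA
  have hAb : |A| ≤ k * (rexp M3 * (2 * C0)) := by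
    rw [hA, abs_mul, abs_neg, abs_of_pos hk]; gcongr
  set B : ℂ := -k * β - k * (p + q) * starRingEnd ℂ E0 with hB
  have hBb : ‖B‖ ≤ k * (rexp M3 * C0) + k * (2 * C0) * rexp M3 := by
    refine (norm_sub_le _ _).trans ?_
    simp only [norm_mul, norm_neg, Complex.norm_real, RCLike.norm_conj, Real.norm_eq_abs, abs_of_pos hk]
    gcongr
  set b : ℂ → ℂ := fun w => a w - ((r1:ℂ) * w.re + A * (w.re:ℂ) ^ 2 - I * B * (w.im:ℂ) ^ 2) with hb
  have db : ∀ w ∈ hDisc (r/128), ‖dbar b w‖ ≤ D * ‖w‖ ^ (3/2:ℝ) := by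
    intro w hw
    have wp := hDisc_pos hw
    have w1 : ‖w‖ ≤ 1 := by linarith [hw.1]
    set t := ‖w‖ ^ (3/2:ℝ) with ht
    have t0 : 0 ≤ t := by positivity
    have g := ha.grad C0 s p q hs hp hq w (hDisc_mono (by linarith) hw) (C0 * (4 * t)) (by
      intro w' hw' hle
      have := hest w' ⟨by linarith [hw.1], hw'.2⟩
      refine this.trans ?_
      gcongr
      calc ‖w'‖ ^ (3/2:ℝ) ≤ (2 * ‖w‖) ^ (3/2:ℝ) := by gcongr
        _ = 2 ^ (3/2:ℝ) * t := Real.mul_rpow (by norm_num) wp.le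
        _ ≤ 4 * t := by
          gcongr
          calc (2:ℝ) ^ (3/2:ℝ) ≤ 2 ^ (2:ℝ) := Real.rpow_le_rpow_of_exponent_le (by norm_num) (by norm_num)
            _ = 4 := by norm_num)
    have hE := exp_bd M _ (ha.bd w (sub hw))
    have him := hw.2
    have wt2 : ‖w‖ ^ 2 ≤ t := by
      calc ‖w‖ ^ 2 = ‖w‖ ^ (2:ℝ) := by norm_cast
        _ ≤ t := Real.rpow_le_rpow_of_exponent_ge wp w1 (by norm_num)
    have him1 : w.im ^ 2 ≤ t := le_trans (by gcongr; exact wim_le hw) wt2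
    have twle : t ≤ ‖w‖ := by
      calc t ≤ ‖w‖ ^ (1:ℝ) := Real.rpow_le_rpow_of_exponent_ge wp w1 (by norm_num)
        _ = ‖w‖ := Real.rpow_one _
    have aw : DifferentiableAt ℝ a w := (ha.c1.differentiableOn one_ne_zero).differentiableAt ((isOpen_hDisc r).mem_nhds (sub hw))
    have est := hest w (hDisc_mono (by linarith) hw)
    have hre : |w.re| ≤ ‖w‖ := Complex.abs_re_le_norm w
    set δ := a w - (s + p * w + q * w.re) with hδ
    have as : ‖a w - s‖ ≤ 3 * C0 * ‖w‖ := by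
      have e : a w - s = δ + (p * w + q * w.re) := by rw [hδ]; ring
      rw [e]
      calc _ ≤ ‖δ‖ + (‖(p:ℂ) * w‖ + ‖(q:ℂ) * w.re‖) := (norm_add_le _ _).trans (by gcongr; exact norm_add_le _ _)
        _ ≤ C0 * ‖w‖ + (C0 * ‖w‖ + C0 * ‖w‖) := by
          simp only [norm_mul, Complex.norm_real, Real.norm_eq_abs]
          gcongr
          exact est.trans (by gcongr)
        _ = _ := by ring
    have bs : ‖(s:ℂ)‖ ≤ M3 := by simp; linarith
    have ba : ‖a w‖ ≤ M3 := (ha.bd w (sub hw)).trans (by linarith)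
    have tay := exp_tay2 M3 (a w) s ba bs
    have tay1 := exp_tay1 M3 (a w) s ba bs
    rw [hb, dbar_sub_quad a _ _ _ w aw, ha.eq w (sub hw)]
    have h2 : w.im * ‖fderiv ℝ a w 1 - (p + q)‖ ≤ CG C0 * (4 * C0 + 1) * t := by
      calc _ ≤ _ := g
        _ ≤ CG C0 * (C0 * (4 * t) + t) := by gcongr
        _ = _ := by ring
    set E := Complex.exp (-I * a w) with hEd
    set P := fderiv ℝ a w 1 with hP
    have hX : ‖E - E0 * (1 - I * (p * w + q * w.re))‖ ≤ D1 * t := by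
      have e : E - E0 * (1 - I * (p * w + q * w.re)) = (E - E0 * (1 - I * (a w - s))) - I * E0 * δ := by rw [hδ]; ring
      rw [e]
      refine (norm_sub_le _ _).trans ?_
      have x1 : ‖E - E0 * (1 - I * (a w - s))‖ ≤ rexp (3 * M3) * ((3 * C0) ^ 2 * t) := by
        refine tay.trans ?_
        gcongr
        calc ‖a w - s‖ ^ 2 ≤ (3 * C0 * ‖w‖) ^ 2 := by gcongr
          _ = (3 * C0) ^ 2 * ‖w‖ ^ 2 := by ring
          _ ≤ _ := by gcongr
      have x2 : ‖I * E0 * δ‖ ≤ rexp M3 * (C0 * t) := by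
        rw [norm_mul, norm_mul]; simp only [Complex.norm_I, one_mul]; gcongr
      calc _ ≤ _ := add_le_add x1 x2
        _ = _ := by rw [hD1]; ring
    have eX : ((E0 * (1 - I * (p * w + q * w.re))).re : ℝ) = E0.re + α * w.re + β * w.im := by
      rw [hα, hβ]
      simp
      ring
    have e1 : -k * (E.re : ℂ) - k * w.im * P * starRingEnd ℂ E - ((r1:ℂ)/2 + A * w.re + B * w.im)
      = -k * ((E - E0 * (1 - I * (p * w + q * w.re))).re : ℂ) - k * w.im * (P - (p + q)) * starRingEnd ℂ E
        - k * w.im * (p + q) * starRingEnd ℂ (E - E0) := by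
      rw [Complex.sub_re, eX, hr1', hA, hB, map_sub]; push_cast; ring
    rw [e1]
    refine (norm_sub_le _ _).trans ((add_le_add_left (norm_sub_le _ _) _).trans ?_)
    simp only [norm_mul, norm_neg, Complex.norm_real, RCLike.norm_conj, Real.norm_eq_abs, abs_of_pos hk, abs_of_pos him]
    have h1 : |(E - E0 * (1 - I * (p * w + q * w.re))).re| ≤ D1 * t := (Complex.abs_re_le_norm _).trans hX
    have h3 : w.im * ‖E - E0‖ ≤ rexp (3 * M3) * (3 * C0) * t := by
      calc _ ≤ ‖w‖ * (rexp (3 * M3) * (3 * C0 * ‖w‖)) := by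
            gcongr
            · exact wim_le hw
            · exact tay1.trans (by gcongr)
        _ = rexp (3 * M3) * (3 * C0) * ‖w‖ ^ 2 := by ring
        _ ≤ _ := by gcongr
    calc _ = k * |(E - E0 * (1 - I * (p * w + q * w.re))).re| + k * (w.im * ‖P - (p + q)‖) * ‖E‖ + k * ‖(p:ℂ) + q‖ * (w.im * ‖E - E0‖) := by ring
      _ ≤ k * (D1 * t) + k * (CG C0 * (4 * C0 + 1) * t) * rexp M + k * (2 * C0) * (rexp (3 * M3) * (3 * C0) * t) := by gcongr
      _ = _ := by rw [hD]; ring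
  have DM : D ≤ M' := by
    rw [hM']; linarith
  obtain ⟨c, hc, hc2⟩ := h b M' ((ha.c1.mono sub).sub (contDiff_quad _ _ _).contDiffOn) (by
      intro w hw
      have w1 : ‖w‖ ≤ 1 := by linarith [hw.1]
      have hre : |w.re| ≤ 1 := (Complex.abs_re_le_norm w).trans w1
      have him : |w.im| ≤ 1 := (Complex.abs_im_le_norm w).trans w1
      constructor
      · simp only [hb]
        refine (norm_sub_le _ _).trans ?_
        have : ‖(r1:ℂ) * w.re + A * (w.re:ℂ) ^ 2 - I * B * (w.im:ℂ) ^ 2‖ ≤ RB := by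
          refine (norm_sub_le _ _).trans ((add_le_add_left (norm_add_le _ _) _).trans ?_)
          simp only [norm_mul, norm_pow, Complex.norm_I, one_mul, Complex.norm_real, Real.norm_eq_abs]
          rw [hRB]
          refine add_le_add (add_le_add ?_ ?_) ?_
          · exact (mul_le_of_le_one_right (abs_nonneg _) hre).trans hr1b
          · exact (mul_le_of_le_one_right (abs_nonneg _) (pow_le_one₀ (abs_nonneg _) hre)).trans hAb
          · exact (mul_le_of_le_one_right (norm_nonneg _) (pow_le_one₀ (abs_nonneg _) him)).trans hBb
        have := ha.bd w (sub hw)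
        rw [hM']; linarith
      · refine (db w hw).trans ((mul_le_of_le_one_right hD0 ?_).trans DM)
        exact Real.rpow_le_one (norm_nonneg _) w1 (by norm_num)) (by
      intro w hw
      refine (db w hw).trans ?_
      norm_num
      gcongr) (by
      intro x hx
      have h1 := ha.bdry x (by linarith)
      have h2 : Tendsto (fun ε : ℝ => (I * B * (ε:ℂ) ^ 2).im) (𝓝[>] 0) (𝓝 0) := by
        have : Continuous (fun ε : ℝ => (I * B * (ε:ℂ) ^ 2).im) := by fun_prop
        have := this.tendsto 0
        simp only [Complex.ofReal_zero, ne_eq, OfNat.ofNat_ne_zero, not_false_eq_true, zero_pow, mul_zero, Complex.zero_im] at this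
        exact this.mono_left nhdsWithin_le_nhds
      have h3 := h1.add h2
      rw [add_zero] at h3
      refine h3.congr fun ε => ?_
      rw [← Complex.add_im]
      simp only [hb]
      have ex : (x + ε * I : ℂ).re = x := by simp
      have ei : (x + ε * I : ℂ).im = ε := by simp
      rw [ex, ei]
      have : a (↑x + ↑ε * I) - (↑r1 * ↑x + ↑A * ↑x ^ 2 - I * B * ↑ε ^ 2) = (a (↑x + ↑ε * I) + I * B * ↑ε ^ 2) - ((r1 * x + A * x ^ 2 : ℝ):ℂ) := by push_cast; ring
      rw [this, Complex.sub_im, Complex.ofReal_im, sub_zero])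
  have CM : 0 ≤ C * M' := by positivity
  have pA : 0 ≤ k * (rexp M3 * (2 * C0)) := by positivity
  have pR : 0 ≤ 2 * k * rexp M3 := by positivity
  have pB : 0 ≤ k * (rexp M3 * C0) + k * (2 * C0) * rexp M3 := by positivity
  refine ⟨c 0, c 1 + r1, c 2 + A, (hc 0 (by norm_num)).trans (by linarith),
    (abs_add_le _ _).trans (by linarith [hc 1 (by norm_num)]), (abs_add_le _ _).trans (by linarith [hc 2 (by norm_num)]), fun w hw => ?_⟩
  have := hc2 w (by convert hw using 1; congr 1; ring)
  simp only [Finset.sum_range_succ, Finset.sum_range_zero, zero_add, pow_zero, mul_one, pow_one, hb] at this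
  have w1 : ‖w‖ ≤ 1 := by linarith [hw.1]
  have hre : |w.re| ≤ 1 := (Complex.abs_re_le_norm w).trans w1
  have him : w.im ≤ 1 := (wim_le hw).trans w1
  have ip := hw.2
  set X := a w - ((r1:ℂ) * w.re + A * (w.re:ℂ) ^ 2 - I * B * (w.im:ℂ) ^ 2) - (↑(c 0) + ↑(c 1) * w + ↑(c 2) * w ^ 2) with hX
  have e1 : a w - (↑(c 0) + ↑(c 1 + r1) * ↑w.re + ↑(c 2 + A) * ↑w.re ^ 2) =
      X + (I * (c 1) + I * (c 2) * (2 * w.re) - (c 2) * w.im - I * B * w.im) * w.im := by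
    have hw : w = w.re + w.im * I := (Complex.re_add_im w).symm
    rw [hX]
    generalize hx : w.re = x at hw
    generalize hy : w.im = y at hw
    push_cast
    rw [hw]
    linear_combination ((c 2 : ℂ) * y ^ 2) * Complex.I_sq
  rw [e1]
  have y1 : ‖(I * (c 1) + I * (c 2) * (2 * w.re) - (c 2) * w.im - I * B * w.im : ℂ)‖ ≤ 4 * (C * M') + 3 * RB := by
    refine (norm_sub_le _ _).trans ((add_le_add_left ((norm_sub_le _ _).trans (add_le_add_left (norm_add_le _ _) _)) _).trans ?_)
    simp only [norm_mul, Complex.norm_I, one_mul, Complex.norm_real, Real.norm_eq_abs, abs_of_pos ip]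
    have h1 := hc 1 (by norm_num)
    have h2 := hc 2 (by norm_num)
    have m1 : |c 2| * (‖(2:ℂ)‖ * |w.re|) ≤ C * M' * 2 := by
      simp only [Complex.norm_ofNat]
      nlinarith [abs_nonneg (c 2), abs_nonneg w.re]
    have m2 : |c 2| * w.im ≤ C * M' := by nlinarith [abs_nonneg (c 2)]
    have m3 : ‖B‖ * w.im ≤ RB := by nlinarith [norm_nonneg B]
    linarith
  have x1 : ‖X‖ ≤ (4 * (C * M') + 3 * RB) * ‖w‖ ^ (5/2:ℝ) := by
    refine this.trans ?_
    norm_num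
    gcongr
    linarith
  calc _ ≤ ‖X‖ + ‖(I * (c 1) + I * (c 2) * (2 * w.re) - (c 2) * w.im - I * B * w.im : ℂ)‖ * w.im := by
        refine (norm_add_le _ _).trans ?_
        rw [norm_mul, Complex.norm_real, Real.norm_eq_abs, abs_of_pos ip]
    _ ≤ (4 * (C * M') + 3 * RB) * ‖w‖ ^ (5/2:ℝ) + (4 * (C * M') + 3 * RB) * w.im := by gcongr
    _ = _ := by ring

theorem expansion (k M r : ℝ) (CG : ℝ → ℝ) (hk : 0 < k) (hM : 0 ≤ M) (hr : 0 < r) (hr1 : r ≤ 1) (hCG : ∀ x, 0 ≤ CG x) :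
    ∃ C > 0, ∀ a, WSetup k M r CG a →
    ∃ q0 q1 q2 : ℝ, |q0| ≤ C ∧ |q1| ≤ C ∧ |q2| ≤ C ∧ ∀ w ∈ hDisc (r/512), ‖a w - (q0 + q1 * w.re + q2 * w.re ^ 2)‖ ≤ C * (‖w‖ ^ (5/2:ℝ) + w.im) := by
  obtain ⟨C0, h0, s0⟩ := step0 k M r CG hk hM hr hr1 hCG
  obtain ⟨C1, h1, s1⟩ := step1 k M r C0 CG hk hM hr hr1 hCG h0
  obtain ⟨C2, h2, s2⟩ := step2 k M r C1 CG hk hM hr hr1 hCG h1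
  refine ⟨C2, h2, fun a ha => ?_⟩
  obtain ⟨θ, hθ, e0⟩ := s0 a ha
  obtain ⟨s, p, q, hs, hp, hq, e1⟩ := s1 a ha θ hθ e0
  exact s2 a ha s p q hs hp hq e1
end ModA6b

section ModA7
open MeasureTheory
open Complex (I)

structure LocalSetup (k M c c0 r : ℝ) (N : Set ℂ) (A ω Z : ℂ → ℂ) : Prop where
  N_open : IsOpen N
  A_c1 : ContDiffOn ℝ 1 A N
  A_dbar : ∀ z ∈ N, dbar A z = -(I * k / 2) * (1 + Complex.exp (-(2 * I * (A z).re)))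
  A_bd : ∀ z ∈ N, ‖A z‖ ≤ M
  A_re : ∀ z ∈ N, c0 ≤ (Complex.exp (I * A z)).re
  ω_c1 : ContDiffOn ℝ 1 ω N
  ω_der : ∀ z ∈ N, ∀ v, fderiv ℝ ω z v = -I * Complex.exp (I * A z) * v + 2 * k * (ω z).im * v.im
  ω_inj : InjOn ω N
  ω_im : ∀ z ∈ N, 0 < (ω z).im ∧ (ω z).im ≤ 1
  Z_mem : ∀ w ∈ hDisc r, Z w ∈ N ∧ ω (Z w) = w
  Z_ball : ∀ w ∈ hDisc r, Metric.ball (Z w) (c * w.im) ⊆ N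
  bdry : ∀ x : ℝ, |x| < r → Tendsto (fun ε : ℝ => (A (Z (x + ε * I))).im) (𝓝[>] 0) (𝓝 0)

variable {k M c c0 r : ℝ} {N : Set ℂ} {A ω Z : ℂ → ℂ}

lemma LocalSetup.lower (h : LocalSetup k M c c0 r N A ω Z) (hk : 0 < k) {z : ℂ} (hz : z ∈ N) (v : ℂ) :
    c0 * ‖v‖ ≤ ‖fderiv ℝ ω z v‖ := by
  rw [h.ω_der z hz v]
  set F := Complex.exp (I * A z)
  have hF := h.A_re z hz
  set X := -I * F * v + 2 * k * (ω z).im * v.im with hX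
  have e1 : (I * starRingEnd ℂ v * X).re = F.re * ‖v‖ ^ 2 + 2 * k * (ω z).im * v.im ^ 2 := by
    rw [hX, ← Complex.normSq_eq_norm_sq, Complex.normSq_apply]
    simp
    ring
  have e2 : (I * starRingEnd ℂ v * X).re ≤ ‖v‖ * ‖X‖ := by
    refine (Complex.re_le_norm _).trans ?_
    rw [norm_mul, norm_mul]; simp
  have h3 : 0 ≤ 2 * k * (ω z).im * v.im ^ 2 := by
    have := (h.ω_im z hz).1
    positivity
  rcases eq_or_ne v 0 with rfl | hv
  · simp
  have hv : 0 < ‖v‖ := norm_pos_iff.2 hv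
  have : c0 * ‖v‖ ^ 2 ≤ F.re * ‖v‖ ^ 2 := by gcongr
  refine le_of_mul_le_mul_left ?_ hv
  nlinarith

lemma LocalSetup.inv (h : LocalSetup k M c c0 r N A ω Z) (hk : 0 < k) (hc0 : 0 < c0) {z : ℂ} (hz : z ∈ N) :
    ∃ L : ℂ ≃L[ℝ] ℂ, (L : ℂ →L[ℝ] ℂ) = fderiv ℝ ω z ∧ ∀ v, ‖L.symm v‖ ≤ ‖v‖ / c0 := by
  have inj : Function.Injective (fderiv ℝ ω z : ℂ →ₗ[ℝ] ℂ) := by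
    rw [injective_iff_map_eq_zero]
    intro v hv
    have := h.lower hk hz v
    have hv' : fderiv ℝ ω z v = 0 := hv
    rw [hv', norm_zero] at this
    have := norm_nonneg v
    have : ‖v‖ = 0 := by nlinarith
    simpa using this
  refine ⟨(LinearEquiv.ofInjectiveEndo _ inj).toContinuousLinearEquiv, ?_, ?_⟩
  · ext v; simp
  · intro v
    set L := (LinearEquiv.ofInjectiveEndo _ inj).toContinuousLinearEquiv with hL
    have := h.lower hk hz (L.symm v)
    have e : fderiv ℝ ω z (L.symm v) = v := by
      have : L (L.symm v) = v := L.apply_symm_apply v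
      exact this
    rw [e] at this
    rw [le_div_iff₀ hc0]; linarith

lemma LocalSetup.ZD (h : LocalSetup k M c c0 r N A ω Z) (hk : 0 < k) (hc0 : 0 < c0) {w : ℂ} (hw : w ∈ hDisc r) :
    ContDiffAt ℝ 1 Z w ∧ ∃ L : ℂ ≃L[ℝ] ℂ, (L : ℂ →L[ℝ] ℂ) = fderiv ℝ ω (Z w) ∧ (∀ v, ‖L.symm v‖ ≤ ‖v‖ / c0) ∧
      HasFDerivAt Z (L.symm : ℂ →L[ℝ] ℂ) w := by
  obtain ⟨hz, hωz⟩ := h.Z_mem w hw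
  obtain ⟨L, hL, hL2⟩ := h.inv hk hc0 hz
  have cd : ContDiffAt ℝ 1 ω (Z w) := h.ω_c1.contDiffAt (h.N_open.mem_nhds hz)
  have hd : HasFDerivAt ω (L : ℂ →L[ℝ] ℂ) (Z w) := by rw [hL]; exact (cd.differentiableAt one_ne_zero).hasFDerivAt
  have hsd : HasStrictFDerivAt ω (L : ℂ →L[ℝ] ℂ) (Z w) := cd.hasStrictFDerivAt' hd one_ne_zero
  set g := hsd.localInverse ω L (Z w) with hg
  have gc : ContDiffAt ℝ 1 g w := by
    have := cd.to_localInverse hd one_ne_zero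
    rw [hωz] at this
    exact this
  have gd : HasFDerivAt g (L.symm : ℂ →L[ℝ] ℂ) w := by
    have := hsd.to_localInverse.hasFDerivAt
    rw [hωz] at this
    exact this
  have gw : g w = Z w := by
    have := hsd.localInverse_apply_image
    rwa [hωz] at this
  have gr : ∀ᶠ y in 𝓝 w, ω (g y) = y := by
    have := hsd.eventually_right_inverse
    rwa [hωz] at this
  have gN : ∀ᶠ y in 𝓝 w, g y ∈ N := gc.continuousAt.eventually_mem (by rw [gw]; exact h.N_open.mem_nhds hz)
  have ev : Z =ᶠ[𝓝 w] g := by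
    filter_upwards [gr, gN, (isOpen_hDisc r).mem_nhds hw] with y h1 h2 h3
    exact h.ω_inj (h.Z_mem y h3).1 h2 (by rw [h1, (h.Z_mem y h3).2])
  exact ⟨gc.congr_of_eventuallyEq ev, L, hL, hL2, gd.congr_of_eventuallyEq ev⟩

lemma LocalSetup.aD (h : LocalSetup k M c c0 r N A ω Z) (hk : 0 < k) (hc0 : 0 < c0) {w : ℂ} (hw : w ∈ hDisc r) :
    dbar (A ∘ Z) w = -k * ((Complex.exp (-I * A (Z w))).re : ℂ) -
    k * w.im * fderiv ℝ (A ∘ Z) w 1 * starRingEnd ℂ (Complex.exp (-I * A (Z w))) := by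
  obtain ⟨zc, L, hL, hL2, hZ⟩ := h.ZD hk hc0 hw
  obtain ⟨hz, hωz⟩ := h.Z_mem w hw
  have hA : HasFDerivAt A (fderiv ℝ A (Z w)) (Z w) :=
    ((h.A_c1.contDiffAt (h.N_open.mem_nhds hz)).differentiableAt one_ne_zero).hasFDerivAt
  have ha := hA.comp w hZ
  set T := fderiv ℝ (A ∘ Z) w with hT
  have hT' : ∀ v, T (fderiv ℝ ω (Z w) v) = fderiv ℝ A (Z w) v := by
    intro v
    rw [hT, ha.fderiv, ← hL]; simp
  set z := Z w with hzd
  set F := Complex.exp (I * A z) with hF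
  have d1 := hT' 1
  have dI := hT' I
  rw [h.ω_der z hz, clm_apply T] at d1 dI
  have β := h.A_dbar z hz
  simp only [dbar] at β ⊢
  rw [← d1, ← dI, hωz, ← hF] at β
  set P := T 1
  set Q := T I
  have key : I * starRingEnd ℂ F * ((P + I * Q) / 2) + I * k * w.im * P = -(I * k / 2) * (1 + Complex.exp (-(2 * I * (A z).re))) := by
    rw [← β]
    have hFc : starRingEnd ℂ F = F.re - F.im * I := by
      apply Complex.ext <;> simp
    rw [hFc]
    simp
    have I3 : I ^ 3 = -I := by rw [pow_succ, Complex.I_sq]; ring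
    ring_nf
    rw [I3, Complex.I_sq]
    ring
  set E := Complex.exp (-I * A z) with hE
  have hFE : starRingEnd ℂ F * starRingEnd ℂ E = 1 := by
    rw [← map_mul, hF, hE, ← Complex.exp_add]; simp
  have hE2 : (1 + Complex.exp (-(2 * I * (A z).re))) * starRingEnd ℂ E = 2 * (E.re : ℂ) := by
    have e1 : Complex.exp (-(2 * I * (A z).re)) * starRingEnd ℂ E = E := by
      rw [hE, ← Complex.exp_conj, ← Complex.exp_add]
      congr 1
      rw [map_mul, map_neg, Complex.conj_I]
      apply Complex.ext <;> simp
      ring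
    have e2 : (2 * (E.re : ℂ)) = E + starRingEnd ℂ E := by
      rw [Complex.add_conj]; push_cast; ring
    rw [add_mul, e1, e2]; ring
  have k2 : ((P + I * Q) / 2) + k * w.im * P * starRingEnd ℂ E = -k * (E.re : ℂ) := by
    have := congrArg (fun x => x * starRingEnd ℂ E * (-I)) key
    linear_combination this + I ^ 2 * ((P + I * Q) / 2) * hFE + (I ^ 2 * k / 2) * hE2 + ((P + I * Q) / 2 + k * w.im * P * starRingEnd ℂ E + k * E.re) * Complex.I_sq
  linear_combination k2
end ModA7

section ModA7b
open MeasureTheory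
open Complex (I)
variable {k M c c0 r : ℝ} {N : Set ℂ} {A ω Z : ℂ → ℂ}

lemma LocalSetup.eD (h : LocalSetup k M c c0 r N A ω Z) (s p q : ℝ) {z : ℂ} (hz : z ∈ N) :
    ∃ L : ℂ →L[ℝ] ℂ, HasFDerivAt (fun z => A z - (s + p * ω z + q * (ω z).re)) L z ∧
      (∀ v, L v = fderiv ℝ A z v - (p * fderiv ℝ ω z v + q * (fderiv ℝ ω z v).re)) ∧
      dbar (fun z => A z - (s + p * ω z + q * (ω z).re)) z =
      -(I * k / 2) * (1 + Complex.exp (-(2 * I * (A z).re))) - (p * (I * k * (ω z).im) + q * (I * starRingEnd ℂ (Complex.exp (I * A z)) / 2 + I * k * (ω z).im)) := by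
  have hA : HasFDerivAt A (fderiv ℝ A z) z :=
    ((h.A_c1.contDiffAt (h.N_open.mem_nhds hz)).differentiableAt one_ne_zero).hasFDerivAt
  have hω : HasFDerivAt ω (fderiv ℝ ω z) z :=
    ((h.ω_c1.contDiffAt (h.N_open.mem_nhds hz)).differentiableAt one_ne_zero).hasFDerivAt
  have hr : HasFDerivAt (fun z => ((ω z).re : ℂ)) ((Complex.ofRealCLM.comp Complex.reCLM).comp (fderiv ℝ ω z)) z :=
    (Complex.ofRealCLM.comp Complex.reCLM).hasFDerivAt.comp z hω
  have H := hA.fun_sub (((hω.const_mul (p:ℂ)).const_add (s:ℂ)).fun_add (hr.const_mul (q:ℂ)))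
  refine ⟨_, H, fun v => by simp, ?_⟩
  rw [← h.A_dbar z hz]
  simp only [dbar]
  rw [H.fderiv]
  simp only [ContinuousLinearMap.sub_apply, ContinuousLinearMap.add_apply, ContinuousLinearMap.smul_apply, ContinuousLinearMap.comp_apply, h.ω_der z hz]
  set F := Complex.exp (I * A z) with hF
  have hFc : starRingEnd ℂ F = F.re - F.im * I := by
    apply Complex.ext <;> simp
  have hF2 : F = F.re + F.im * I := (Complex.re_add_im F).symm
  rw [hFc]
  simp
  have I3 : I ^ 3 = -I := by rw [pow_succ, Complex.I_sq]; ring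
  ring_nf
  rw [I3, Complex.I_sq]
  ring

lemma LocalSetup.ωb (h : LocalSetup k M c c0 r N A ω Z) (hk : 0 < k) {z : ℂ} (hz : z ∈ N) :
    ‖fderiv ℝ ω z‖ ≤ rexp M + 2 * k := by
  refine ContinuousLinearMap.opNorm_le_bound _ (by positivity) fun v => ?_
  rw [h.ω_der z hz]
  have h1 : ‖Complex.exp (I * A z)‖ ≤ rexp M := by
    have := exp_bd M (-A z) (by rw [norm_neg]; exact h.A_bd z hz)
    simpa using this
  have h2 := h.ω_im z hz
  refine (norm_add_le _ _).trans ?_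
  simp only [norm_mul, norm_neg, Complex.norm_I, one_mul, Complex.norm_real, Real.norm_eq_abs, abs_of_pos hk, abs_of_pos h2.1, Complex.norm_ofNat]
  have := Complex.abs_im_le_norm v
  calc _ ≤ rexp M * ‖v‖ + 2 * k * 1 * ‖v‖ := by gcongr; exact h2.2
    _ = _ := by ring

lemma grad_local (k M c c0 : ℝ) (hk : 0 < k) (hM : 0 ≤ M) (hc : 0 < c) (hc0 : 0 < c0) :
    ∃ CG : ℝ → ℝ, (∀ x, 0 ≤ CG x) ∧ ∀ (r : ℝ) (N : Set ℂ) (A ω Z : ℂ → ℂ), r ≤ 1 → LocalSetup k M c c0 r N A ω Z →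
    ∀ M2 s p q : ℝ, |s| ≤ M2 → |p| ≤ M2 → |q| ≤ M2 → ∀ w ∈ hDisc (r/2), ∀ S : ℝ,
    (∀ w' ∈ hDisc r, ‖w'‖ ≤ 2 * ‖w‖ → ‖(A ∘ Z) w' - (s + p * w' + q * w'.re)‖ ≤ S) →
    w.im * ‖fderiv ℝ (A ∘ Z) w 1 - (p + q)‖ ≤ CG M2 * (S + w.im ^ 2) := by
  obtain ⟨C, hC, hab⟩ := grad_absorb
  have key : ∀ m : ℝ, ∃ G : ℝ, 0 ≤ G ∧ ∀ (r : ℝ) (N : Set ℂ) (A ω Z : ℂ → ℂ), r ≤ 1 → LocalSetup k M c c0 r N A ω Z →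
    ∀ s p q : ℝ, |s| ≤ m → |p| ≤ m → |q| ≤ m → ∀ w ∈ hDisc (r/2), ∀ S : ℝ,
    (∀ w' ∈ hDisc r, ‖w'‖ ≤ 2 * ‖w‖ → ‖(A ∘ Z) w' - (s + p * w' + q * w'.re)‖ ≤ S) →
    w.im * ‖fderiv ℝ (A ∘ Z) w 1 - (p + q)‖ ≤ G * (S + w.im ^ 2) := by
    intro m
    by_cases hm : m < 0
    · exact ⟨0, le_rfl, fun _ _ _ _ _ _ _ s _ _ hs => absurd (abs_nonneg s) (by linarith)⟩
    push Not at hm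
    set K1 := rexp M + 2 * k with hK1
    have K1p : 0 < K1 := by positivity
    set κ := k * rexp (3 * (2 * M)) + m * rexp (3 * M) with hκ
    have κ0 : 0 ≤ κ := by positivity
    set M1 := κ * (2 * m * K1) + 2 * m * k * K1 with hM1
    have M10 : 0 ≤ M1 := by positivity
    set c2 := min c (min (1/(2*K1)) (1/(C * κ + 1))) with hc2
    have c2p : 0 < c2 := by rw [hc2]; positivity
    have c2a : c2 ≤ c := min_le_left _ _
    have c2b : c2 * K1 ≤ 1/2 := by
      have : c2 ≤ 1/(2*K1) := (min_le_right _ _).trans (min_le_left _ _)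
      calc c2 * K1 ≤ 1/(2*K1) * K1 := by gcongr
        _ = 1/2 := by field_simp
    have c2c : C * κ * c2 ≤ 1 := by
      have : c2 ≤ 1/(C * κ + 1) := (min_le_right _ _).trans (min_le_right _ _)
      calc C * κ * c2 ≤ C * κ * (1/(C * κ + 1)) := by gcongr
        _ ≤ 1 := by rw [mul_one_div, div_le_one (by positivity)]; linarith
    refine ⟨C * (1 + c2 ^ 2 * M1) / (c2 * c0), by positivity, fun r N A ω Z hr h s p q hs hp hq w hw S hS => ?_⟩
    have hwr : w ∈ hDisc r := hDisc_mono (by linarith [hDisc_pos hw, hw.1]) hw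
    obtain ⟨hz, hωz⟩ := h.Z_mem w hwr
    have ip := hw.2
    have him : w.im ≤ 1 := (wim_le hw).trans (by linarith [hw.1])
    set z0 := Z w with hz0
    set ρ := c2 * w.im with hρ
    have ρp : 0 < ρ := by positivity
    have bN : Metric.ball z0 ρ ⊆ N := (Metric.ball_subset_ball (by rw [hρ]; gcongr)).trans (h.Z_ball w hwr)
    set e : ℂ → ℂ := fun z => A z - (s + p * ω z + q * (ω z).re) with he
    have ωl : ∀ z ∈ Metric.ball z0 ρ, ∀ z' ∈ Metric.ball z0 ρ, ‖ω z - ω z'‖ ≤ K1 * ‖z - z'‖ := by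
      intro z hz z' hz'
      exact (convex_ball z0 ρ).norm_image_sub_le_of_norm_fderiv_le (𝕜 := ℝ)
        (fun w hw => (h.ω_c1.differentiableOn one_ne_zero).differentiableAt (h.N_open.mem_nhds (bN hw))) (fun w hw => h.ωb hk (bN hw)) hz' hz
    have ec : ContDiffOn ℝ 1 e (Metric.ball z0 ρ) := by
      have h1 := h.A_c1.mono bN
      have h2 := h.ω_c1.mono bN
      have h3 : ContDiffOn ℝ 1 (fun z => ((ω z).re : ℂ)) (Metric.ball z0 ρ) :=
        (Complex.ofRealCLM.comp Complex.reCLM).contDiff.comp_contDiffOn h2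
      exact h1.sub ((contDiffOn_const.add (contDiffOn_const.mul h2)).add (contDiffOn_const.mul h3))
    have S0 : 0 ≤ S := (norm_nonneg _).trans (hS w hwr (by linarith [norm_nonneg w]))
    have main := hab e S κ M1 z0 ρ ρp ec (by
      intro z hz'
      have hzN := bN hz'
      have d1 := ωl z hz' z0 (Metric.mem_ball_self ρp)
      have d2 : ‖z - z0‖ < ρ := by simpa [dist_eq_norm] using hz'
      have d3 : ‖ω z - w‖ ≤ w.im / 2 := by
        rw [hωz] at d1
        calc _ ≤ K1 * ‖z - z0‖ := d1
          _ ≤ K1 * ρ := by gcongr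
          _ = (c2 * K1) * w.im := by rw [hρ]; ring
          _ ≤ 1/2 * w.im := by gcongr
          _ = _ := by ring
      have d4 : ‖ω z‖ ≤ ‖w‖ + w.im / 2 := by
        calc ‖ω z‖ = ‖w + (ω z - w)‖ := by ring_nf
          _ ≤ _ := (norm_add_le _ _).trans (by gcongr)
      have wl := wim_le hw
      have m1 : ω z ∈ hDisc r := ⟨by linarith [hw.1], (h.ω_im z hzN).1⟩
      have := hS (ω z) m1 (by linarith)
      have e1 : Z (ω z) = z := h.ω_inj (h.Z_mem _ m1).1 hzN (h.Z_mem _ m1).2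
      rw [Function.comp_apply, e1] at this
      exact this) κ0 M10 (by
      intro z hzb z' hzb'
      have hzN := bN hzb
      have hzN' := bN hzb'
      obtain ⟨-, -, -, d1⟩ := h.eD s p q hzN
      obtain ⟨-, -, -, d2⟩ := h.eD s p q hzN'
      rw [he, d1, d2]
      have x1 : ‖Complex.exp (-(2 * I * (A z).re)) - Complex.exp (-(2 * I * (A z').re))‖ ≤ rexp (3 * (2 * M)) * (2 * ‖A z - A z'‖) := by
        have := exp_tay1 (2 * M) (2 * (A z).re) (2 * (A z').re) (by
          simpa using (Complex.abs_re_le_norm (A z)).trans (h.A_bd z hzN)) (by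
          simpa using (Complex.abs_re_le_norm (A z')).trans (h.A_bd z' hzN'))
        have e1 : ∀ x : ℂ, -I * (2 * x) = -(2 * I * x) := fun x => by ring
        rw [e1, e1] at this
        refine this.trans ?_
        gcongr
        rw [← mul_sub, norm_mul, ← Complex.ofReal_sub, ← Complex.sub_re]
        simp only [Complex.norm_ofNat, Complex.norm_real]
        gcongr
        exact Complex.abs_re_le_norm _
      have x2 : ‖Complex.exp (I * A z) - Complex.exp (I * A z')‖ ≤ rexp (3 * M) * ‖A z - A z'‖ := by
        have := exp_tay1 M (-A z) (-A z') (by rw [norm_neg]; exact h.A_bd z hzN) (by rw [norm_neg]; exact h.A_bd z' hzN')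
        rw [neg_mul_neg, neg_mul_neg, ← norm_neg (-A z - _)] at this
        refine this.trans (le_of_eq ?_)
        congr 2; ring
      have x3 := ωl z hzb z' hzb'
      have x4 : |(ω z).im - (ω z').im| ≤ ‖ω z - ω z'‖ := by
        rw [← Complex.sub_im]; exact Complex.abs_im_le_norm _
      have x5 : ‖A z - A z'‖ ≤ ‖e z - e z'‖ + 2 * m * ‖ω z - ω z'‖ := by
        have e1 : A z - A z' = (e z - e z') + (p * (ω z - ω z') + q * ((ω z - ω z').re : ℂ)) := by
          simp only [he, Complex.sub_re]; push_cast; ring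
        rw [e1]
        refine (norm_add_le _ _).trans ?_
        gcongr
        refine (norm_add_le _ _).trans ?_
        simp only [norm_mul, Complex.norm_real, Real.norm_eq_abs]
        have := Complex.abs_re_le_norm (ω z - ω z')
        calc _ ≤ m * ‖ω z - ω z'‖ + m * ‖ω z - ω z'‖ := by gcongr
          _ = _ := by ring
      have e2 : (-(I * k / 2) * (1 + Complex.exp (-(2 * I * (A z).re))) - (p * (I * k * (ω z).im) + q * (I * starRingEnd ℂ (Complex.exp (I * A z)) / 2 + I * k * (ω z).im))) - (-(I * k / 2) * (1 + Complex.exp (-(2 * I * (A z').re))) - (p * (I * k * (ω z').im) + q * (I * starRingEnd ℂ (Complex.exp (I * A z')) / 2 + I * k * (ω z').im)))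
        = -(I * k / 2) * (Complex.exp (-(2 * I * (A z).re)) - Complex.exp (-(2 * I * (A z').re))) - (p + q) * I * k * (((ω z).im - (ω z').im : ℝ) : ℂ) - q * I / 2 * starRingEnd ℂ (Complex.exp (I * A z) - Complex.exp (I * A z')) := by
        rw [map_sub]; push_cast; ring
      rw [e2]
      refine (norm_sub_le _ _).trans ((add_le_add_left (norm_sub_le _ _) _).trans ?_)
      have pq : ‖(p:ℂ) + q‖ ≤ 2 * m := by
        refine (norm_add_le _ _).trans ?_
        simp only [Complex.norm_real, Real.norm_eq_abs]; linarith
      simp only [norm_mul, norm_neg, norm_div, Complex.norm_I, one_mul, mul_one, Complex.norm_real, RCLike.norm_conj, Real.norm_eq_abs, abs_of_pos hk, Complex.norm_ofNat]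
      calc _ ≤ k / 2 * (rexp (3 * (2 * M)) * (2 * ‖A z - A z'‖)) + 2 * m * k * ‖ω z - ω z'‖ + m / 1 * (rexp (3 * M) * ‖A z - A z'‖) := by
            gcongr
            norm_num
        _ = κ * ‖A z - A z'‖ + 2 * m * k * ‖ω z - ω z'‖ := by rw [hκ]; ring
        _ ≤ κ * (‖e z - e z'‖ + 2 * m * ‖ω z - ω z'‖) + 2 * m * k * ‖ω z - ω z'‖ := by gcongr
        _ ≤ κ * (‖e z - e z'‖ + 2 * m * (K1 * ‖z - z'‖)) + 2 * m * k * (K1 * ‖z - z'‖) := by gcongr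
        _ = _ := by rw [hM1]; ring) (by
      calc C * κ * ρ = C * κ * c2 * w.im := by rw [hρ]; ring
        _ ≤ 1 * 1 := by gcongr
        _ = 1 := by norm_num)
    obtain ⟨zc, L, hL, hL2, hZ⟩ := h.ZD hk hc0 hwr
    obtain ⟨T, hT, hT2, -⟩ := h.eD s p q hz
    have hA : HasFDerivAt A (fderiv ℝ A z0) z0 :=
      ((h.A_c1.contDiffAt (h.N_open.mem_nhds hz)).differentiableAt one_ne_zero).hasFDerivAt
    have d1 : fderiv ℝ (A ∘ Z) w 1 - (p + q) = T (L.symm 1) := by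
      rw [(hA.comp w hZ).fderiv, hT2, ← hL]; simp
    have d2 : ‖fderiv ℝ (A ∘ Z) w 1 - (p + q)‖ ≤ ‖fderiv ℝ e z0‖ / c0 := by
      rw [d1, hT.fderiv]
      calc _ ≤ ‖T‖ * ‖L.symm 1‖ := T.le_opNorm _
        _ ≤ ‖T‖ * (‖(1:ℂ)‖ / c0) := by gcongr; exact hL2 1
        _ = _ := by simp; ring
    calc _ ≤ w.im * (‖fderiv ℝ e z0‖ / c0) := by gcongr
      _ = (ρ * ‖fderiv ℝ e z0‖) / (c2 * c0) := by rw [hρ]; field_simp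
      _ ≤ (C * (S + ρ ^ 2 * M1)) / (c2 * c0) := by gcongr
      _ ≤ (C * (1 + c2 ^ 2 * M1) * (S + w.im ^ 2)) / (c2 * c0) := by
        gcongr ?_ / _
        rw [mul_assoc]
        gcongr
        have : 0 ≤ c2 ^ 2 * M1 * S := by positivity
        rw [hρ]
        nlinarith [sq_nonneg w.im]
      _ = _ := by ring
  choose G hG0 hG using key
  exact ⟨G, hG0, fun r N A ω Z hr h M2 => hG M2 r N A ω Z hr h⟩

theorem local_expansion (k M c c0 r : ℝ) (hk : 0 < k) (hM : 0 ≤ M) (hc : 0 < c) (hc0 : 0 < c0) (hr : 0 < r) (hr1 : r ≤ 1) :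
    ∃ C > 0, ∀ (N : Set ℂ) (A ω Z : ℂ → ℂ), LocalSetup k M c c0 r N A ω Z →
    ∃ q0 q1 q2 : ℝ, |q0| ≤ C ∧ |q1| ≤ C ∧ |q2| ≤ C ∧ ∀ w ∈ hDisc (r/512), ‖A (Z w) - (q0 + q1 * w.re + q2 * w.re ^ 2)‖ ≤ C * (‖w‖ ^ (5/2:ℝ) + w.im) := by
  obtain ⟨CG, h0, hG⟩ := grad_local k M c c0 hk hM hc hc0
  obtain ⟨C, hC, h⟩ := expansion k M r CG hk hM hr hr1 h0
  refine ⟨C, hC, fun N A ω Z hs => h (A ∘ Z) ⟨?_, ?_, ?_, ?_, ?_⟩⟩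
  · exact hs.A_c1.comp (fun w hw => (hs.ZD hk hc0 hw).1.contDiffWithinAt) (fun w hw => (hs.Z_mem w hw).1)
  · exact fun w hw => hs.A_bd _ (hs.Z_mem w hw).1
  · exact fun w hw => hs.aD hk hc0 hw
  · exact hG r N A ω Z hr1 hs
  · exact hs.bdry
end ModA7b

section ModB1
open MeasureTheory
open Complex (I)

def Rg (φ : ℝ → ℝ) : Set ℂ := {z | z.im < 0 ∧ z.re < φ z.im}
def Rgc (φ : ℝ → ℝ) : Set ℂ := {z | z.im < 0 ∧ z.re ≤ φ z.im}

structure FB (k K : ℝ) (φ : ℝ → ℝ) (U P Q : ℂ → ℝ) : Prop where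
  k_pos : 0 < k
  K_pos : 0 < K
  φa : AnalyticOnNhd ℝ φ (Iio 0)
  U_der : ∀ z ∈ Rg φ, HasFDerivAt U (P z • Complex.reCLM + Q z • Complex.imCLM) z
  P_c1 : ContDiffOn ℝ 1 P (Rg φ)
  Q_c1 : ContDiffOn ℝ 1 Q (Rg φ)
  sym : ∀ z ∈ Rg φ, fderiv ℝ P z I = fderiv ℝ Q z 1
  pde : ∀ z ∈ Rg φ, fderiv ℝ P z 1 + fderiv ℝ Q z I = 2 * k * P z
  P_neg : ∀ z ∈ Rg φ, P z < 0
  P_bd : ∀ z ∈ Rg φ, |P z| ≤ K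
  Q_bd : ∀ z ∈ Rg φ, |Q z| ≤ K
  U_pos : ∀ z ∈ Rg φ, 0 < U z
  U_one : ∀ z ∈ Rg φ, U z ≤ 1
  U_zero : ∀ y < 0, U (φ y + y * I) = 0
  U_cont : ContinuousOn U (Rgc φ)
  P_cont : ContinuousOn P (Rgc φ)
  Q_cont : ContinuousOn Q (Rgc φ)
  P_bdry : ∀ y < 0, P (φ y + y * I) = -1 / √(1 + deriv φ y ^ 2)
  Q_bdry : ∀ y < 0, Q (φ y + y * I) = deriv φ y / √(1 + deriv φ y ^ 2)

section C1
variable {d D μ c : ℝ} {u : ℝ → ℝ → ℝ} {φ : ℝ → ℝ}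

lemma tw_open (hu : OneSpeciesTW d D μ c u) : IsOpen (posSet u ∩ {p | p.2 < 0}) := by
  obtain ⟨V, hV, h⟩ := hu.relOpen
  have : posSet u ∩ {p | p.2 < 0} = V ∩ {p | p.2 < 0} := by
    rw [h]; ext p; simp only [lowerH, mem_inter_iff, mem_ofPred_eq]
    constructor
    · rintro ⟨⟨a, b⟩, c⟩; exact ⟨a, c⟩
    · rintro ⟨a, c⟩; exact ⟨⟨a, c.le⟩, c⟩
  rw [this]
  exact hV.inter (isOpen_lt continuous_snd continuous_const)

lemma tw_left (hu : OneSpeciesTW d D μ c u) (hφ : ContinuousOn φ (Iio 0))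
    (hΓ : freeBdry u = {p : ℝ × ℝ | ∃ y < (0:ℝ), p = (φ y, y)}) {x y : ℝ} (hy : y < 0) (hx : x < φ y) :
    0 < u x y := by
  set L : Set (ℝ × ℝ) := (fun q : ℝ × ℝ => (φ q.2 + q.1, q.2)) '' (Iio 0 ×ˢ Iio 0) with hL
  have hLp : IsPreconnected L := by
    apply IsPreconnected.image
    · exact ((convex_Iio 0).prod (convex_Iio 0)).isPreconnected
    · apply ContinuousOn.prodMk _ continuousOn_snd
      exact (hφ.comp continuousOn_snd (fun q hq => hq.2)).add continuousOn_fst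
  have hmem : ∀ {x y : ℝ}, y < 0 → x < φ y → (x, y) ∈ L := fun {x y} hy hx =>
    ⟨(x - φ y, y), ⟨by simp; linarith, hy⟩, by simp⟩
  obtain ⟨M, hM⟩ := hu.lim_left 1 one_pos
  by_contra hcon
  have h1 : (L ∩ posSet u).Nonempty := by
    refine ⟨(min M (φ (-1) - 1), -1), hmem (by norm_num) ((min_le_right _ _).trans_lt (by linarith)), by norm_num, ?_⟩
    have := hM (min M (φ (-1) - 1)) (min_le_left _ _) (-1) (by norm_num)
    rw [abs_lt] at this
    simp only
    linarith [this.1]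
  have h2 : (L ∩ (posSet u)ᶜ).Nonempty := ⟨(x, y), hmem hy hx, fun h => hcon h.2⟩
  have hint : ∃ p ∈ L, p ∈ frontier (posSet u) := by
    by_contra! hno
    have hsub : L ⊆ interior (posSet u) ∪ (closure (posSet u))ᶜ := by
      intro p hp
      by_cases h : p ∈ interior (posSet u)
      · exact Or.inl h
      · exact Or.inr (fun h' => hno p hp ⟨h', h⟩)
    obtain ⟨a, ha, ha'⟩ := h1
    obtain ⟨b, hb, hb'⟩ := h2
    obtain ⟨p, -, hp1, hp2⟩ := hLp _ _ isOpen_interior isClosed_closure.isOpen_compl hsub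
      ⟨a, ha, (hsub ha).resolve_right (fun h => h (subset_closure ha'))⟩
      ⟨b, hb, (hsub hb).resolve_left (fun h => hb' (interior_subset h))⟩
    exact hp2 (subset_closure (interior_subset hp1))
  obtain ⟨p, ⟨q, hq, rfl⟩, hp⟩ := hint
  have : (φ q.2 + q.1, q.2) ∈ freeBdry u := ⟨hp, hq.2⟩
  rw [hΓ] at this
  obtain ⟨y', hy', h'⟩ := this
  simp only [Prod.mk.injEq] at h'
  have h3 := hq.1
  simp only [mem_Iio] at h3
  rw [← h'.2] at h'
  linarith [h'.1]

lemma tw_zero (hu : OneSpeciesTW d D μ c u)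
    (hΓ : freeBdry u = {p : ℝ × ℝ | ∃ y < (0:ℝ), p = (φ y, y)}) {y : ℝ} (hy : y < 0) :
    u (φ y) y = 0 := by
  by_contra hne
  have h0 := (hu.mem01 (φ y) y hy.le).1
  have hp : 0 < u (φ y) y := lt_of_le_of_ne h0 (Ne.symm hne)
  have h1 : (φ y, y) ∈ freeBdry u := by rw [hΓ]; exact ⟨y, hy, rfl⟩
  have h2 : (φ y, y) ∈ interior (posSet u) := by
    apply mem_interior.mpr
    exact ⟨_, inter_subset_left, tw_open hu, ⟨hy.le, hp⟩, hy⟩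
  exact h1.1.2 h2

lemma tw_fderiv (hu : OneSpeciesTW d D μ c u) {p : ℝ × ℝ} (hp : p ∈ posSet u ∩ {p | p.2 < 0}) :
    fderiv ℝ (fun p : ℝ × ℝ => u p.1 p.2) p (1, 0) = pdx u p.1 p.2 ∧
    fderiv ℝ (fun p : ℝ × ℝ => u p.1 p.2) p (0, 1) = pdy u p.1 p.2 := by
  have hd : HasFDerivAt (fun p : ℝ × ℝ => u p.1 p.2) (fderiv ℝ (fun p : ℝ × ℝ => u p.1 p.2) p) p :=
    ((hu.smooth.contDiffAt ((tw_open hu).mem_nhds hp)).differentiableAt two_ne_zero).hasFDerivAt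
  obtain ⟨x, y⟩ := p
  constructor
  · have h1 : HasDerivAt (fun t : ℝ => (t, y)) ((1:ℝ), (0:ℝ)) x := (hasDerivAt_id x).prodMk (hasDerivAt_const x y)
    exact (HasFDerivAt.comp_hasDerivAt (f := fun t : ℝ => (t, y)) x hd h1).deriv.symm
  · have h1 : HasDerivAt (fun t : ℝ => (x, t)) ((0:ℝ), (1:ℝ)) y := (hasDerivAt_const y x).prodMk (hasDerivAt_id y)
    exact (HasFDerivAt.comp_hasDerivAt (f := fun t : ℝ => (x, t)) y hd h1).deriv.symm

lemma tw_fderiv2 (hu : OneSpeciesTW d D μ c u) {p : ℝ × ℝ} (hp : p ∈ posSet u ∩ {p | p.2 < 0}) :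
    fderiv ℝ (fderiv ℝ (fun p : ℝ × ℝ => u p.1 p.2)) p (1, 0) (1, 0) = pdxx u p.1 p.2 ∧
    fderiv ℝ (fderiv ℝ (fun p : ℝ × ℝ => u p.1 p.2)) p (0, 1) (0, 1) = pdyy u p.1 p.2 := by
  have hd : HasFDerivAt (fderiv ℝ (fun p : ℝ × ℝ => u p.1 p.2)) (fderiv ℝ (fderiv ℝ (fun p : ℝ × ℝ => u p.1 p.2)) p) p :=
    (((hu.smooth.contDiffAt ((tw_open hu).mem_nhds hp)).fderiv_right (m := 1) (by norm_num)).differentiableAt one_ne_zero).hasFDerivAt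
  obtain ⟨x, y⟩ := p
  constructor
  · have h1 : HasDerivAt (fun t : ℝ => (t, y)) ((1:ℝ), (0:ℝ)) x := (hasDerivAt_id x).prodMk (hasDerivAt_const x y)
    have h2 := HasFDerivAt.comp_hasDerivAt (f := fun t : ℝ => (t, y)) x hd h1
    have h3 := h2.clm_apply (hasDerivAt_const x ((1:ℝ), (0:ℝ)))
    simp only [map_zero, add_zero] at h3
    rw [← h3.deriv]
    apply Filter.EventuallyEq.deriv_eq
    have : ∀ᶠ t in 𝓝 x, (t, y) ∈ posSet u ∩ {p | p.2 < 0} :=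
      h1.continuousAt.eventually ((tw_open hu).mem_nhds hp)
    filter_upwards [this] with t ht
    exact (tw_fderiv hu ht).1
  · have h1 : HasDerivAt (fun t : ℝ => (x, t)) ((0:ℝ), (1:ℝ)) y := (hasDerivAt_const y x).prodMk (hasDerivAt_id y)
    have h2 := HasFDerivAt.comp_hasDerivAt (f := fun t : ℝ => (x, t)) y hd h1
    have h3 := h2.clm_apply (hasDerivAt_const y ((0:ℝ), (1:ℝ)))
    simp only [map_zero, add_zero] at h3
    rw [← h3.deriv]
    apply Filter.EventuallyEq.deriv_eq
    have : ∀ᶠ t in 𝓝 y, (x, t) ∈ posSet u ∩ {p | p.2 < 0} :=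
      h1.continuousAt.eventually ((tw_open hu).mem_nhds hp)
    filter_upwards [this] with t ht
    exact (tw_fderiv hu ht).2
end C1
end ModB1

section ModB1b
open MeasureTheory
open Complex (I)

lemma isOpen_Rg {φ : ℝ → ℝ} (hφ : ContinuousOn φ (Iio 0)) : IsOpen (Rg φ) := by
  have h1 : IsOpen {z : ℂ | z.im < 0} := isOpen_lt Complex.continuous_im continuous_const
  have h2 : ContinuousOn (fun z : ℂ => φ z.im - z.re) {z : ℂ | z.im < 0} :=
    (hφ.comp Complex.continuous_im.continuousOn (fun z hz => hz)).sub Complex.continuous_re.continuousOn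
  have := h2.isOpen_inter_preimage h1 (isOpen_Ioi (a := 0))
  convert this using 1
  ext z; simp [Rg]

/-- tangency at the free boundary -/
lemma tangency {K y0 : ℝ} {φ : ℝ → ℝ} {U P Q : ℂ → ℝ} (hK : 0 < K) (hφ : ContDiffOn ℝ 1 φ (Iio 0))
    (hU : ∀ z ∈ Rg φ, HasFDerivAt U (P z • Complex.reCLM + Q z • Complex.imCLM) z)
    (hUK : ∀ z ∈ Rg φ, |U z| ≤ K * (φ z.im - z.re))
    (hP : ContinuousOn P (Rgc φ)) (hQ : ContinuousOn Q (Rgc φ)) (hy0 : y0 < 0) :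
    P (φ y0 + y0 * I) * deriv φ y0 + Q (φ y0 + y0 * I) = 0 := by
  by_contra hne
  set κ := P (φ y0 + y0 * I) * deriv φ y0 + Q (φ y0 + y0 * I) with hκ
  have hκp : 0 < |κ| := abs_pos.mpr hne
  have hcφ := hφ.continuousOn
  have hdφ : ContinuousOn (deriv φ) (Iio 0) := hφ.continuousOn_deriv_of_isOpen isOpen_Iio le_rfl
  let e : ℝ × ℝ → ℂ := fun q => (φ q.2 - q.1 : ℝ) + q.2 * I
  have he : ∀ q : ℝ × ℝ, (e q).im = q.2 ∧ (e q).re = φ q.2 - q.1 := fun q => by simp [e]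
  set S : Set (ℝ × ℝ) := Ici 0 ×ˢ Iio 0 with hS
  have hec : ContinuousOn e S := by
    have h1 : ContinuousOn (fun q : ℝ × ℝ => φ q.2 - q.1) S :=
      (hcφ.comp continuousOn_snd (fun q hq => hq.2)).sub continuousOn_fst
    exact (Complex.continuous_ofReal.comp_continuousOn h1).add
      ((Complex.continuous_ofReal.comp_continuousOn continuousOn_snd).mul continuousOn_const)
  have hem : MapsTo e S (Rgc φ) := fun q hq => by
    have := hq.1
    have h2 := hq.2
    simp only [mem_Ici, mem_Iio] at this h2
    refine ⟨by rw [(he q).1]; exact h2, by rw [(he q).1, (he q).2]; linarith⟩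
  have hE : ContinuousOn (fun q : ℝ × ℝ => P (e q) * deriv φ q.2 + Q (e q)) S :=
    ((hP.comp hec hem).mul (hdφ.comp continuousOn_snd (fun q hq => hq.2))).add (hQ.comp hec hem)
  have h0S : ((0:ℝ), y0) ∈ S := ⟨by simp, hy0⟩
  have h1 := (hE _ h0S).eventually (Metric.ball_mem_nhds _ (half_pos hκp))
  rw [hS, nhdsWithin_prod_eq, Filter.eventually_iff, Metric.nhdsWithin_basis_ball.prod Metric.nhdsWithin_basis_ball |>.mem_iff] at h1
  obtain ⟨⟨a, b⟩, ⟨ha, hb⟩, hab⟩ := h1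
  simp only at ha hb hab
  set δ := min (b/2) (-y0/2) with hδ
  have hδp : 0 < δ := lt_min (by linarith) (by linarith)
  have hδb : δ < b := (min_le_left _ _).trans_lt (by linarith)
  have hδ0 : y0 + δ < 0 := by linarith [min_le_right (b/2) (-y0/2)]
  obtain ⟨h, hh0, hh⟩ : ∃ h, 0 < h ∧ h < min a (|κ| * δ / (4 * K)) :=
    exists_between (lt_min ha (by positivity))
  have hha := hh.trans_le (min_le_left _ _)
  have hhK := hh.trans_le (min_le_right _ _)
  rw [lt_div_iff₀ (by positivity)] at hhK
  have hmem : ∀ y < 0, e (h, y) ∈ Rg φ := fun y hy => by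
    refine ⟨by rw [(he _).1]; exact hy, by rw [(he _).1, (he _).2]; simp; linarith⟩
  have hder : ∀ y < 0, HasDerivAt (fun y => U (e (h, y))) (P (e (h,y)) * deriv φ y + Q (e (h,y))) y := by
    intro y hy
    have h2 : HasDerivAt φ (deriv φ y) y :=
      ((hφ.contDiffAt (Iio_mem_nhds hy)).differentiableAt one_ne_zero).hasDerivAt
    have h3 : HasDerivAt (fun y => e (h, y)) ((deriv φ y : ℝ) + 1 * I) y := by
      refine HasDerivAt.add (HasDerivAt.ofReal_comp (f := fun y => φ y - h) (h2.sub_const h)) ?_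
      exact (HasDerivAt.ofReal_comp (hasDerivAt_id y)).mul_const I
    have := (hU _ (hmem y hy)).comp_hasDerivAt y h3
    refine HasDerivAt.congr_deriv this ?_
    change P (e (h,y)) * ((deriv φ y : ℝ) + 1 * I : ℂ).re + Q (e (h,y)) * ((deriv φ y : ℝ) + 1 * I : ℂ).im = _
    simp
  obtain ⟨y, hy, hyE⟩ := exists_hasDerivAt_eq_slope (fun y => U (e (h, y))) _ (show y0 < y0 + δ by linarith)
    (fun y hy => (hder y (by linarith [hy.2])).continuousAt.continuousWithinAt)
    (fun y hy => hder y (by linarith [hy.2]))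
  have hin := hab (show ((h, y) : ℝ × ℝ) ∈ _ from ⟨⟨by simp [abs_of_pos hh0, hha], hh0.le⟩, ⟨by
    rw [Metric.mem_ball, Real.dist_eq, abs_of_pos (by linarith [hy.1])]; linarith [hy.2], by
    simp; linarith [hy.2]⟩⟩)
  simp only [Real.dist_eq, Metric.ball, mem_ofPred_eq, hyE] at hin
  have e0 : e (0, y0) = φ y0 + y0 * I := by simp [e]
  rw [e0, ← hκ] at hin
  have b1 := hUK _ (hmem y0 hy0)
  have b2 := hUK _ (hmem (y0 + δ) hδ0)
  rw [(he _).1, (he _).2] at b1 b2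
  simp only [sub_sub_cancel, add_sub_cancel_left] at b1 b2 hin
  have h5 : |(U (e (h, y0 + δ)) - U (e (h, y0))) / δ| ≤ 2 * K * h / δ := by
    rw [abs_div, abs_of_pos hδp]
    gcongr
    calc _ ≤ |U (e (h, y0 + δ))| + |U (e (h, y0))| := abs_sub _ _
      _ ≤ _ := by linarith
  have h6 : 2 * K * h / δ < |κ| / 2 := by
    rw [div_lt_iff₀ hδp]; linarith
  have := abs_sub_abs_le_abs_sub κ ((U (e (h, y0 + δ)) - U (e (h, y0))) / δ)
  rw [abs_sub_comm] at this
  linarith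

lemma tw_FB {d D μ c : ℝ} (hd : 0 < d)
    {u : ℝ → ℝ → ℝ} (hu : OneSpeciesTW d D μ c u)
    (hLip : ∃ K : NNReal, LipschitzOnWith K (fun p : ℝ × ℝ => u p.1 p.2) lowerH)
    (hmono : ∀ p ∈ posSet u, pdx u p.1 p.2 < 0)
    {φ : ℝ → ℝ} (hφa : AnalyticOnNhd ℝ φ (Iio 0))
    (hΓ : freeBdry u = {p : ℝ × ℝ | ∃ y < (0:ℝ), p = (φ y, y)}) :
    ∃ K U P Q, FB (c / (2 * d)) K φ U P Q := by
  obtain ⟨K, hK⟩ := hLip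
  obtain ⟨G1, G2, hG1, hG2, hG, hG1G2⟩ := hu.grad_ext
  set W : ℝ × ℝ → ℝ := fun p => u p.1 p.2 with hW
  let e : ℂ →L[ℝ] ℝ × ℝ := Complex.reCLM.prod Complex.imCLM
  have he : ∀ z, e z = (z.re, z.im) := fun z => rfl
  have hφc : ContinuousOn φ (Iio 0) := hφa.continuousOn
  have hφ1 : ContDiffOn ℝ 1 φ (Iio 0) := hφa.contDiffOn isOpen_Iio.uniqueDiffOn
  set S := posSet u ∩ {p | p.2 < 0} with hS
  have hSo : IsOpen S := tw_open hu
  have hRS : ∀ z ∈ Rg φ, e z ∈ S := fun z hz => ⟨⟨hz.1.le, tw_left hu hφc hΓ hz.1 hz.2⟩, hz.1⟩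
  have hΓm : ∀ y < 0, (φ y, y) ∈ freeBdry u := fun y hy => by rw [hΓ]; exact ⟨y, hy, rfl⟩
  have hRc : MapsTo e (Rgc φ) (posSet u ∪ freeBdry u) := fun z hz => by
    rcases hz.2.lt_or_eq with h | h
    · exact Or.inl (hRS z ⟨hz.1, h⟩).1
    · right
      rw [he, h]; exact hΓm _ hz.1
  have hRo := isOpen_Rg hφc
  have hW2 : ∀ p ∈ S, ContDiffAt ℝ 2 W p := fun p hp => hu.smooth.contDiffAt (hSo.mem_nhds hp)
  have hW1 : ∀ p ∈ S, ContDiffAt ℝ 1 (fderiv ℝ W) p := fun p hp => (hW2 p hp).fderiv_right (by norm_num)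
  have hK1 : (0:ℝ) < K + 1 := by positivity
  set P : ℂ → ℝ := fun z => G1 (e z) with hP
  set Q : ℂ → ℝ := fun z => G2 (e z) with hQ
  have hPeq : ∀ z ∈ Rg φ, P z = fderiv ℝ W (e z) (1, 0) := fun z hz => by
    rw [(tw_fderiv hu (hRS z hz)).1]; exact (hG _ (hRS z hz)).1
  have hQeq : ∀ z ∈ Rg φ, Q z = fderiv ℝ W (e z) (0, 1) := fun z hz => by
    rw [(tw_fderiv hu (hRS z hz)).2]; exact (hG _ (hRS z hz)).2
  have hPc : ContinuousOn P (Rgc φ) := hG1.comp e.continuous.continuousOn hRc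
  have hQc : ContinuousOn Q (Rgc φ) := hG2.comp e.continuous.continuousOn hRc
  have hUd : ∀ z ∈ Rg φ, HasFDerivAt (fun z => W (e z)) (P z • Complex.reCLM + Q z • Complex.imCLM) z := by
    intro z hz
    have h1 := (((hW2 _ (hRS z hz)).differentiableAt two_ne_zero).hasFDerivAt).comp z e.hasFDerivAt
    refine HasFDerivAt.congr_fderiv h1 ?_
    apply ContinuousLinearMap.ext
    intro v
    have : e v = v.re • ((1:ℝ), (0:ℝ)) + v.im • ((0:ℝ), (1:ℝ)) := by simp [he]
    change fderiv ℝ W (e z) (e v) = P z * v.re + Q z * v.im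
    rw [this, map_add, map_smul, map_smul, hPeq z hz, hQeq z hz, smul_eq_mul, smul_eq_mul]
    ring
  have hcurve : ∀ v : ℝ × ℝ, ∀ z ∈ Rg φ, HasFDerivAt (fun z => fderiv ℝ W (e z) v)
      (((ContinuousLinearMap.apply ℝ ℝ v).comp (fderiv ℝ (fderiv ℝ W) (e z))).comp e) z := by
    intro v z hz
    have h1 := (((hW1 _ (hRS z hz)).differentiableAt one_ne_zero).hasFDerivAt).comp z e.hasFDerivAt
    exact (ContinuousLinearMap.apply ℝ ℝ v).hasFDerivAt.comp z h1
  have hPf : ∀ z ∈ Rg φ, ∀ v, fderiv ℝ P z v = fderiv ℝ (fderiv ℝ W) (e z) (e v) (1, 0) := by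
    intro z hz v
    rw [Filter.EventuallyEq.fderiv_eq (Filter.eventually_of_mem (hRo.mem_nhds hz) hPeq), (hcurve _ z hz).fderiv]
    rfl
  have hQf : ∀ z ∈ Rg φ, ∀ v, fderiv ℝ Q z v = fderiv ℝ (fderiv ℝ W) (e z) (e v) (0, 1) := by
    intro z hz v
    rw [Filter.EventuallyEq.fderiv_eq (Filter.eventually_of_mem (hRo.mem_nhds hz) hQeq), (hcurve _ z hz).fderiv]
    rfl
  have hc1 : ∀ v : ℝ × ℝ, ContDiffOn ℝ 1 (fun z => fderiv ℝ W (e z) v) (Rg φ) := by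
    intro v z hz
    have h1 := (hW1 _ (hRS z hz)).comp z e.contDiff.contDiffAt
    exact ((ContinuousLinearMap.apply ℝ ℝ v).contDiff.contDiffAt.comp z h1).contDiffWithinAt
  have hLn : ∀ z ∈ Rg φ, ∀ v : ℝ × ℝ, ‖v‖ ≤ 1 → |fderiv ℝ W (e z) v| ≤ K + 1 := by
    intro z hz v hv
    have h1 : ‖fderiv ℝ W (e z)‖ ≤ K := by
      apply norm_fderiv_le_of_lipschitzOn ℝ (s := lowerH) _ hK
      exact mem_of_superset (hSo.mem_nhds (hRS z hz)) (fun p hp => le_of_lt (show p.2 < 0 from hp.2))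
    calc _ ≤ ‖fderiv ℝ W (e z)‖ * ‖v‖ := ContinuousLinearMap.le_opNorm _ _
      _ ≤ K * 1 := by gcongr
      _ ≤ _ := by linarith
  have hUz : ∀ y < 0, W (φ y, y) = 0 := fun y hy => tw_zero hu hΓ hy
  have hUK : ∀ z ∈ Rg φ, |W (e z)| ≤ (K + 1) * (φ z.im - z.re) := by
    intro z hz
    have h1 := hK.norm_sub_le (x := e z) (y := (φ z.im, z.im)) hz.1.le hz.1.le
    rw [hUz _ hz.1, sub_zero, Real.norm_eq_abs] at h1
    have h2 : ‖e z - (φ z.im, z.im)‖ = φ z.im - z.re := by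
      simp only [he, Prod.mk_sub_mk, sub_self, Prod.norm_mk, norm_zero, Real.norm_eq_abs]
      rw [max_eq_left (abs_nonneg _), abs_sub_comm, abs_of_pos (by linarith [hz.2])]
    rw [h2] at h1
    nlinarith [hz.2]
  have hPn : ∀ z ∈ Rg φ, P z < 0 := fun z hz => by
    have h1 := hmono _ (hRS z hz).1
    rwa [← (hG _ (hRS z hz)).1] at h1
  have hbd : ∀ y < 0, P (φ y + y * I) = -1 / √(1 + deriv φ y ^ 2) ∧ Q (φ y + y * I) = deriv φ y / √(1 + deriv φ y ^ 2) := by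
    intro y hy
    have ht := tangency hK1 hφ1 hUd hUK hPc hQc hy
    have hey : e (φ y + y * I) = (φ y, y) := by simp [he]
    have h1 : P (φ y + y * I) ^ 2 + Q (φ y + y * I) ^ 2 = 1 := by
      simp only [hP, hQ, hey]; exact hG1G2 _ (hΓm y hy)
    have h2 : P (φ y + y * I) ≤ 0 := by
      have hc : Tendsto (fun h : ℝ => P ((φ y - h : ℝ) + y * I)) (𝓝[>] 0) (𝓝 (P (φ y + y * I))) := by
        apply (hPc (φ y + y * I) ⟨by simpa using hy, by simp⟩).tendsto.comp
        apply tendsto_nhdsWithin_iff.mpr ⟨?_, ?_⟩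
        · have : Continuous (fun h : ℝ => ((φ y - h : ℝ) + y * I : ℂ)) := by fun_prop
          have h3 := this.tendsto 0
          simp only [sub_zero] at h3
          exact h3.mono_left nhdsWithin_le_nhds
        · filter_upwards [self_mem_nhdsWithin] with h hh
          simp only [mem_Ioi] at hh
          exact ⟨by simpa using hy, by simp [hh.le]⟩
      apply le_of_tendsto hc
      filter_upwards [self_mem_nhdsWithin] with h hh
      simp only [mem_Ioi] at hh
      exact (hPn _ ⟨by simpa using hy, by simp [hh]⟩).le
    set m := deriv φ y
    set p := P (φ y + y * I)
    set q := Q (φ y + y * I)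
    have hq : q = -p * m := by linarith
    have hsp : 0 < √(1 + m ^ 2) := Real.sqrt_pos.mpr (by positivity)
    have hp2 : -p * √(1 + m ^ 2) = 1 := by
      have : (-p * √(1 + m ^ 2)) ^ 2 = 1 := by
        rw [mul_pow, Real.sq_sqrt (by positivity)]; rw [hq] at h1; linear_combination h1
      nlinarith [mul_nonneg (neg_nonneg.mpr h2) hsp.le]
    constructor
    · rw [eq_div_iff hsp.ne']; linarith
    · rw [eq_div_iff hsp.ne', hq]; linear_combination m * hp2
  refine ⟨K + 1, fun z => W (e z), P, Q, ⟨by have := hu.c_pos; positivity, hK1, hφa, hUd, ?_, ?_, ?_, ?_, hPn, ?_, ?_, ?_, ?_, ?_, ?_, hPc, hQc,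
    fun y hy => (hbd y hy).1, fun y hy => (hbd y hy).2⟩⟩
  · exact (hc1 (1,0)).congr hPeq
  · exact (hc1 (0,1)).congr hQeq
  · intro z hz
    rw [hPf z hz, hQf z hz]
    have := (hW2 _ (hRS z hz)).isSymmSndFDerivAt (by simp)
    have h2 := this.eq (0, 1) (1, 0)
    simpa [he] using h2
  · intro z hz
    have h1 := tw_fderiv2 hu (hRS z hz)
    have h2 := hu.pde _ (hRS z hz)
    rw [hPf z hz, hQf z hz]
    have e1 : e 1 = (1, 0) := by simp [he]
    have eI : e I = (0, 1) := by simp [he]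
    rw [e1, eI, h1.1, h1.2, hPeq z hz, (tw_fderiv hu (hRS z hz)).1]
    field_simp
    linarith
  · intro z hz; rw [hPeq z hz]; exact hLn z hz _ (by simp [Prod.norm_mk])
  · intro z hz; rw [hQeq z hz]; exact hLn z hz _ (by simp [Prod.norm_mk])
  · intro z hz; exact (hRS z hz).1.2
  · intro z hz; exact (hu.mem01 _ _ hz.1.le).2
  · intro y hy; have := hUz y hy; simpa [he] using this
  · exact hu.cont.comp e.continuous.continuousOn (fun z hz => hz.1.le)
end ModB1b

section ModB2
open MeasureTheory
open Complex (I)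

lemma sec_min {f f1 : ℝ → ℝ} {a : ℝ} (hf : ∀ᶠ t in 𝓝 (0:ℝ), HasDerivAt f (f1 t) t) (hf1 : HasDerivAt f1 a 0)
    (hmin : IsLocalMin f 0) : f1 0 = 0 ∧ 0 ≤ a := by
  have h0 : f1 0 = 0 := hmin.hasDerivAt_eq_zero hf.self_of_nhds
  refine ⟨h0, ?_⟩
  by_contra! ha
  have hd : deriv f =ᶠ[𝓝 0] f1 := by filter_upwards [hf] with t ht using ht.deriv
  have hmax : IsLocalMax f 0 := isLocalMax_of_deriv_deriv_neg (by rw [hd.deriv_eq, hf1.deriv]; exact ha)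
    (by rw [hd.self_of_nhds, h0]) hf.self_of_nhds.continuousAt
  have hc : f =ᶠ[𝓝 0] fun _ => f 0 := by
    filter_upwards [hmin, hmax] with t h1 h2 using le_antisymm h2 h1
  have hc2 : f1 =ᶠ[𝓝 0] fun _ => 0 := by
    filter_upwards [hf, hc.eventuallyEq_nhds] with t h1 h2
    rw [← h1.deriv, h2.deriv_eq]; simp
  have := hf1.congr_of_eventuallyEq hc2.symm
  have := this.unique (hasDerivAt_const 0 0)
  linarith

lemma line_deriv {g g1 g2 : ℂ → ℝ} {p v : ℂ} (t : ℝ)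
    (hg : HasFDerivAt g (g1 (p + t * v) • Complex.reCLM + g2 (p + t * v) • Complex.imCLM) (p + t * v)) :
    HasDerivAt (fun t : ℝ => g (p + t * v)) (g1 (p + t * v) * v.re + g2 (p + t * v) * v.im) t := by
  have h1 : HasDerivAt (fun t : ℝ => p + t * v) v t := by
    have := ((Complex.ofRealCLM.hasDerivAt (x := t)).mul_const v).const_add p
    simpa using this
  exact HasFDerivAt.comp_hasDerivAt t hg h1

lemma minp {k : ℝ} {S : Set ℂ} (hS : IsCompact S) {g : ℂ → ℝ} (hg : ContinuousOn g S)
    (h : ∀ p ∈ S, 0 ≤ g p ∨ (S ∈ 𝓝 p ∧ ∃ g1 g2 : ℂ → ℝ, ∃ a b : ℝ,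
      (∀ᶠ z in 𝓝 p, HasFDerivAt g (g1 z • Complex.reCLM + g2 z • Complex.imCLM) z) ∧
      HasDerivAt (fun t : ℝ => g1 (p + t * 1)) a 0 ∧ HasDerivAt (fun t : ℝ => g2 (p + t * I)) b 0 ∧
      a + b - 2 * k * g1 p < 0)) : ∀ p ∈ S, 0 ≤ g p := by
  intro p hp
  obtain ⟨q, hq, hmin⟩ := hS.exists_isMinOn ⟨p, hp⟩ hg
  suffices 0 ≤ g q from this.trans (hmin hp)
  rcases h q hq with h1 | ⟨hn, g1, g2, a, b, hd, ha, hb, hlt⟩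
  · exact h1
  have hloc : ∀ᶠ z in 𝓝 q, g q ≤ g z := Filter.eventually_of_mem hn (fun z hz => hmin hz)
  have hcont : ∀ v : ℂ, Tendsto (fun t : ℝ => q + t * v) (𝓝 0) (𝓝 q) := fun v => by
    have : Continuous (fun t : ℝ => q + t * v) := by fun_prop
    simpa using this.tendsto 0
  have key : ∀ v : ℂ, (∀ᶠ t : ℝ in 𝓝 0, HasDerivAt (fun t : ℝ => g (q + t * v)) (g1 (q + t * v) * v.re + g2 (q + t * v) * v.im) t) ∧
      IsLocalMin (fun t : ℝ => g (q + t * v)) 0 := fun v => by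
    refine ⟨?_, ?_⟩
    · filter_upwards [(hcont v).eventually hd] with t ht using line_deriv t ht
    · have := (hcont v).eventually hloc
      simpa [IsLocalMin, IsMinFilter] using this
  have k1 := sec_min (a := a) (key 1).1 (by simpa using ha) (key 1).2
  have k2 := sec_min (a := b) (key I).1 (by simpa using hb) (key I).2
  simp at k1 k2
  rw [k1.1] at hlt
  linarith

lemma ev_bdry {k K : ℝ} {φ : ℝ → ℝ} {U P Q : ℂ → ℝ} (h : FB k K φ U P Q) {s a b : ℝ} (hb : b < 0) (hs : 0 < s)
    (hP : ∀ y ∈ Icc a b, P (φ y + y * I) ≤ -2 * s) :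
    ∃ η > 0, ∀ t, 0 < t → t < η → ∀ y ∈ Icc a b, s * t ≤ U ((φ y - t : ℝ) + y * I) := by
  let e : ℝ × ℝ → ℂ := fun q => (φ q.2 - q.1 : ℝ) + q.2 * I
  have he : ∀ q : ℝ × ℝ, (e q).im = q.2 ∧ (e q).re = φ q.2 - q.1 := fun q => by simp [e]
  set S : Set (ℝ × ℝ) := Icc 0 1 ×ˢ Icc a b with hS
  have hSc : IsCompact S := isCompact_Icc.prod isCompact_Icc
  have hlt : ∀ q ∈ S, q.2 < 0 := fun q hq => lt_of_le_of_lt hq.2.2 hb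
  have hec : ContinuousOn e S := by
    have h1 : ContinuousOn (fun q : ℝ × ℝ => φ q.2 - q.1) S :=
      (h.φa.continuousOn.comp continuousOn_snd (fun q hq => hlt q hq)).sub continuousOn_fst
    exact (Complex.continuous_ofReal.comp_continuousOn h1).add
      ((Complex.continuous_ofReal.comp_continuousOn continuousOn_snd).mul continuousOn_const)
  have hem : MapsTo e S (Rgc φ) := fun q hq => by
    refine ⟨by rw [(he q).1]; exact hlt q hq, by rw [(he q).1, (he q).2]; linarith [hq.1.1]⟩
  have hu := hSc.uniformContinuousOn_of_continuous (h.P_cont.comp hec hem)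
  obtain ⟨δ, hδ, hd⟩ := Metric.uniformContinuousOn_iff.mp hu s hs
  refine ⟨min 1 δ, lt_min one_pos hδ, fun t ht htη y hy => ?_⟩
  have ht1 := htη.trans_le (min_le_left _ _)
  have htδ := htη.trans_le (min_le_right _ _)
  have hy0 : y < 0 := lt_of_le_of_lt hy.2 hb
  have hR : ∀ τ ∈ Ioo 0 t, e (τ, y) ∈ Rg φ := fun τ hτ =>
    ⟨by rw [(he _).1]; exact hy0, by rw [(he _).1, (he _).2]; simp; exact hτ.1⟩
  have hder : ∀ τ ∈ Ioo 0 t, HasDerivAt (fun τ => U (e (τ, y))) (-P (e (τ, y))) τ := fun τ hτ => by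
    have h1 : HasDerivAt (fun τ => e (τ, y)) (-1) τ := by
      have := (HasDerivAt.ofReal_comp ((hasDerivAt_id τ).const_sub (φ y))).add_const (y * I)
      simpa [e] using this
    refine (HasFDerivAt.comp_hasDerivAt τ (h.U_der _ (hR τ hτ)) h1).congr_deriv ?_
    change P (e (τ, y)) * (-1 : ℂ).re + Q (e (τ, y)) * (-1 : ℂ).im = _
    simp
  have hcont : ContinuousOn (fun τ => U (e (τ, y))) (Icc 0 t) := by
    have h2 : ContinuousOn (fun τ : ℝ => ((τ, y) : ℝ × ℝ)) (Icc 0 t) := by fun_prop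
    exact (h.U_cont.comp hec hem).comp h2 (fun τ hτ => ⟨⟨hτ.1, hτ.2.trans ht1.le⟩, hy⟩)
  obtain ⟨τ, hτ, heq⟩ := exists_hasDerivAt_eq_slope _ _ ht hcont hder
  have e0 : e (0, y) = φ y + y * I := by simp [e]
  rw [e0, h.U_zero y hy0, sub_zero, sub_zero, eq_div_iff ht.ne'] at heq
  have h3 := hd (τ, y) ⟨⟨hτ.1.le, by linarith [hτ.2]⟩, hy⟩ (0, y) ⟨⟨le_rfl, zero_le_one⟩, hy⟩ (by
    simp only [Prod.dist_eq, dist_self, Real.dist_eq, sub_zero, abs_of_pos hτ.1]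
    exact max_lt (by linarith [hτ.2]) hδ)
  simp only [Function.comp, Real.dist_eq, e0] at h3
  have h4 := hP y hy
  rw [abs_lt] at h3
  have : s * t ≤ -P (e (τ, y)) * t := by apply mul_le_mul_of_nonneg_right _ ht.le; linarith [h3.2]
  rw [heq] at this
  exact this
end ModB2

section ModB2b
open MeasureTheory
open Complex (I)

lemma FB.open {k K : ℝ} {φ : ℝ → ℝ} {U P Q : ℂ → ℝ} (h : FB k K φ U P Q) : IsOpen (Rg φ) :=
  isOpen_Rg h.φa.continuousOn

lemma FB.anti {k K : ℝ} {φ : ℝ → ℝ} {U P Q : ℂ → ℝ} (h : FB k K φ U P Q) {z : ℂ} {t : ℝ} (ht : 0 < t)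
    (hz : z.im < 0) (hz2 : z.re ≤ φ z.im - t) : U (z + t) ≤ U z := by
  have hR : ∀ τ ∈ Ico 0 t, z + τ * 1 ∈ Rg φ := fun τ hτ => ⟨by simpa using hz, by simp; linarith [hτ.2]⟩
  have hder : ∀ τ ∈ Ico 0 t, HasDerivAt (fun τ : ℝ => U (z + τ * 1)) (P (z + τ * 1)) τ := fun τ hτ => by
    simpa using line_deriv τ (h.U_der _ (hR τ hτ))
  have hcont : ContinuousOn (fun τ : ℝ => U (z + τ * 1)) (Icc 0 t) := by
    have h2 : ContinuousOn (fun τ : ℝ => z + τ * 1) (Icc 0 t) := by fun_prop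
    exact h.U_cont.comp h2 (fun τ hτ => ⟨by simpa using hz, by simp; linarith [hτ.2]⟩)
  obtain ⟨τ, hτ, heq⟩ := exists_hasDerivAt_eq_slope _ _ ht hcont (fun τ hτ => hder τ ⟨hτ.1.le, hτ.2⟩)
  have := h.P_neg _ (hR τ ⟨hτ.1.le, hτ.2⟩)
  rw [heq, sub_zero, div_neg_iff] at this
  simp at this
  rcases this with h1 | h1 <;> linarith

lemma barrier_alg {m ε lam : ℝ} (hε : 0 ≤ ε) (hε2 : 3 * ε ^ 2 + 3 * (1 + |m|) * ε ≤ 1/6)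
    (h1 : -(1 + |m|) ≤ lam) (h2 : lam ≤ ε) : 3 * lam ^ 2 + 3 * (1 + |m|) * lam ≤ 1/6 := by
  have := abs_nonneg m
  rcases le_or_gt lam 0 with h | h
  · nlinarith
  · nlinarith

lemma grad_quad (z0 : ℂ) (m A s ρ : ℝ) (z : ℂ) :
    HasFDerivAt (fun z : ℂ => s * (3/4 - ((z.re - z0.re)^2 + (z.im - z0.im)^2) / ρ^2 + 3 * ((z.re - z0.re) - m * (z.im - z0.im))^2/ρ^2 + A * ((z.re - z0.re) - m * (z.im - z0.im))/ρ))
     ((s * (-2 * (z.re - z0.re)/ρ^2 + 6 * ((z.re - z0.re) - m * (z.im - z0.im))/ρ^2 + A/ρ)) • Complex.reCLM +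
      (s * (-2 * (z.im - z0.im)/ρ^2 - 6 * m * ((z.re - z0.re) - m * (z.im - z0.im))/ρ^2 - A*m/ρ)) • Complex.imCLM) z := by
  have hx : HasFDerivAt (fun z : ℂ => z.re - z0.re) Complex.reCLM z := Complex.reCLM.hasFDerivAt.sub_const _
  have hy : HasFDerivAt (fun z : ℂ => z.im - z0.im) Complex.imCLM z := Complex.imCLM.hasFDerivAt.sub_const _
  have hl : HasFDerivAt (fun z : ℂ => (z.re - z0.re) - m * (z.im - z0.im)) _ z := hx.fun_sub (hy.const_mul m)
  have H := (((((hx.pow 2).fun_add (hy.pow 2)).const_mul (-1/ρ^2)).fun_add ((hl.pow 2).const_mul (3/ρ^2))).fun_add (hl.const_mul (A/ρ))).const_add (3/4) |>.const_mul s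
  refine HasFDerivAt.congr_fderiv (H.congr_of_eventuallyEq (Eventually.of_forall fun z => ?_)) ?_
  · simp only; ring
  · apply ContinuousLinearMap.ext
    intro v
    simp
    ring

lemma barrier {k K : ℝ} {φ : ℝ → ℝ} {U P Q : ℂ → ℝ} (h : FB k K φ U P Q) {m ε ρ s y0 t : ℝ}
    (hε : 0 ≤ ε) (hε2 : 3 * ε ^ 2 + 3 * (1 + |m|) * ε ≤ 1/6) (hρ : 0 < ρ)
    (hρ2 : 2 * k * (11 + 9 * |m|) * ρ < 2 + 6 * m ^ 2) (hy0 : y0 + ρ < 0)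
    (hφ : ∀ y ∈ Icc (y0 - ρ) (y0 + ρ), |deriv φ y - m| ≤ ε) (hs : 0 < s)
    (hP : ∀ y ∈ Icc (y0 - ρ) (y0 + ρ), P (φ y + y * I) ≤ -2 * s)
    (ht : 0 < t) (ht2 : t ≤ ρ / (12 * (1 + |m|))) : s / 2 ≤ -P ((φ y0 - t : ℝ) + y0 * I) := by
  obtain ⟨η, hη, hev⟩ := ev_bdry h hy0 hs hP
  have hmp : 0 ≤ |m| := abs_nonneg m
  have hk := h.k_pos
  have hcφ := h.φa.continuousOn
  set z0 : ℂ := φ y0 + y0 * I with hz0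
  have z0r : z0.re = φ y0 := by simp [hz0]
  have z0i : z0.im = y0 := by simp [hz0]
  set A := 3 * (1 + |m|) with hA
  set w : ℂ → ℝ := fun z : ℂ => s * (3/4 - ((z.re - z0.re)^2 + (z.im - z0.im)^2) / ρ^2 + 3 * ((z.re - z0.re) - m * (z.im - z0.im))^2/ρ^2 + A * ((z.re - z0.re) - m * (z.im - z0.im))/ρ) with hw
  set w1 : ℂ → ℝ := fun z => (s * (-2 * (z.re - z0.re)/ρ^2 + 6 * ((z.re - z0.re) - m * (z.im - z0.im))/ρ^2 + A/ρ)) with hw1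
  set w2 : ℂ → ℝ := fun z => (s * (-2 * (z.im - z0.im)/ρ^2 - 6 * m * ((z.re - z0.re) - m * (z.im - z0.im))/ρ^2 - A*m/ρ)) with hw2
  have hwd : ∀ z, HasFDerivAt w (w1 z • Complex.reCLM + w2 z • Complex.imCLM) z := fun z => grad_quad z0 m A s ρ z
  have hxbd : ∀ z ∈ Metric.closedBall z0 ρ, |z.re - z0.re| ≤ ρ ∧ |z.im - z0.im| ≤ ρ := fun z hz => by
    rw [mem_closedBall_iff_norm] at hz
    exact ⟨(Complex.abs_re_le_norm (z - z0)).trans hz, (Complex.abs_im_le_norm (z - z0)).trans hz⟩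
  have hIcc : ∀ z ∈ Metric.closedBall z0 ρ, z.im ∈ Icc (y0 - ρ) (y0 + ρ) := fun z hz => by
    have := (hxbd z hz).2
    rw [z0i, abs_le] at this
    constructor <;> linarith [this.1, this.2]
  have hslope : ∀ y ∈ Icc (y0 - ρ) (y0 + ρ), φ y - φ y0 - m * (y - y0) ≤ ε * |y - y0| := by
    intro y hy
    have hd : ∀ x ∈ Icc (y0 - ρ) (y0 + ρ), HasDerivWithinAt (fun y => φ y - m * y) (deriv φ x - m * 1) (Icc (y0 - ρ) (y0 + ρ)) x := fun x hx => by
      have h1 : HasDerivAt φ (deriv φ x) x := (h.φa x (lt_of_le_of_lt hx.2 hy0)).differentiableAt.hasDerivAt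
      exact (h1.sub ((hasDerivAt_id x).const_mul m)).hasDerivWithinAt
    have := (convex_Icc (y0 - ρ) (y0 + ρ)).norm_image_sub_le_of_norm_hasDerivWithin_le (C := ε) hd (fun x hx => by simpa using hφ x hx)
      (show y0 ∈ _ from ⟨by linarith, by linarith⟩) hy
    have h2 := le_abs_self (φ y - m * y - (φ y0 - m * y0))
    simp only [Real.norm_eq_abs] at this
    linarith
  have hlam : ∀ z ∈ Metric.closedBall z0 ρ, z.re ≤ φ z.im →
      3 * ((z.re - z0.re) - m * (z.im - z0.im))^2/ρ^2 + A * ((z.re - z0.re) - m * (z.im - z0.im))/ρ ≤ 1/6 := by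
    intro z hz hzφ
    have h1 := hxbd z hz
    have h2 := hslope z.im (hIcc z hz)
    have h3 := barrier_alg (lam := ((z.re - z0.re) - m * (z.im - z0.im))/ρ) hε hε2 (by
      rw [le_div_iff₀ hρ]
      have : |m * (z.im - z0.im)| ≤ |m| * ρ := by rw [abs_mul]; gcongr; exact h1.2
      have a1 := (abs_le.mp this).2
      have a2 := (abs_le.mp h1.1).1
      linarith) (by
      rw [div_le_iff₀ hρ, z0r, z0i]
      have : ε * |z.im - y0| ≤ ε * ρ := by gcongr; rw [← z0i]; exact h1.2
      linarith)
    rw [div_pow] at h3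
    calc _ = _ := by rw [hA]; ring
      _ ≤ _ := h3
  have hAt : A * t / ρ ≤ 1/4 := by
    rw [div_le_iff₀ hρ]; rw [le_div_iff₀ (by positivity)] at ht2; rw [hA]; linarith
  have htρ : t ≤ ρ := ht2.trans (div_le_self hρ.le (by linarith))
  have key : ∀ δ, 0 < δ → δ < min η t → w ((φ y0 - t : ℝ) + y0 * I) ≤ (U ((φ y0 - t : ℝ) + y0 * I) - U ((φ y0 - t : ℝ) + y0 * I + δ)) / δ := by
    intro δ hδ hδη
    have hδ1 := hδη.trans_le (min_le_left _ _)
    have hδ2 := hδη.trans_le (min_le_right _ _)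
    set S : Set ℂ := Metric.closedBall z0 ρ ∩ {z | z.re ≤ φ z.im - δ} with hS
    have hφim : ContinuousOn (fun z : ℂ => φ z.im - δ - z.re) (Metric.closedBall z0 ρ) :=
      ((hcφ.comp Complex.continuous_im.continuousOn (fun z hz => lt_of_le_of_lt (hIcc z hz).2 hy0)).sub continuousOn_const).sub Complex.continuous_re.continuousOn
    have hSc : IsCompact S := by
      have h1 := hφim.preimage_isClosed_of_isClosed Metric.isClosed_closedBall (isClosed_Ici (a := 0))
      have : S = Metric.closedBall z0 ρ ∩ (fun z : ℂ => φ z.im - δ - z.re) ⁻¹' Ici 0 := by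
        ext z; simp [hS]
      rw [this]
      exact (isCompact_closedBall z0 ρ).of_isClosed_subset h1 inter_subset_left
    have him : ∀ z ∈ S, z.im < 0 := fun z hz => lt_of_le_of_lt (hIcc z hz.1).2 hy0
    have hm1 : MapsTo (fun z : ℂ => z) S (Rgc φ) := fun z hz => ⟨him z hz, by have : z.re ≤ φ z.im - δ := hz.2; linarith⟩
    have hm2 : MapsTo (fun z : ℂ => z + δ) S (Rgc φ) := fun z hz => ⟨by simpa using him z hz, by have : z.re ≤ φ z.im - δ := hz.2; simp; linarith⟩
    have hgc : ContinuousOn (fun z => (1/δ) * (U z - U (z + δ)) - w z) S := by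
      refine ContinuousOn.sub (continuousOn_const.mul ((h.U_cont.comp continuousOn_id hm1).sub (h.U_cont.comp (by fun_prop) hm2))) ?_
      exact fun z _ => (hwd z).continuousAt.continuousWithinAt
    have hmain := minp (k := k) hSc hgc ?_ ((φ y0 - t : ℝ) + y0 * I) ⟨?_, ?_⟩
    · rw [div_eq_inv_mul, ← one_div]; linarith
    · intro p hp
      have hp2 : p.re ≤ φ p.im - δ := hp.2
      rcases hp2.lt_or_eq with hlt | heq
      swap
      · left
        have h1 := hev δ hδ hδ1 p.im (hIcc p hp.1)
        have h2 : ((φ p.im - δ : ℝ) + p.im * I : ℂ) = p := by rw [← heq]; exact Complex.re_add_im p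
        rw [h2] at h1
        have h3 : p + δ = φ p.im + p.im * I := by
          rw [← h2]; push_cast; simp; ring
        rw [h3, h.U_zero _ (him p hp), sub_zero]
        have h4 : s ≤ 1 / δ * U p := by rw [one_div, inv_mul_eq_div, le_div_iff₀ hδ]; exact h1
        have h5 := hlam p hp.1 (by linarith)
        have h6 : w p ≤ s * 1 := by
          simp only [hw]
          apply mul_le_mul_of_nonneg_left _ hs.le
          have : 0 ≤ ((p.re - z0.re)^2 + (p.im - z0.im)^2) / ρ^2 := by positivity
          linarith
        linarith
      have hpb := hp.1
      rw [mem_closedBall_iff_norm] at hpb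
      rcases hpb.lt_or_eq with hlt2 | heq2
      swap
      · left
        have h1 := h.anti hδ (him p hp) hp2
        have h5 := hlam p hp.1 (by linarith)
        have h6 : w p ≤ s * 0 := by
          simp only [hw]
          apply mul_le_mul_of_nonneg_left _ hs.le
          have : (p.re - z0.re)^2 + (p.im - z0.im)^2 = ρ^2 := by
            rw [← heq2, Complex.sq_norm, Complex.normSq_apply]; simp; ring
          rw [this, div_self (by positivity)]
          linarith
        have : 0 ≤ 1 / δ * (U p - U (p + δ)) := mul_nonneg (by positivity) (by linarith)
        linarith
      right
      have hpR : p ∈ Rg φ := ⟨him p hp, by linarith⟩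
      have hpR2 : p + δ ∈ Rg φ := ⟨by simpa using him p hp, by simp; linarith⟩
      have hn1 : ∀ᶠ z in 𝓝 p, z ∈ Rg φ := h.open.mem_nhds hpR
      have hct : ContinuousAt (fun z : ℂ => z + δ) p := by fun_prop
      have hn2 : ∀ᶠ z : ℂ in 𝓝 p, z + δ ∈ Rg φ := hct.eventually (h.open.mem_nhds hpR2)
      have hPd : ∀ z ∈ Rg φ, HasFDerivAt P (fderiv ℝ P z) z := fun z hz =>
        ((h.P_c1.contDiffAt (h.open.mem_nhds hz)).differentiableAt one_ne_zero).hasFDerivAt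
      have hQd : ∀ z ∈ Rg φ, HasFDerivAt Q (fderiv ℝ Q z) z := fun z hz =>
        ((h.Q_c1.contDiffAt (h.open.mem_nhds hz)).differentiableAt one_ne_zero).hasFDerivAt
      have hsh : ∀ z : ℂ, HasFDerivAt (fun z : ℂ => z + δ) (ContinuousLinearMap.id ℝ ℂ) z := fun z => (hasFDerivAt_id z).add_const _
      have hline : ∀ v : ℂ, HasDerivAt (fun t : ℝ => p + t * v) v 0 := fun v => by
        have := ((Complex.ofRealCLM.hasDerivAt (x := (0:ℝ))).mul_const v).const_add p
        simpa using this
      refine ⟨?_, fun z => (1/δ) * (P z - P (z + δ)) - w1 z, fun z => (1/δ) * (Q z - Q (z + δ)) - w2 z,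
        (1/δ) * (fderiv ℝ P p 1 - fderiv ℝ P (p + δ) 1) - s * (4 / ρ^2), (1/δ) * (fderiv ℝ Q p I - fderiv ℝ Q (p + δ) I) - s * ((-2 + 6 * m^2) / ρ^2), ?_, ?_, ?_, ?_⟩
      · filter_upwards [hn2, Metric.ball_mem_nhds p (show 0 < ρ - ‖p - z0‖ by linarith)] with z h1 h2
        refine ⟨?_, ?_⟩
        · rw [mem_closedBall_iff_norm]
          rw [mem_ball_iff_norm] at h2
          calc ‖z - z0‖ ≤ ‖z - p‖ + ‖p - z0‖ := norm_sub_le_norm_sub_add_norm_sub _ _ _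
            _ ≤ _ := by linarith
        · have := h1.2
          simp at this
          show z.re ≤ φ z.im - δ
          linarith
      · filter_upwards [hn1, hn2] with z h1 h2
        have a1 := h.U_der z h1
        have a2 : HasFDerivAt (fun z => U (z + δ)) _ z := (h.U_der _ h2).comp z (hsh z)
        refine HasFDerivAt.congr_fderiv (((a1.fun_sub a2).const_mul (1/δ)).fun_sub (hwd z)) ?_
        apply ContinuousLinearMap.ext
        intro v
        simp
        ring
      · have a1 : HasFDerivAt (fun z => P (z + δ)) _ p := (hPd _ hpR2).comp p (hsh p)
        have a2 := ((hPd p hpR).fun_sub a1).const_mul (1/δ)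
        rw [show p = p + (0:ℝ) * 1 by simp] at a2
        have a3 := HasFDerivAt.comp_hasDerivAt (f := fun t : ℝ => p + t * 1) 0 a2 (hline 1)
        have a4 : HasDerivAt (fun t : ℝ => w1 (p + t * 1)) (s * (4/ρ^2)) 0 := by
          have b1 := (((hasDerivAt_id (0:ℝ)).const_mul (s * (4/ρ^2))).const_add (w1 p))
          simp only [mul_one] at b1
          refine b1.congr_of_eventuallyEq (Eventually.of_forall fun t => ?_)
          simp [hw1]; ring
        refine (a3.sub a4).congr_deriv ?_
        simp
      · have a1 : HasFDerivAt (fun z => Q (z + δ)) _ p := (hQd _ hpR2).comp p (hsh p)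
        have a2 := ((hQd p hpR).fun_sub a1).const_mul (1/δ)
        rw [show p = p + (0:ℝ) * I by simp] at a2
        have a3 := HasFDerivAt.comp_hasDerivAt (f := fun t : ℝ => p + t * I) 0 a2 (hline I)
        have a4 : HasDerivAt (fun t : ℝ => w2 (p + t * I)) (s * ((-2 + 6 * m^2)/ρ^2)) 0 := by
          have b1 := (((hasDerivAt_id (0:ℝ)).const_mul (s * ((-2 + 6 * m^2)/ρ^2))).const_add (w2 p))
          simp only [mul_one] at b1
          refine b1.congr_of_eventuallyEq (Eventually.of_forall fun t => ?_)
          simp [hw2]; ring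
        refine (a3.sub a4).congr_deriv ?_
        simp
      · have c1 := h.pde p hpR
        have c2 := h.pde _ hpR2
        have c3 : 2 * k * w1 p < s * ((2 + 6 * m^2) / ρ^2) := by
          have d1 := hxbd p hp.1
          have d2 : w1 p ≤ s * ((11 + 9 * |m|) / ρ) := by
            simp only [hw1]
            apply mul_le_mul_of_nonneg_left _ hs.le
            have : |m * (p.im - z0.im)| ≤ |m| * ρ := by rw [abs_mul]; gcongr; exact d1.2
            have e1 := (abs_le.mp this).1
            obtain ⟨e2, e3⟩ := abs_le.mp d1.1
            have : (11 + 9 * |m|) / ρ = (2 * ρ + 6 * (ρ + |m| * ρ))/ρ^2 + A / ρ := by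
              rw [hA]; field_simp; ring
            rw [this, ← add_div]
            have e4 : -2 * (p.re - z0.re) + 6 * ((p.re - z0.re) - m * (p.im - z0.im)) ≤ 2 * ρ + 6 * (ρ + |m| * ρ) := by linarith
            have e5 := div_le_div_of_nonneg_right e4 (sq_nonneg ρ)
            linarith
          calc 2 * k * w1 p ≤ 2 * k * (s * ((11 + 9 * |m|) / ρ)) := by gcongr
            _ = s * ((2 * k * (11 + 9 * |m|) * ρ) / ρ^2) := by field_simp
            _ < _ := by gcongr
        have c4 : s * ((2 + 6 * m^2) / ρ^2) = s * (4 / ρ^2) + s * ((-2 + 6 * m^2) / ρ^2) := by ring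
        have c5 : (1/δ) * (fderiv ℝ P p 1 - fderiv ℝ P (p + δ) 1) + (1/δ) * (fderiv ℝ Q p I - fderiv ℝ Q (p + δ) I) = 2 * k * ((1/δ) * (P p - P (p + δ))) := by
          linear_combination (1/δ) * c1 - (1/δ) * c2
        linarith
    · rw [mem_closedBall_iff_norm, hz0]
      have : ((φ y0 - t : ℝ) + y0 * I : ℂ) - (φ y0 + y0 * I) = ((-t : ℝ) : ℂ) := by push_cast; ring
      rw [this, Complex.norm_real, Real.norm_eq_abs, abs_neg, abs_of_pos ht]; exact htρ
    · show ((φ y0 - t : ℝ) + y0 * I : ℂ).re ≤ φ ((φ y0 - t : ℝ) + y0 * I : ℂ).im - δ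
      simp; linarith
  set z : ℂ := (φ y0 - t : ℝ) + y0 * I with hz
  have hzr : z.re = φ y0 - t := by simp [hz]
  have hzi : z.im = y0 := by simp [hz]
  have hzR : z ∈ Rg φ := ⟨by rw [hzi]; linarith, by rw [hzi, hzr]; linarith⟩
  have hwz : s / 2 ≤ w z := by
    simp only [hw, hzr, hzi, z0r, z0i]
    have h1 : t ^ 2 / ρ ^ 2 * 2 ≥ 0 := by positivity
    have : s * (1/2) ≤ s * (3/4 - ((φ y0 - t - φ y0)^2 + (y0 - y0)^2) / ρ^2 + 3 * ((φ y0 - t - φ y0) - m * (y0 - y0))^2/ρ^2 + A * ((φ y0 - t - φ y0) - m * (y0 - y0))/ρ) := by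
      apply mul_le_mul_of_nonneg_left _ hs.le
      have : 3/4 - ((φ y0 - t - φ y0)^2 + (y0 - y0)^2) / ρ^2 + 3 * ((φ y0 - t - φ y0) - m * (y0 - y0))^2/ρ^2 + A * ((φ y0 - t - φ y0) - m * (y0 - y0))/ρ = 3/4 + t^2/ρ^2 * 2 - A * t/ρ := by ring
      rw [this]; linarith
    linarith
  have hder : HasDerivAt (fun τ : ℝ => U (z + τ * 1)) (P z) 0 := by
    have := line_deriv (v := 1) (p := z) 0 (g1 := P) (g2 := Q) (g := U) (by simpa using h.U_der z hzR)
    simpa using this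
  have hlim := hder.tendsto_slope_zero_right
  have hle : P z ≤ -(w z) := by
    apply le_of_tendsto hlim
    have : Ioo 0 (min η t) ∈ 𝓝[>] (0:ℝ) := Ioo_mem_nhdsGT (lt_min hη ht)
    filter_upwards [this] with δ hδ
    have := key δ hδ.1 hδ.2
    simp only [zero_add, mul_one, Complex.ofReal_zero, add_zero, smul_eq_mul]
    rw [div_eq_inv_mul] at this
    linarith
  linarith
end ModB2b

section ModB3
open MeasureTheory
open Complex (I)

section B3
variable {k K m : ℝ} {φ : ℝ → ℝ} {U P Q : ℂ → ℝ}

lemma strip_lower (h : FB k K φ U P Q) (hm : Tendsto (deriv φ) atBot (𝓝 m)) :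
    ∃ c0 > 0, ∃ l > 0, ∃ Y < 0, ∀ z : ℂ, z.im < Y → φ z.im - l ≤ z.re → z.re < φ z.im → c0 ≤ -P z := by
  have hmp := abs_nonneg m
  have hk := h.k_pos
  obtain ⟨ε, hε, hε1, hε2⟩ : ∃ ε : ℝ, 0 < ε ∧ ε ≤ 1 ∧ 3 * ε ^ 2 + 3 * (1 + |m|) * ε ≤ 1/6 := by
    refine ⟨1 / (36 * (1 + |m|)), by positivity, ?_, ?_⟩
    · rw [div_le_one (by positivity)]; linarith
    · have : 3 * (1 + |m|) * (1 / (36 * (1 + |m|))) = 1/12 := by field_simp; norm_num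
      have h2 : 1 / (36 * (1 + |m|)) ≤ 1/36 := by
        apply one_div_le_one_div_of_le (by norm_num); linarith
      have h3 : (1 / (36 * (1 + |m|)))^2 ≤ (1/36)^2 := by gcongr
      rw [this]; linarith
  set ρ := 1 / (2 * k * (11 + 9 * |m|)) with hρ
  have hρp : 0 < ρ := by positivity
  set s := 1 / (2 * √(1 + (|m| + 1)^2)) with hs
  have hsp : 0 < s := by positivity
  have hev : ∀ᶠ y in atBot, |deriv φ y - m| ≤ ε := by
    filter_upwards [hm.eventually (Metric.closedBall_mem_nhds m hε)] with y hy using hy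
  obtain ⟨Y0, hY0⟩ := eventually_atBot.mp hev
  refine ⟨s/2, by positivity, ρ / (12 * (1 + |m|)), by positivity, min (Y0 - ρ) (-ρ - 1), ?_, ?_⟩
  · exact (min_le_right _ _).trans_lt (by linarith)
  intro z hz hz1 hz2
  have a1 := hz.trans_le (min_le_left _ _)
  have a2 := hz.trans_le (min_le_right _ _)
  have := barrier h (m := m) (ε := ε) (ρ := ρ) (s := s) (y0 := z.im) (t := φ z.im - z.re) hε.le hε2 hρp ?_ (by linarith)
    (fun y hy => hY0 y (by linarith [hy.2])) hsp ?_ (by linarith) (by linarith)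
  · simpa using this
  · rw [hρ, mul_one_div_cancel (by positivity)]; nlinarith [sq_nonneg m]
  · intro y hy
    rw [h.P_bdry y (by linarith [hy.2])]
    have b1 := hY0 y (by linarith [hy.2])
    have b2 : |deriv φ y| ≤ |m| + 1 := by
      have := abs_sub_abs_le_abs_sub (deriv φ y) m
      linarith
    have b3 : √(1 + deriv φ y ^ 2) ≤ √(1 + (|m| + 1)^2) := by
      apply Real.sqrt_le_sqrt
      have : deriv φ y ^ 2 ≤ (|m| + 1)^2 := by rw [← sq_abs]; gcongr
      linarith
    have b4 : 0 < √(1 + deriv φ y ^ 2) := Real.sqrt_pos.mpr (by positivity)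
    have b5 : 1 / √(1 + (|m| + 1)^2) ≤ 1 / √(1 + deriv φ y ^ 2) := one_div_le_one_div_of_le b4 b3
    have b6 : -2 * s = -(1 / √(1 + (|m| + 1)^2)) := by rw [hs]; field_simp
    rw [b6, neg_div]; linarith

lemma FB.φd (h : FB k K φ U P Q) {y : ℝ} (hy : y < 0) : HasDerivAt φ (deriv φ y) y :=
  (h.φa y hy).differentiableAt.hasDerivAt
lemma FB.φdd (h : FB k K φ U P Q) {y : ℝ} (hy : y < 0) : HasDerivAt (deriv φ) (deriv (deriv φ) y) y :=
  ((h.φa y hy).deriv).differentiableAt.hasDerivAt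
lemma FB.Pd (h : FB k K φ U P Q) {z : ℂ} (hz : z ∈ Rg φ) : HasFDerivAt P (fderiv ℝ P z) z :=
  ((h.P_c1.contDiffAt (h.open.mem_nhds hz)).differentiableAt one_ne_zero).hasFDerivAt
lemma FB.Qd (h : FB k K φ U P Q) {z : ℂ} (hz : z ∈ Rg φ) : HasFDerivAt Q (fderiv ℝ Q z) z :=
  ((h.Q_c1.contDiffAt (h.open.mem_nhds hz)).differentiableAt one_ne_zero).hasFDerivAt

lemma clm_real (L : ℂ →L[ℝ] ℝ) (v : ℂ) : L v = v.re * L 1 + v.im * L I := by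
  conv_lhs => rw [show v = v.re • (1:ℂ) + v.im • I by simp [Complex.re_add_im]]
  rw [map_add, map_smul, map_smul, smul_eq_mul, smul_eq_mul]

lemma exists_psi (h : FB k K φ U P Q) : ∃ ψ : ℂ → ℝ, ∀ z ∈ Rg φ,
    HasFDerivAt ψ (Q z • Complex.reCLM + (2 * k * U z - P z) • Complex.imCLM) z := by
  set S : Set ℂ := {w | w.re < 0 ∧ w.im < 0} with hS
  have hSo : IsOpen S := (isOpen_lt Complex.continuous_re continuous_const).inter (isOpen_lt Complex.continuous_im continuous_const)
  have hSc : Convex ℝ S := (convex_halfSpace_re_lt 0).inter (convex_halfSpace_im_lt 0)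
  let e : ℂ → ℂ := fun w => w + φ w.im
  have heR : ∀ w ∈ S, e w ∈ Rg φ := fun w hw => ⟨by simpa [e] using hw.2, by simpa [e] using hw.1⟩
  have hφim : ∀ w : ℂ, w.im < 0 → HasFDerivAt (fun w : ℂ => φ w.im) (deriv φ w.im • Complex.imCLM) w := fun w hw =>
    (h.φd hw).comp_hasFDerivAt w Complex.imCLM.hasFDerivAt
  have hφim2 : ∀ w : ℂ, w.im < 0 → HasFDerivAt (fun w : ℂ => deriv φ w.im) (deriv (deriv φ) w.im • Complex.imCLM) w := fun w hw =>
    (h.φdd hw).comp_hasFDerivAt w Complex.imCLM.hasFDerivAt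
  have hed : ∀ w ∈ S, HasFDerivAt e (ContinuousLinearMap.id ℝ ℂ + Complex.ofRealCLM.comp (deriv φ w.im • Complex.imCLM)) w := fun w hw =>
    (hasFDerivAt_id w).add (Complex.ofRealCLM.hasFDerivAt.comp w (hφim w hw.2))
  let η : ℂ → ℂ →L[ℝ] ℝ := fun w => Q (e w) • Complex.reCLM + (Q (e w) * deriv φ w.im + (2 * k * U (e w) - P (e w))) • Complex.imCLM
  have hηd : ∀ w ∈ S, ∃ L : ℂ →L[ℝ] ℂ →L[ℝ] ℝ, HasFDerivAt η L w ∧ ∀ x y, L x y = L y x := by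
    intro w hw
    have dQ := (h.Qd (heR w hw)).comp w (hed w hw)
    have dP := (h.Pd (heR w hw)).comp w (hed w hw)
    have dU := (h.U_der _ (heR w hw)).comp w (hed w hw)
    have d2 := hφim2 w hw.2
    have H := (dQ.smul_const Complex.reCLM).add (((dQ.mul d2).add ((dU.const_mul (2 * k)).sub dP)).smul_const Complex.imCLM)
    refine ⟨_, H, fun x y => ?_⟩
    have s1 := h.sym _ (heR w hw)
    have s2 := h.pde _ (heR w hw)
    simp only [Function.comp, ContinuousLinearMap.add_apply, ContinuousLinearMap.smulRight_apply, ContinuousLinearMap.smul_apply, ContinuousLinearMap.coe_comp,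
      ContinuousLinearMap.sub_apply, smul_eq_mul, Complex.reCLM_apply, Complex.imCLM_apply, ContinuousLinearMap.id_apply, Complex.ofRealCLM_apply]
    rw [clm_real (fderiv ℝ Q (e w)) (x + _), clm_real (fderiv ℝ Q (e w)) (y + _), clm_real (fderiv ℝ P (e w)) (x + _), clm_real (fderiv ℝ P (e w)) (y + _)]
    simp only [Complex.add_re, Complex.add_im, Complex.ofReal_re, Complex.ofReal_im]
    linear_combination (x.im * y.re - y.im * x.re) * s2
  obtain ⟨f, hf⟩ := hSc.exists_forall_hasFDerivAt_of_fderiv_symmetric hSo (ω := η)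
    (fun w hw => by obtain ⟨L, hL, _⟩ := hηd w hw; exact hL.differentiableAt.differentiableWithinAt)
    (fun w hw x y => by obtain ⟨L, hL, hs⟩ := hηd w hw; rw [hL.fderiv]; exact hs x y)
  refine ⟨fun z => f (z - φ z.im), fun z hz => ?_⟩
  have hzS : z - φ z.im ∈ S := ⟨by simpa using hz.2, by simpa using hz.1⟩
  have d1 : HasFDerivAt (fun z : ℂ => z - φ z.im) (ContinuousLinearMap.id ℝ ℂ - Complex.ofRealCLM.comp (deriv φ z.im • Complex.imCLM)) z :=
    (hasFDerivAt_id z).sub (Complex.ofRealCLM.hasFDerivAt.comp z (hφim z hz.1))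
  refine ((hf _ hzS).comp z d1).congr_fderiv ?_
  apply ContinuousLinearMap.ext
  intro v
  have e1 : e (z - φ z.im) = z := by simp [e]
  simp [η, e1]
  ring

lemma exists_s (h : FB k K φ U P Q) {ψ : ℂ → ℝ} (hψ : ∀ z ∈ Rg φ,
    HasFDerivAt ψ (Q z • Complex.reCLM + (2 * k * U z - P z) • Complex.imCLM) z) :
    ∃ s : ℝ → ℝ, (∀ z ∈ Rg φ, |ψ z - s z.im| ≤ K * (φ z.im - z.re)) ∧
      ∀ y < 0, HasDerivAt s (√(1 + deriv φ y ^ 2)) y := by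
  let e : ℝ × ℝ → ℂ := fun q => (φ q.2 - q.1 : ℝ) + q.2 * I
  have he : ∀ q : ℝ × ℝ, (e q).im = q.2 ∧ (e q).re = φ q.2 - q.1 := fun q => by simp [e]
  have heR : ∀ t > 0, ∀ y < 0, e (t, y) ∈ Rg φ := fun t ht y hy =>
    ⟨by rw [(he _).1]; exact hy, by rw [(he _).1, (he _).2]; simp; exact ht⟩
  have hlip : ∀ y : ℝ, ∃ a : ℝ, y < 0 → ∀ t > 0, |ψ (e (t, y)) - a| ≤ K * t := by
    intro y
    by_cases hy : y < 0
    swap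
    · exact ⟨0, fun h => absurd h hy⟩
    have h1 : LipschitzOnWith K.toNNReal (fun t => ψ (e (t, y))) (Ioi 0) := by
      apply (convex_Ioi 0).lipschitzOnWith_of_nnnorm_hasDerivWithin_le (f' := fun t => -Q (e (t, y)))
      · intro t ht
        have h1 : HasDerivAt (fun τ => e (τ, y)) (-1) t := by
          have := (HasDerivAt.ofReal_comp ((hasDerivAt_id t).const_sub (φ y))).add_const (y * I)
          simpa [e] using this
        refine ((HasFDerivAt.comp_hasDerivAt t (hψ _ (heR t ht y hy)) h1).congr_deriv ?_).hasDerivWithinAt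
        change Q (e (t, y)) * (-1 : ℂ).re + (2 * k * U (e (t, y)) - P (e (t, y))) * (-1 : ℂ).im = _
        simp
      · intro t ht
        rw [← NNReal.coe_le_coe, coe_nnnorm, Real.coe_toNNReal _ h.K_pos.le, norm_neg]
        exact h.Q_bd _ (heR t ht y hy)
    obtain ⟨g, hg, hge⟩ := h1.extend_real
    refine ⟨g 0, fun _ t ht => ?_⟩
    have h2 := hge (show t ∈ Ioi 0 from ht)
    simp only at h2
    rw [h2]
    have := hg.dist_le_mul t 0
    rw [Real.dist_eq, Real.dist_eq, Real.coe_toNNReal _ h.K_pos.le, sub_zero, abs_of_pos ht] at this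
    exact this
  choose s hs using hlip
  refine ⟨s, ?_, ?_⟩
  · intro z hz
    have := hs z.im hz.1 (φ z.im - z.re) (by linarith [hz.2])
    have e1 : e (φ z.im - z.re, z.im) = z := by simp [e, Complex.re_add_im]
    rwa [e1] at this
  let E : ℝ × ℝ → ℝ := fun q => Q (e q) * deriv φ q.2 + (2 * k * U (e q) - P (e q))
  set S : Set (ℝ × ℝ) := Ici 0 ×ˢ Iio 0 with hS
  have hec : ContinuousOn e S := by
    have h1 : ContinuousOn (fun q : ℝ × ℝ => φ q.2 - q.1) S :=
      (h.φa.continuousOn.comp continuousOn_snd (fun q hq => hq.2)).sub continuousOn_fst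
    exact (Complex.continuous_ofReal.comp_continuousOn h1).add
      ((Complex.continuous_ofReal.comp_continuousOn continuousOn_snd).mul continuousOn_const)
  have hem : MapsTo e S (Rgc φ) := fun q hq => by
    have := hq.1
    have h2 := hq.2
    simp only [mem_Ici, mem_Iio] at this h2
    refine ⟨by rw [(he q).1]; exact h2, by rw [(he q).1, (he q).2]; linarith⟩
  have hdφ : ContinuousOn (deriv φ) (Iio 0) := fun y hy => (h.φdd hy).continuousAt.continuousWithinAt
  have hE : ContinuousOn E S :=
    ((h.Q_cont.comp hec hem).mul (hdφ.comp continuousOn_snd (fun q hq => hq.2))).add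
      ((continuousOn_const.mul (h.U_cont.comp hec hem)).sub (h.P_cont.comp hec hem))
  have hE0 : ∀ y < 0, E (0, y) = √(1 + deriv φ y ^ 2) := by
    intro y hy
    have e0 : e (0, y) = φ y + y * I := by simp [e]
    simp only [E, e0, h.U_zero y hy, h.P_bdry y hy, h.Q_bdry y hy]
    have : 0 < √(1 + deriv φ y ^ 2) := Real.sqrt_pos.mpr (by positivity)
    field_simp
    rw [Real.sq_sqrt (by positivity)]; ring
  intro y hy
  rw [← hE0 y hy]
  refine hasDerivAt_of_tendstoLocallyUniformlyOn (l := 𝓝[>] (0:ℝ)) (f := fun t y => ψ (e (t, y))) (f' := fun t y => E (t, y)) (g' := fun y => E (0, y))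
    (s := Iio 0) isOpen_Iio ?_ ?_ ?_ hy
  · rw [Metric.tendstoLocallyUniformlyOn_iff]
    intro ε hε x hx
    have h1 := (hE (0, x) ⟨by simp, hx⟩).eventually (Metric.ball_mem_nhds _ (half_pos hε))
    rw [hS, nhdsWithin_prod_eq, Filter.eventually_iff, Metric.nhdsWithin_basis_ball.prod Metric.nhdsWithin_basis_ball |>.mem_iff] at h1
    obtain ⟨⟨a, b⟩, ⟨ha, hb⟩, hab⟩ := h1
    simp only at ha hb hab
    have hab' : ∀ t y : ℝ, 0 ≤ t → t < a → |y - x| < b → y < 0 → dist (E (t, y)) (E (0, x)) < ε / 2 := by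
      intro t y ht0 hta hyb hy0
      exact hab (show ((t, y) : ℝ × ℝ) ∈ _ from ⟨⟨by simpa [abs_of_nonneg ht0] using hta, ht0⟩, ⟨by simpa [Real.dist_eq] using hyb, hy0⟩⟩)
    refine ⟨Metric.ball x b ∩ Iio 0, inter_mem (mem_nhdsWithin_of_mem_nhds (Metric.ball_mem_nhds x hb)) self_mem_nhdsWithin, ?_⟩
    filter_upwards [Ioo_mem_nhdsGT ha] with t ht y hy
    have hyb : |y - x| < b := by simpa [Real.dist_eq] using hy.1
    have c1 := hab' t y ht.1.le ht.2 hyb hy.2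
    have c2 := hab' 0 y le_rfl ha hyb hy.2
    rw [dist_comm] at c1
    calc dist (E (0, y)) (E (t, y)) ≤ dist (E (0, y)) (E (0, x)) + dist (E (0, x)) (E (t, y)) := dist_triangle _ _ _
      _ < ε := by linarith
  · filter_upwards [self_mem_nhdsWithin] with t ht y hy
    have h3 : HasDerivAt (fun y => e (t, y)) ((deriv φ y : ℝ) + 1 * I) y := by
      refine HasDerivAt.add (HasDerivAt.ofReal_comp (f := fun y => φ y - t) ((h.φd hy).sub_const t)) ?_
      exact (HasDerivAt.ofReal_comp (hasDerivAt_id y)).mul_const I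
    refine (HasFDerivAt.comp_hasDerivAt y (hψ _ (heR t ht y hy)) h3).congr_deriv ?_
    change Q (e (t,y)) * ((deriv φ y : ℝ) + 1 * I : ℂ).re + (2 * k * U (e (t, y)) - P (e (t, y))) * ((deriv φ y : ℝ) + 1 * I : ℂ).im = _
    simp [E]
  · intro x hx
    rw [tendsto_iff_norm_sub_tendsto_zero]
    apply squeeze_zero' (g := fun t => K * t) (Eventually.of_forall fun _ => norm_nonneg _)
    · filter_upwards [self_mem_nhdsWithin] with t ht using hs x hx t ht
    · have : Continuous (fun t : ℝ => K * t) := by fun_prop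
      have := this.tendsto 0
      rw [mul_zero] at this
      exact this.mono_left nhdsWithin_le_nhds
end B3
end ModB3

section ModB4
open MeasureTheory
open Complex (I)

structure Strip (k K m ε c0 l Y : ℝ) (φ : ℝ → ℝ) (U P Q ψ : ℂ → ℝ) (s : ℝ → ℝ) : Prop where
  fb : FB k K φ U P Q
  psi : ∀ z ∈ Rg φ, HasFDerivAt ψ (Q z • Complex.reCLM + (2 * k * U z - P z) • Complex.imCLM) z
  s_bd : ∀ z ∈ Rg φ, |ψ z - s z.im| ≤ K * (φ z.im - z.re)
  s_der : ∀ y < 0, HasDerivAt s (√(1 + deriv φ y ^ 2)) y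
  low : ∀ z : ℂ, z.im < Y → φ z.im - l ≤ z.re → z.re < φ z.im → c0 ≤ -P z
  slope : ∀ y < Y, |deriv φ y - m| ≤ ε
  c0_pos : 0 < c0
  l_pos : 0 < l
  Y_neg : Y < 0
  ε_pos : 0 ≤ ε
  ε_one : ε ≤ 1
  ε_sm : 2 * ε * K ^ 2 < c0

section B4
variable {k K m ε c0 l Y : ℝ} {φ : ℝ → ℝ} {U P Q ψ : ℂ → ℝ} {s : ℝ → ℝ}

lemma exists_strip (h : FB k K φ U P Q) (hm : Tendsto (deriv φ) atBot (𝓝 m)) :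
    ∃ ε c0 l Y ψ s, Strip k K m ε c0 l Y φ U P Q ψ s := by
  obtain ⟨ψ, hψ⟩ := exists_psi h
  obtain ⟨s, hs1, hs2⟩ := exists_s h hψ
  obtain ⟨c0, hc0, l, hl, Y, hY, hlow⟩ := strip_lower h hm
  have hK := h.K_pos
  set ε := min 1 (c0 / (4 * K ^ 2)) with hε
  have hεp : 0 < ε := lt_min one_pos (by positivity)
  have hev : ∀ᶠ y in atBot, |deriv φ y - m| ≤ ε := by
    filter_upwards [hm.eventually (Metric.closedBall_mem_nhds m hεp)] with y hy using hy
  obtain ⟨Y0, hY0⟩ := eventually_atBot.mp hev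
  refine ⟨ε, c0, l, min Y Y0, ψ, s, ⟨h, hψ, hs1, hs2, fun z hz => hlow z (hz.trans_le (min_le_left _ _)), fun y hy => hY0 y (hy.le.trans (min_le_right _ _)),
    hc0, hl, (min_le_left _ _).trans_lt hY, hεp.le, min_le_left _ _, ?_⟩⟩
  have : ε ≤ c0 / (4 * K ^ 2) := min_le_right _ _
  rw [le_div_iff₀ (by positivity)] at this
  linarith

lemma FB.U_mvt (h : FB k K φ U P Q) {z : ℂ} (hz : z ∈ Rg φ) : ∃ τ, 0 < τ ∧ τ < φ z.im - z.re ∧ U z = -P (z + τ) * (φ z.im - z.re) := by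
  set t := φ z.im - z.re with ht
  have htp : 0 < t := by linarith [hz.2]
  have hR : ∀ τ ∈ Ioo 0 t, z + τ * 1 ∈ Rg φ := fun τ hτ => ⟨by simpa using hz.1, by simp; linarith [hτ.2]⟩
  have hder : ∀ τ ∈ Ioo 0 t, HasDerivAt (fun τ : ℝ => U (z + τ * 1)) (P (z + τ * 1)) τ := fun τ hτ => by
    simpa using line_deriv τ (h.U_der _ (hR τ hτ))
  have hcont : ContinuousOn (fun τ : ℝ => U (z + τ * 1)) (Icc 0 t) := by
    have h2 : ContinuousOn (fun τ : ℝ => z + τ * 1) (Icc 0 t) := by fun_prop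
    exact h.U_cont.comp h2 (fun τ hτ => ⟨by simpa using hz.1, by simp; linarith [hτ.2]⟩)
  obtain ⟨τ, hτ, heq⟩ := exists_hasDerivAt_eq_slope _ _ htp hcont hder
  refine ⟨τ, hτ.1, hτ.2, ?_⟩
  have h3 : z + t * 1 = φ z.im + z.im * I := by
    apply Complex.ext <;> simp [ht]
  rw [h3, h.U_zero _ hz.1, eq_div_iff (by linarith)] at heq
  simp at heq
  linarith

lemma FB.U_le (h : FB k K φ U P Q) {z : ℂ} (hz : z ∈ Rg φ) : U z ≤ K * (φ z.im - z.re) := by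
  obtain ⟨τ, h1, h2, h3⟩ := h.U_mvt hz
  rw [h3]
  apply mul_le_mul_of_nonneg_right _ (by linarith [hz.2])
  exact (neg_le_abs _).trans (h.P_bd _ ⟨by simpa using hz.1, by simp; linarith⟩)

lemma Strip.U_ge (h : Strip k K m ε c0 l Y φ U P Q ψ s) {z : ℂ} (hz : z.im < Y) (hz1 : φ z.im - l ≤ z.re) (hz2 : z.re < φ z.im) :
    c0 * (φ z.im - z.re) ≤ U z := by
  obtain ⟨τ, h1, h2, h3⟩ := h.fb.U_mvt ⟨hz.trans h.Y_neg, hz2⟩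
  rw [h3]
  apply mul_le_mul_of_nonneg_right _ (by linarith)
  exact h.low _ (by simpa using hz) (by simp; linarith) (by simp; linarith)

lemma Strip.s_mono (h : Strip k K m ε c0 l Y φ U P Q ψ s) {y1 y2 : ℝ} (hy : y1 ≤ y2) (hy2 : y2 < 0) : y2 - y1 ≤ s y2 - s y1 := by
  have hmon : MonotoneOn (fun y => s y - y) (Icc y1 y2) := by
    apply monotoneOn_of_deriv_nonneg (convex_Icc _ _)
    · intro y hy
      exact ((h.s_der y (by linarith [hy.2])).continuousAt.sub continuousAt_id).continuousWithinAt
    · intro y hy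
      rw [interior_Icc] at hy
      exact ((h.s_der y (by linarith [hy.2])).sub (hasDerivAt_id y)).differentiableAt.differentiableWithinAt
    · intro y hy
      rw [interior_Icc] at hy
      have : HasDerivAt (fun y => s y - y) _ y := (h.s_der y (by linarith [hy.2])).sub (hasDerivAt_id y)
      rw [this.deriv]
      have : 1 ≤ √(1 + deriv φ y ^ 2) := by rw [Real.one_le_sqrt]; nlinarith [sq_nonneg (deriv φ y)]
      linarith
  have := hmon (left_mem_Icc.mpr hy) (right_mem_Icc.mpr hy) hy
  simp only at this
  linarith

lemma Strip.s_abs (h : Strip k K m ε c0 l Y φ U P Q ψ s) {y1 y2 : ℝ} (hy1 : y1 < 0) (hy2 : y2 < 0) : |y2 - y1| ≤ |s y2 - s y1| := by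
  rcases le_total y1 y2 with hh | hh
  · have := h.s_mono hh hy2
    rw [abs_of_nonneg (by linarith)]; exact this.trans (le_abs_self _)
  · have := h.s_mono hh hy1
    rw [abs_sub_comm, abs_sub_comm (s y2), abs_of_nonneg (by linarith)]; exact this.trans (le_abs_self _)

lemma Strip.φ_lip (h : Strip k K m ε c0 l Y φ U P Q ψ s) {y1 y2 : ℝ} (hy1 : y1 < Y) (hy2 : y2 < Y) :
    |φ y2 - φ y1 - m * (y2 - y1)| ≤ ε * |y2 - y1| := by
  have hd : ∀ x ∈ Iio Y, HasDerivWithinAt (fun y => φ y - m * y) (deriv φ x - m * 1) (Iio Y) x := fun x hx =>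
    ((h.fb.φd (lt_trans hx h.Y_neg)).sub ((hasDerivAt_id x).const_mul m)).hasDerivWithinAt
  have := (convex_Iio Y).norm_image_sub_le_of_norm_hasDerivWithin_le (C := ε) hd (fun x hx => by simpa using h.slope x hx) hy1 hy2
  simp only [Real.norm_eq_abs] at this
  convert this using 2
  ring

def stripN (φ : ℝ → ℝ) (l Y : ℝ) : Set ℂ := {z | z.im < Y ∧ φ z.im - l < z.re ∧ z.re < φ z.im}

lemma Strip.N_open (h : Strip k K m ε c0 l Y φ U P Q ψ s) : IsOpen (stripN φ l Y) := by
  have h1 : IsOpen {z : ℂ | z.im < Y} := isOpen_lt Complex.continuous_im continuous_const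
  have h2 : ContinuousOn (fun z : ℂ => φ z.im - z.re) {z : ℂ | z.im < Y} :=
    (h.fb.φa.continuousOn.comp Complex.continuous_im.continuousOn (fun z hz => lt_trans hz h.Y_neg)).sub Complex.continuous_re.continuousOn
  have := h2.isOpen_inter_preimage h1 (isOpen_Ioo (a := 0) (b := l))
  convert this using 1
  ext z; simp [stripN]
  intro _
  constructor
  · rintro ⟨a, b⟩; exact ⟨b, by linarith⟩
  · rintro ⟨a, b⟩; exact ⟨by linarith, a⟩

lemma Strip.N_sub (h : Strip k K m ε c0 l Y φ U P Q ψ s) {z : ℂ} (hz : z ∈ stripN φ l Y) : z ∈ Rg φ := ⟨hz.1.trans h.Y_neg, hz.2.2⟩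

lemma Strip.inj (h : Strip k K m ε c0 l Y φ U P Q ψ s) {z1 z2 : ℂ} (h1 : z1 ∈ stripN φ l Y) (h2 : z2 ∈ stripN φ l Y)
    (hU : U z1 = U z2) (hψ : ψ z1 = ψ z2) : z1 = z2 := by
  have hK := h.fb.K_pos
  have hk := h.fb.k_pos
  have hc0 := h.c0_pos
  set p := U z1 with hp
  have r1 := h.N_sub h1
  have r2 := h.N_sub h2
  have hpp : 0 < p := h.fb.U_pos _ r1
  have a1 := h.fb.U_le r1
  have a2 := h.fb.U_le r2
  have b1 := h.U_ge h1.1 h1.2.1.le h1.2.2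
  have b2 := h.U_ge h2.1 h2.2.1.le h2.2.2
  rw [← hU] at a2 b2
  rw [← hp] at a1 b1
  have d1 := h.s_bd _ r1
  have d2 := h.s_bd _ r2
  have dy : |z2.im - z1.im| ≤ K * (φ z1.im - z1.re) + K * (φ z2.im - z2.re) := by
    refine (h.s_abs r1.1 r2.1).trans ?_
    rw [hψ] at d1
    calc |s z2.im - s z1.im| = |(ψ z2 - s z1.im) - (ψ z2 - s z2.im)| := by congr 1; ring
      _ ≤ _ := (abs_sub _ _).trans (add_le_add d1 d2)
  have dy2 : c0 * |z2.im - z1.im| ≤ 2 * K * p := by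
    calc _ ≤ c0 * (K * (φ z1.im - z1.re) + K * (φ z2.im - z2.re)) := by gcongr
      _ = K * (c0 * (φ z1.im - z1.re)) + K * (c0 * (φ z2.im - z2.re)) := by ring
      _ ≤ K * p + K * p := by gcongr
      _ = _ := by ring
  by_contra hne
  set v := z2 - z1 with hv
  have hseg : ∀ t ∈ Icc (0:ℝ) 1, z1 + t * v ∈ Rg φ := by
    intro t ht
    have him : (z1 + t * v).im = z1.im + t * (z2.im - z1.im) := by simp [hv]
    have hre : (z1 + t * v).re = z1.re + t * (z2.re - z1.re) := by simp [hv]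
    have hlt : z1.im + t * (z2.im - z1.im) < Y := by
      have e1 := h1.1; have e2 := h2.1
      rcases le_total z1.im z2.im with hh | hh
      · nlinarith [ht.1, ht.2, mul_nonneg (sub_nonneg.2 hh) (sub_nonneg.2 ht.2)]
      · nlinarith [ht.1, ht.2, mul_nonneg (sub_nonneg.2 hh) ht.1]
    refine ⟨by rw [him]; exact hlt.trans h.Y_neg, ?_⟩
    rw [him, hre]
    set y := z1.im + t * (z2.im - z1.im) with hy
    have f1 := h.φ_lip h1.1 hlt
    have f2 := h.φ_lip h2.1 hlt
    have g1 : |y - z1.im| ≤ |z2.im - z1.im| := by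
      rw [hy, add_sub_cancel_left, abs_mul, abs_of_nonneg ht.1]
      exact mul_le_of_le_one_left (abs_nonneg _) ht.2
    have g2 : |y - z2.im| ≤ |z2.im - z1.im| := by
      rw [show y - z2.im = (1 - t) * -(z2.im - z1.im) by rw [hy]; ring, abs_mul, abs_neg, abs_of_nonneg (by linarith [ht.2])]
      exact mul_le_of_le_one_left (abs_nonneg _) (by linarith [ht.1])
    have f1' := (abs_le.mp (f1.trans (mul_le_mul_of_nonneg_left g1 h.ε_pos))).1
    have f2' := (abs_le.mp (f2.trans (mul_le_mul_of_nonneg_left g2 h.ε_pos))).1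
    have e1 : K * (ε * |z2.im - z1.im|) < p := by
      have := h.ε_sm
      have i1 : c0 * (K * (ε * |z2.im - z1.im|)) < c0 * p := by
        calc c0 * (K * (ε * |z2.im - z1.im|)) = K * ε * (c0 * |z2.im - z1.im|) := by ring
          _ ≤ K * ε * (2 * K * p) := by have := h.ε_pos; gcongr
          _ = (2 * ε * K ^2) * p := by ring
          _ < c0 * p := by gcongr
      exact lt_of_mul_lt_mul_left i1 hc0.le
    have t1 : ε * |z2.im - z1.im| < φ z1.im - z1.re := lt_of_mul_lt_mul_left (e1.trans_le a1) hK.le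
    have t2 : ε * |z2.im - z1.im| < φ z2.im - z2.re := lt_of_mul_lt_mul_left (e1.trans_le a2) hK.le
    have u1 : 0 < φ y - z1.re - m * (y - z1.im) := by linarith
    have u2 : 0 < φ y - z2.re - m * (y - z2.im) := by linarith
    have u3 : φ y - (z1.re + t * (z2.re - z1.re)) = (1 - t) * (φ y - z1.re - m * (y - z1.im)) + t * (φ y - z2.re - m * (y - z2.im)) := by
      rw [hy]; ring
    have u4 : 0 < φ y - (z1.re + t * (z2.re - z1.re)) := by
      rw [u3]
      rcases ht.1.eq_or_lt with h0 | h0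
      · have e : t = 0 := h0.symm
        have : (1 - t) * (φ y - z1.re - m * (y - z1.im)) + t * (φ y - z2.re - m * (y - z2.im)) = φ y - z1.re - m * (y - z1.im) := by
          generalize φ y - z1.re - m * (y - z1.im) = a
          generalize φ y - z2.re - m * (y - z2.im) = b
          rw [e]; ring
        rw [this]; exact u1
      · have := mul_pos h0 u2
        have := mul_nonneg (show 0 ≤ 1 - t by linarith [ht.2]) u1.le
        linarith
    linarith
  have hder : ∀ t ∈ Icc (0:ℝ) 1, HasDerivAt (fun t : ℝ => v.im * ψ (z1 + t * v) - v.re * U (z1 + t * v))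
      ((2 * k * U (z1 + t * v) - P (z1 + t * v)) * v.im ^ 2 + (-P (z1 + t * v)) * v.re ^ 2) t := by
    intro t ht
    have q1 := line_deriv (g := ψ) (g1 := Q) (g2 := fun z => 2 * k * U z - P z) t (h.psi _ (hseg t ht))
    have q2 := line_deriv t (h.fb.U_der _ (hseg t ht))
    refine ((q1.const_mul v.im).sub (q2.const_mul v.re)).congr_deriv ?_
    ring
  obtain ⟨t, ht, heq⟩ := exists_hasDerivAt_eq_slope _ _ (zero_lt_one' ℝ) (fun t ht => (hder t ht).continuousAt.continuousWithinAt) (fun t ht => hder t ⟨ht.1.le, ht.2.le⟩)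
  have hz2 : z1 + (1:ℝ) * v = z2 := by simp [hv]
  have hz1 : z1 + (0:ℝ) * v = z1 := by simp
  rw [hz2, hz1, ← hψ, ← hU, ← hp, sub_self, zero_div] at heq
  have hRt := hseg t ⟨ht.1.le, ht.2.le⟩
  have hPt := h.fb.P_neg _ hRt
  have hUt := h.fb.U_pos _ hRt
  have hvne : v ≠ 0 := fun h0 => hne (by rw [hv, sub_eq_zero] at h0; exact h0.symm)
  have hvs : 0 < v.re ^ 2 + v.im ^ 2 := by
    have := Complex.normSq_pos.mpr hvne
    rw [Complex.normSq_apply] at this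
    nlinarith
  have w1 : 0 ≤ 2 * k * U (z1 + t * v) * v.im ^ 2 := by positivity
  have w2 : 0 < -P (z1 + t * v) * (v.re ^ 2 + v.im ^ 2) := mul_pos (by linarith) hvs
  nlinarith
end B4
end ModB4

section ModB5
open MeasureTheory
open Complex (I)

section B5
variable {k K m ε c0 l Y : ℝ} {φ : ℝ → ℝ} {U P Q ψ : ℂ → ℝ} {s : ℝ → ℝ}

def FF (P Q : ℂ → ℝ) (z : ℂ) : ℂ := ((-P z : ℝ) : ℂ) + Q z * I
def AA (P Q : ℂ → ℝ) (z : ℂ) : ℂ := -I * Complex.log (FF P Q z)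
def om (ψ U : ℂ → ℝ) (a : ℝ) (z : ℂ) : ℂ := ((ψ z - a : ℝ) : ℂ) + U z * I

lemma FF_re (z : ℂ) : (FF P Q z).re = -P z := by simp [FF]
lemma FF_im (z : ℂ) : (FF P Q z).im = Q z := by simp [FF]

lemma FB.F_ne (h : FB k K φ U P Q) {z : ℂ} (hz : z ∈ Rg φ) : FF P Q z ≠ 0 := fun h0 => by
  have := FF_re (P := P) (Q := Q) z
  rw [h0] at this; simp at this
  linarith [h.P_neg z hz]
lemma FB.F_slit (h : FB k K φ U P Q) {z : ℂ} (hz : z ∈ Rg φ) : FF P Q z ∈ Complex.slitPlane :=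
  Or.inl (by rw [FF_re]; linarith [h.P_neg z hz])

lemma FB.exp_A (h : FB k K φ U P Q) {z : ℂ} (hz : z ∈ Rg φ) : Complex.exp (I * AA P Q z) = FF P Q z := by
  rw [AA, ← mul_assoc, mul_neg, Complex.I_mul_I, neg_neg, one_mul, Complex.exp_log (h.F_ne hz)]

lemma FB.A_c1 (h : FB k K φ U P Q) : ContDiffOn ℝ 1 (AA P Q) (Rg φ) := by
  have hF : ContDiffOn ℝ 1 (FF P Q) (Rg φ) :=
    (Complex.ofRealCLM.contDiff.comp_contDiffOn h.P_c1.neg).add ((Complex.ofRealCLM.contDiff.comp_contDiffOn h.Q_c1).mul contDiffOn_const)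
  intro z hz
  apply ContDiffAt.contDiffWithinAt
  apply ContDiffAt.mul contDiffAt_const
  have := (Complex.contDiffAt_log (n := 1) (h.F_slit hz)).restrict_scalars ℝ
  exact this.comp z (hF.contDiffAt (h.open.mem_nhds hz))

lemma FB.A_dbar (h : FB k K φ U P Q) {z : ℂ} (hz : z ∈ Rg φ) :
    dbar (AA P Q) z = -(I * k / 2) * (1 + Complex.exp (-(2 * I * (AA P Q z).re))) := by
  have hF : HasFDerivAt (FF P Q) (Complex.ofRealCLM.comp (-fderiv ℝ P z) + I • Complex.ofRealCLM.comp (fderiv ℝ Q z)) z := by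
    have h1 := Complex.ofRealCLM.hasFDerivAt.comp z (h.Pd hz).neg
    have h2 := (Complex.ofRealCLM.hasFDerivAt.comp z (h.Qd hz)).const_mul I
    refine (h1.add h2).congr_of_eventuallyEq (Eventually.of_forall fun w => ?_)
    simp [FF, mul_comm]
  have hlog := ((Complex.hasStrictDerivAt_log (h.F_slit hz)).hasDerivAt.hasFDerivAt.restrictScalars ℝ).comp z hF
  have hA := hlog.const_mul (-I)
  have hAe : fderiv ℝ (AA P Q) z = _ := HasFDerivAt.fderiv hA
  have hne := h.F_ne hz
  have e1 : dbar (AA P Q) z = -I * ((FF P Q z)⁻¹ * ((-P z : ℝ) * k)) := by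
    have p1 := h.sym z hz
    have p2 : (fderiv ℝ P z 1 : ℂ) + fderiv ℝ Q z I = 2 * k * P z := by exact_mod_cast congrArg (fun x : ℝ => (x : ℂ)) (h.pde z hz)
    rw [dbar, hAe]
    simp only [ContinuousLinearMap.smul_apply, ContinuousLinearMap.comp_apply, ContinuousLinearMap.add_apply, ContinuousLinearMap.neg_apply, ContinuousLinearMap.coe_restrictScalars', smul_eq_mul, ContinuousLinearMap.toSpanSingleton_apply, Complex.ofRealCLM_apply, p1]
    push_cast
    linear_combination (I / 2 * (FF P Q z)⁻¹) * p2 + (-I/2* (FF P Q z)⁻¹ * fderiv ℝ Q z I )* Complex.I_sq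
  have e2 : (AA P Q z).re = (FF P Q z).arg := by simp [AA, Complex.log_im]
  have e3 : FF P Q z * Complex.exp (-(2 * I * (FF P Q z).arg)) = starRingEnd ℂ (FF P Q z) := by
    have hn := Complex.norm_mul_exp_arg_mul_I (FF P Q z)
    have h4 := congrArg (starRingEnd ℂ) hn
    rw [map_mul, Complex.conj_ofReal, ← Complex.exp_conj, map_mul, Complex.conj_I, Complex.conj_ofReal] at h4
    rw [← h4]
    calc _ = (‖FF P Q z‖ * Complex.exp ((FF P Q z).arg * I)) * Complex.exp (-(2 * I * (FF P Q z).arg)) := by rw [hn]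
      _ = _ := by rw [mul_assoc, ← Complex.exp_add]; congr 2; ring
  have e4 : FF P Q z + starRingEnd ℂ (FF P Q z) = 2 * (-P z : ℝ) := by
    rw [Complex.add_conj, FF_re]; push_cast; ring
  rw [e1, e2, ← mul_right_inj' hne]
  rw [show FF P Q z * (-I * ((FF P Q z)⁻¹ * ((-P z : ℝ) * k))) = -I * ((-P z : ℝ) * k) by field_simp]
  linear_combination (I * k / 2) * e4 - (-(I * k / 2)) * e3

lemma Strip.A_bd (h : Strip k K m ε c0 l Y φ U P Q ψ s) {z : ℂ} (hz : z ∈ stripN φ l Y) :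
    ‖AA P Q z‖ ≤ |Real.log c0| + |Real.log (2 * K)| + π := by
  have hR := h.N_sub hz
  have h1 := h.low z hz.1 hz.2.1.le hz.2.2
  have n1 : c0 ≤ ‖FF P Q z‖ := by
    rw [← FF_re (Q := Q)] at h1
    exact h1.trans (Complex.re_le_norm _)
  have n2 : ‖FF P Q z‖ ≤ 2 * K := by
    refine (Complex.norm_le_abs_re_add_abs_im _).trans ?_
    rw [FF_re, FF_im, abs_neg]
    linarith [h.fb.P_bd z hR, h.fb.Q_bd z hR]
  rw [AA, norm_mul, norm_neg, Complex.norm_I, one_mul]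
  refine (Complex.norm_le_abs_re_add_abs_im _).trans ?_
  rw [Complex.log_re, Complex.log_im]
  have h0 : 0 < ‖FF P Q z‖ := h.c0_pos.trans_le n1
  have l1 := Real.log_le_log h.c0_pos n1
  have l2 := Real.log_le_log h0 n2
  have : |Real.log ‖FF P Q z‖| ≤ |Real.log c0| + |Real.log (2 * K)| := by
    rw [abs_le]
    constructor <;> linarith [neg_abs_le (Real.log c0), le_abs_self (Real.log (2*K)), abs_nonneg (Real.log c0), abs_nonneg (Real.log (2*K))]
  linarith [Complex.abs_arg_le_pi (FF P Q z)]

lemma Strip.om_der (h : Strip k K m ε c0 l Y φ U P Q ψ s) (a : ℝ) {z : ℂ} (hz : z ∈ Rg φ) :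
    HasFDerivAt (om ψ U a) (Complex.ofRealCLM.comp (Q z • Complex.reCLM + (2 * k * U z - P z) • Complex.imCLM) +
      I • Complex.ofRealCLM.comp (P z • Complex.reCLM + Q z • Complex.imCLM)) z := by
  have h1 := Complex.ofRealCLM.hasFDerivAt.comp z ((h.psi z hz).sub_const a)
  have h2 := (Complex.ofRealCLM.hasFDerivAt.comp z (h.fb.U_der z hz)).const_mul I
  refine (h1.add h2).congr_of_eventuallyEq (Eventually.of_forall fun w => ?_)
  simp [om, mul_comm]

lemma Strip.om_fd (h : Strip k K m ε c0 l Y φ U P Q ψ s) (a : ℝ) {z : ℂ} (hz : z ∈ Rg φ) (v : ℂ) :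
    fderiv ℝ (om ψ U a) z v = -I * Complex.exp (I * AA P Q z) * v + 2 * k * (om ψ U a z).im * v.im := by
  rw [(h.om_der a hz).fderiv, h.fb.exp_A hz]
  apply Complex.ext <;> simp [om, FF] <;> ring

lemma Strip.om_c1 (h : Strip k K m ε c0 l Y φ U P Q ψ s) (a : ℝ) : ContDiffOn ℝ 1 (om ψ U a) (Rg φ) := by
  rw [show (1 : WithTop ℕ∞) = 0 + 1 by simp, contDiffOn_succ_iff_fderiv_of_isOpen h.fb.open]
  refine ⟨fun z hz => (h.om_der a hz).differentiableAt.differentiableWithinAt, by simp, ?_⟩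
  rw [contDiffOn_zero]
  have hs : Rg φ ⊆ Rgc φ := fun z hz => ⟨hz.1, hz.2.le⟩
  have cU := h.fb.U_cont.mono hs
  have cP := h.fb.P_cont.mono hs
  have cQ := h.fb.Q_cont.mono hs
  refine ContinuousOn.congr (f := fun z => Complex.ofRealCLM.comp (Q z • Complex.reCLM + (2 * k * U z - P z) • Complex.imCLM) +
      I • Complex.ofRealCLM.comp (P z • Complex.reCLM + Q z • Complex.imCLM)) ?_ (fun z hz => (h.om_der a hz).fderiv)
  have c1 : ContinuousOn (fun z => Q z • Complex.reCLM + (2 * k * U z - P z) • Complex.imCLM) (Rg φ) :=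
    (cQ.smul continuousOn_const).add (((continuousOn_const.mul cU).sub cP).smul continuousOn_const)
  have c2 : ContinuousOn (fun z => P z • Complex.reCLM + Q z • Complex.imCLM) (Rg φ) :=
    (cP.smul continuousOn_const).add (cQ.smul continuousOn_const)
  exact (continuousOn_const.clm_comp c1).add ((continuousOn_const.clm_comp c2).const_smul I)
end B5
end ModB5

section ModB6
open MeasureTheory
open Complex (I)

section B6
variable {k K m ε c0 l Y : ℝ} {φ : ℝ → ℝ} {U P Q ψ : ℂ → ℝ} {s : ℝ → ℝ}

lemma FB.V_mono (h : FB k K φ U P Q) {y : ℝ} (hy : y < 0) :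
    StrictMonoOn (fun t : ℝ => U ((φ y - t : ℝ) + y * I)) (Ici 0) := by
  have hd : ∀ t > 0, HasDerivAt (fun t : ℝ => U ((φ y - t : ℝ) + y * I)) (-P ((φ y - t : ℝ) + y * I)) t := by
    intro t ht
    have e : ∀ t : ℝ, (((φ y - t : ℝ) : ℂ) + y * I) = (φ y + y * I) + t * (-1) := fun t => by push_cast; ring
    have hR : (φ y + y * I : ℂ) + t * (-1) ∈ Rg φ := ⟨by simpa using hy, by simpa using ht⟩
    have := line_deriv t (h.U_der _ hR)
    simp only [e]
    simpa using this
  apply strictMonoOn_of_deriv_pos (convex_Ici 0)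
  · refine h.U_cont.comp (Continuous.continuousOn (by fun_prop)) (fun t ht => ⟨by simpa using hy, by simpa using ht⟩)
  · intro t ht
    rw [interior_Ici] at ht
    rw [(hd t ht).deriv]
    have := h.P_neg ((φ y - t : ℝ) + y * I) ⟨by simpa using hy, by simpa using ht⟩
    linarith

lemma Strip.exists_Z (h : Strip k K m ε c0 l Y φ U P Q ψ s) {r y0 x p : ℝ} (hr : r * (1 + K / c0) ≤ 1 / 2) (hrl : r / c0 ≤ l / 2)
    (hy0 : y0 < Y - 1) (hx : |x| < r) (hp : 0 < p) (hpr : p < r) :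
    ∃ z : ℂ, |z.im - y0| ≤ 1 / 2 ∧ z.re < φ z.im ∧ φ z.im - z.re < l / 2 ∧ c0 * (φ z.im - z.re) ≤ p ∧ p ≤ K * (φ z.im - z.re) ∧ U z = p ∧ ψ z = x + s y0 := by
  have hc0 := h.c0_pos
  have hK := h.fb.K_pos
  have hl := h.l_pos
  have hYn := h.Y_neg
  have hrl' : r ≤ c0 * (l / 2) := by rw [div_le_iff₀ hc0] at hrl; linarith
  have hT : ∀ y : ℝ, ∃ t, y < Y → (0 < t ∧ t < l / 2 ∧ U ((φ y - t : ℝ) + y * I) = p) := by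
    intro y
    by_cases hy : y < Y
    swap
    · exact ⟨0, fun h => absurd h hy⟩
    have hyn := hy.trans hYn
    have hcont : ContinuousOn (fun t : ℝ => U ((φ y - t : ℝ) + y * I)) (Icc 0 (l / 2)) :=
      h.fb.U_cont.comp (Continuous.continuousOn (by fun_prop)) (fun t ht => ⟨by simpa using hyn, by simpa using ht.1⟩)
    have h0 : U ((φ y - (0:ℝ) : ℝ) + y * I) = 0 := by simpa using h.fb.U_zero y hyn
    have h1 := h.U_ge (z := ((φ y - l / 2 : ℝ) + y * I)) (by simpa using hy) (by simp; linarith) (by simp; linarith)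
    simp at h1
    obtain ⟨t, ht, hU⟩ := intermediate_value_Ioo (by linarith) hcont (show p ∈ Ioo _ _ from ⟨by rw [h0]; exact hp, by push_cast; linarith⟩)
    exact ⟨t, fun _ => ⟨ht.1, ht.2, hU⟩⟩
  choose T hT using hT
  have hTR : ∀ y < Y, ((φ y - T y : ℝ) + y * I : ℂ) ∈ Rg φ := fun y hy => ⟨by simpa using hy.trans hYn, by simpa using (hT y hy).1⟩
  have hφc : ∀ y < Y, ContinuousAt φ y := fun y hy => (h.fb.φd (hy.trans hYn)).continuousAt
  have hTc : ∀ y < Y, ContinuousAt T y := by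
    intro y1 hy1
    have hev : ∀ᶠ y in 𝓝 y1, y < Y := isOpen_Iio.mem_nhds hy1
    have hVc : ∀ t > 0, ContinuousAt (fun y : ℝ => U ((φ y - t : ℝ) + y * I)) y1 := by
      intro t ht
      have hR : ((φ y1 - t : ℝ) + y1 * I : ℂ) ∈ Rg φ := ⟨by simpa using hy1.trans hYn, by simpa using ht⟩
      have c2 : ContinuousAt (fun y : ℝ => ((φ y - t : ℝ) + y * I : ℂ)) y1 :=
        (Complex.continuous_ofReal.continuousAt.comp ((hφc y1 hy1).sub continuousAt_const)).add (by fun_prop)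
      exact ContinuousAt.comp (f := fun y : ℝ => ((φ y - t : ℝ) + y * I : ℂ)) (h.fb.U_der _ hR).continuousAt c2
    obtain ⟨t1, t2, t3⟩ := hT y1 hy1
    refine tendsto_order.2 ⟨fun a ha => ?_, fun b hb => ?_⟩
    · rcases le_or_gt a 0 with h0 | h0
      · filter_upwards [hev] with y hy using h0.trans_lt (hT y hy).1
      have := h.fb.V_mono (hy1.trans hYn) h0.le t1.le ha
      simp only [t3] at this
      filter_upwards [hev, (hVc a h0).eventually_lt_const this] with y hy hV
      by_contra! hc
      have := (h.fb.V_mono (hy.trans hYn)).monotoneOn (hT y hy).1.le h0.le hc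
      simp only [(hT y hy).2.2] at this
      linarith
    · have h0 := t1.trans hb
      have := h.fb.V_mono (hy1.trans hYn) t1.le h0.le hb
      simp only [t3] at this
      filter_upwards [hev, (hVc b h0).eventually_const_lt this] with y hy hV
      by_contra! hc
      have := (h.fb.V_mono (hy.trans hYn)).monotoneOn h0.le (hT y hy).1.le hc
      simp only [(hT y hy).2.2] at this
      linarith
  have hTp : ∀ y < Y, c0 * T y ≤ p ∧ p ≤ K * T y := by
    intro y hy
    obtain ⟨t1, t2, t3⟩ := hT y hy
    have a1 := h.U_ge (z := ((φ y - T y : ℝ) + y * I)) (by simpa using hy) (by simp; linarith) (by simpa using t1)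
    have a2 := h.fb.U_le (hTR y hy)
    rw [t3] at a1 a2
    simp at a1 a2
    exact ⟨a1, a2⟩
  have hψs : ∀ y < Y, |ψ ((φ y - T y : ℝ) + y * I) - s y| ≤ K / c0 * r := by
    intro y hy
    have a1 := h.s_bd _ (hTR y hy)
    simp at a1
    have a2 := (hTp y hy).1
    push_cast
    refine a1.trans ?_
    rw [div_mul_eq_mul_div, le_div_iff₀ hc0]
    nlinarith
  have hgc : ContinuousOn (fun y : ℝ => ψ ((φ y - T y : ℝ) + y * I)) (Icc (y0 - 1/2) (y0 + 1/2)) := by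
    intro y hy
    have hyY : y < Y := by linarith [hy.2]
    have c2 : ContinuousAt (fun y : ℝ => ((φ y - T y : ℝ) + y * I : ℂ)) y :=
        (Complex.continuous_ofReal.continuousAt.comp ((hφc y hyY).sub (hTc y hyY))).add (by fun_prop)
    exact (ContinuousAt.comp (f := fun y : ℝ => ((φ y - T y : ℝ) + y * I : ℂ)) (h.psi _ (hTR y hyY)).continuousAt c2).continuousWithinAt
  have b1 := h.s_mono (show y0 - 1/2 ≤ y0 by linarith) (by linarith)
  have b2 := h.s_mono (show y0 ≤ y0 + 1/2 by linarith) (by linarith)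
  have b3 := (abs_le.mp (hψs (y0 - 1/2) (by linarith))).2
  have b4 := (abs_le.mp (hψs (y0 + 1/2) (by linarith))).1
  have b5 := abs_lt.mp hx
  obtain ⟨y, hy, hψ⟩ := intermediate_value_Icc (by linarith) hgc (show x + s y0 ∈ Icc _ _ from ⟨by linarith, by linarith⟩)
  have hyY : y < Y := by linarith [hy.2]
  refine ⟨(φ y - T y : ℝ) + y * I, ?_⟩
  have e1 : ((φ y - T y : ℝ) + y * I : ℂ).im = y := by simp
  have e2 : ((φ y - T y : ℝ) + y * I : ℂ).re = φ y - T y := by simp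
  rw [e1, e2, sub_sub_cancel]
  refine ⟨abs_le.2 ⟨by linarith [hy.1], by linarith [hy.2]⟩, by linarith [(hT y hyY).1], (hT y hyY).2.1, (hTp y hyY).1, (hTp y hyY).2, (hT y hyY).2.2, hψ⟩

lemma log_arctan (a : ℝ) : -I * Complex.log (((1 / √(1 + a ^ 2) : ℝ) : ℂ) + ((a / √(1 + a ^ 2) : ℝ) : ℂ) * I) = arctan a := by
  rw [← Real.cos_arctan, ← Real.sin_arctan, Complex.ofReal_cos, Complex.ofReal_sin, ← Complex.exp_mul_I, Complex.log_exp]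
  · linear_combination (-(arctan a : ℂ)) * Complex.I_sq
  · rw [Complex.mul_I_im, Complex.ofReal_re]; linarith [neg_pi_div_two_lt_arctan a, Real.pi_pos]
  · rw [Complex.mul_I_im, Complex.ofReal_re]; linarith [arctan_lt_pi_div_two a, Real.pi_pos]

lemma FB.A_bdry (h : FB k K φ U P Q) {y : ℝ} (hy : y < 0) :
    Tendsto (AA P Q) (𝓝[Rgc φ] (φ y + y * I)) (𝓝 (arctan (deriv φ y) : ℂ)) := by
  have hm : (φ y + y * I : ℂ) ∈ Rgc φ := ⟨by simpa using hy, by simp⟩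
  have e : FF P Q (φ y + y * I) = ((1 / √(1 + deriv φ y ^ 2) : ℝ) : ℂ) + ((deriv φ y / √(1 + deriv φ y ^ 2) : ℝ) : ℂ) * I := by
    rw [FF, h.P_bdry y hy, h.Q_bdry y hy, neg_div, neg_neg]
  have hF : ContinuousWithinAt (FF P Q) (Rgc φ) (φ y + y * I) :=
    (Complex.continuous_ofReal.continuousAt.comp_continuousWithinAt (h.P_cont _ hm).neg).add
      ((Complex.continuous_ofReal.continuousAt.comp_continuousWithinAt (h.Q_cont _ hm)).mul continuousWithinAt_const)
  have hs : FF P Q (φ y + y * I) ∈ Complex.slitPlane := Or.inl (by rw [FF_re, h.P_bdry y hy, neg_div, neg_neg]; positivity)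
  have : Tendsto (AA P Q) (𝓝[Rgc φ] (φ y + y * I)) (𝓝 (-I * Complex.log (FF P Q (φ y + y * I)))) := (continuousWithinAt_const (b := -I)).mul (hF.clog hs)
  rw [e, log_arctan] at this
  exact this
end B6
end ModB6

section ModB7
open MeasureTheory
open Complex (I)

section B7
variable {k K m ε c0 l Y : ℝ} {φ : ℝ → ℝ} {U P Q ψ : ℂ → ℝ} {s : ℝ → ℝ}

lemma Strip.Z_lim (h : Strip k K m ε c0 l Y φ U P Q ψ s) {r y0 x ys : ℝ} (hr : 0 < r) {Z : ℂ → ℂ} (hys : ys < 0) (hx : s ys = x + s y0)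
    (hZ : ∀ p : ℝ, 0 < p → p < r → (Z (x + p * I)).im < 0 ∧ (Z (x + p * I)).re < φ (Z (x + p * I)).im ∧ c0 * (φ (Z (x + p * I)).im - (Z (x + p * I)).re) ≤ p ∧ ψ (Z (x + p * I)) = x + s y0) :
    Tendsto (fun p : ℝ => AA P Q (Z (x + p * I))) (𝓝[>] 0) (𝓝 (arctan (deriv φ ys) : ℂ)) := by
  have hc0 := h.c0_pos
  have hK := h.fb.K_pos
  have hev : ∀ᶠ p : ℝ in 𝓝[>] 0, 0 < p ∧ p < r := Ioo_mem_nhdsGT hr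
  have him : Tendsto (fun p : ℝ => (Z (x + p * I)).im) (𝓝[>] 0) (𝓝 ys) := by
    rw [tendsto_iff_norm_sub_tendsto_zero]
    refine squeeze_zero' (g := fun p => K * (p / c0)) (Eventually.of_forall fun _ => norm_nonneg _) ?_ ?_
    · filter_upwards [hev] with p hp
      obtain ⟨z1, z2, z3, z4⟩ := hZ p hp.1 hp.2
      rw [Real.norm_eq_abs]
      refine (h.s_abs hys z1).trans ?_
      have := h.s_bd _ ⟨z1, z2⟩
      rw [z4, ← hx, abs_sub_comm] at this
      refine this.trans ?_
      gcongr
      rw [le_div_iff₀ hc0]; linarith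
    · have : Tendsto (fun p : ℝ => K * (p / c0)) (𝓝 0) (𝓝 (K * (0 / c0))) := by
        apply Continuous.tendsto; fun_prop
      rw [zero_div, mul_zero] at this
      exact this.mono_left nhdsWithin_le_nhds
  have hT : Tendsto (fun p : ℝ => φ (Z (x + p * I)).im - (Z (x + p * I)).re) (𝓝[>] 0) (𝓝 0) := by
    refine squeeze_zero' (g := fun p => p / c0) ?_ ?_ ?_
    · filter_upwards [hev] with p hp
      linarith [(hZ p hp.1 hp.2).2.1]
    · filter_upwards [hev] with p hp
      rw [le_div_iff₀ hc0]; linarith [(hZ p hp.1 hp.2).2.2.1]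
    · have : Tendsto (fun p : ℝ => p / c0) (𝓝 0) (𝓝 (0 / c0)) := by
        apply Continuous.tendsto; fun_prop
      rw [zero_div] at this
      exact this.mono_left nhdsWithin_le_nhds
  have hre : Tendsto (fun p : ℝ => (Z (x + p * I)).re) (𝓝[>] 0) (𝓝 (φ ys)) := by
    have := (((h.fb.φd hys).continuousAt.tendsto.comp him).sub hT)
    simpa using this
  have hZl : Tendsto (fun p : ℝ => Z (x + p * I)) (𝓝[>] 0) (𝓝[Rgc φ] (φ ys + ys * I)) := by
    rw [tendsto_nhdsWithin_iff]
    constructor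
    · have := ((Complex.continuous_ofReal.tendsto _).comp hre).add (((Complex.continuous_ofReal.tendsto _).comp him).mul_const I)
      refine this.congr fun p => ?_
      simp [Complex.re_add_im]
    · filter_upwards [hev] with p hp
      obtain ⟨z1, z2, z3, z4⟩ := hZ p hp.1 hp.2
      exact ⟨z1, z2.le⟩
  exact (h.fb.A_bdry hys).comp hZl

lemma Strip.expansion (h : Strip k K m ε c0 l Y φ U P Q ψ s) :
    ∃ C > 0, ∃ r > 0, ∀ y0 < Y - 1, ∃ q0 q1 q2 : ℝ, ∀ y < 0, |s y - s y0| < r →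
      |arctan (deriv φ y) - (q0 + q1 * (s y - s y0) + q2 * (s y - s y0) ^ 2)| ≤ C * |s y - s y0| ^ (5/2:ℝ) := by
  have hc0 := h.c0_pos
  have hK := h.fb.K_pos
  have hl := h.l_pos
  have hYn := h.Y_neg
  have hm := abs_nonneg m
  set r := min (1 / (2 * (1 + K / c0))) (c0 * (l / 2)) with hrd
  have hr : 0 < r := lt_min (by positivity) (by positivity)
  have hr1 : r * (1 + K / c0) ≤ 1 / 2 := by
    have : r ≤ 1 / (2 * (1 + K / c0)) := min_le_left _ _
    rw [le_div_iff₀ (by positivity)] at this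
    linarith
  have hr2 : r / c0 ≤ l / 2 := by
    rw [div_le_iff₀ hc0]; linarith [min_le_right (1 / (2 * (1 + K / c0))) (c0 * (l / 2))]
  have hrh : r ≤ 1 / 2 := by
    have : 0 < K / c0 := by positivity
    nlinarith
  set c := min (1/4) (min (1 / (K * (|m| + 2))) (l / (2 * (|m| + 2)))) with hcd
  have hc : 0 < c := lt_min (by norm_num) (lt_min (by positivity) (by positivity))
  have hc1 : c ≤ 1 / 4 := min_le_left _ _
  have hc2 : c * (K * (|m| + 2)) ≤ 1 := by
    have : c ≤ 1 / (K * (|m| + 2)) := (min_le_right _ _).trans (min_le_left _ _)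
    rwa [le_div_iff₀ (by positivity)] at this
  have hc3 : c * (2 * (|m| + 2)) ≤ l := by
    have : c ≤ l / (2 * (|m| + 2)) := (min_le_right _ _).trans (min_le_right _ _)
    rwa [le_div_iff₀ (by positivity)] at this
  obtain ⟨C, hC, hexp⟩ := local_expansion k (|Real.log c0| + |Real.log (2 * K)| + π) c c0 r h.fb.k_pos (by positivity) hc hc0 hr (by linarith)
  refine ⟨C, hC, r / 512, by positivity, fun y0 hy0 => ?_⟩
  have hZ : ∀ w : ℂ, ∃ z : ℂ, w ∈ hDisc r → |z.im - y0| ≤ 1 / 2 ∧ z.re < φ z.im ∧ φ z.im - z.re < l / 2 ∧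
      c0 * (φ z.im - z.re) ≤ w.im ∧ w.im ≤ K * (φ z.im - z.re) ∧ U z = w.im ∧ ψ z = w.re + s y0 := by
    intro w
    by_cases hw : w ∈ hDisc r
    · obtain ⟨z, hz⟩ := h.exists_Z hr1 hr2 hy0 ((Complex.abs_re_le_norm w).trans_lt hw.1) hw.2 ((Complex.im_le_norm w).trans_lt hw.1)
      exact ⟨z, fun _ => hz⟩
    · exact ⟨0, fun hh => absurd hh hw⟩
  choose Z hZ using hZ
  have hZY : ∀ w ∈ hDisc r, (Z w).im ≤ Y - 1 / 2 := fun w hw => by linarith [(abs_le.mp (hZ w hw).1).2]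
  have hdisc : ∀ x : ℝ, |x| < r → ∃ r' : ℝ, 0 < r' ∧ ∀ p : ℝ, 0 < p → p < r' → (x + p * I : ℂ) ∈ hDisc r := by
    intro x hx
    refine ⟨r - |x|, by linarith, fun p hp hpr => ⟨?_, by simpa using hp⟩⟩
    refine (norm_add_le _ _).trans_lt ?_
    rw [norm_mul, Complex.norm_I, mul_one, Complex.norm_real, Complex.norm_real, Real.norm_eq_abs, Real.norm_eq_abs, abs_of_pos hp]
    linarith
  have hlim : ∀ ys < 0, |s ys - s y0| < r → Tendsto (fun p : ℝ => AA P Q (Z ((s ys - s y0 : ℝ) + p * I))) (𝓝[>] 0) (𝓝 (arctan (deriv φ ys) : ℂ)) := by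
    intro ys hys hx
    obtain ⟨r', hr', hd⟩ := hdisc _ hx
    refine h.Z_lim (y0 := y0) hr' hys (by ring) (fun p hp hpr => ?_)
    have hm := hd p hp hpr
    obtain ⟨z1, z2, z3, z4, z5, z6, z7⟩ := hZ _ hm
    have z8 := hZY _ hm
    simp only [Complex.add_im, Complex.add_re, Complex.ofReal_im, Complex.ofReal_re, Complex.mul_I_im, Complex.mul_I_re, neg_zero, add_zero, zero_add] at z4 z7
    exact ⟨by linarith, z2, z4, z7⟩
  have hset : LocalSetup k (|Real.log c0| + |Real.log (2 * K)| + π) c c0 r (stripN φ l Y) (AA P Q) (om ψ U (s y0)) Z := by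
    refine ⟨h.N_open, h.fb.A_c1.mono fun z hz => h.N_sub hz, fun z hz => h.fb.A_dbar (h.N_sub hz), fun z hz => h.A_bd hz, ?_, (h.om_c1 _).mono fun z hz => h.N_sub hz,
      fun z hz v => h.om_fd _ (h.N_sub hz) v, ?_, ?_, ?_, ?_, ?_⟩
    · intro z hz
      rw [h.fb.exp_A (h.N_sub hz), FF_re]
      exact h.low z hz.1 hz.2.1.le hz.2.2
    · intro z1 h1 z2 h2 he
      have e1 := congrArg Complex.re he
      have e2 := congrArg Complex.im he
      simp [om] at e1 e2
      exact h.inj h1 h2 e2 e1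
    · intro z hz
      simp only [om, Complex.add_im, Complex.ofReal_im, Complex.mul_I_im, Complex.ofReal_re, zero_add]
      exact ⟨h.fb.U_pos _ (h.N_sub hz), h.fb.U_one _ (h.N_sub hz)⟩
    · intro w hw
      obtain ⟨z1, z2, z3, z4, z5, z6, z7⟩ := hZ w hw
      have z8 := hZY w hw
      refine ⟨⟨by linarith, by linarith, z2⟩, ?_⟩
      apply Complex.ext <;> simp [om, z6, z7]
    · intro w hw z' hz'
      obtain ⟨z1, z2, z3, z4, z5, z6, z7⟩ := hZ w hw
      have z8 := hZY w hw
      have hwi : w.im < 1 := by linarith [(Complex.im_le_norm w).trans_lt hw.1]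
      have hwp := hw.2
      rw [Metric.mem_ball, Complex.dist_eq] at hz'
      have d1 := (Complex.abs_im_le_norm (z' - Z w)).trans_lt hz'
      have d2 := (Complex.abs_re_le_norm (z' - Z w)).trans_lt hz'
      rw [Complex.sub_im] at d1
      rw [Complex.sub_re] at d2
      have hcp : c * w.im < 1 / 4 := by nlinarith
      have i1 : z'.im < Y := by linarith [(abs_lt.mp d1).2]
      have f1 := h.φ_lip (show (Z w).im < Y by linarith) i1
      have f2 : |φ z'.im - φ (Z w).im| ≤ (|m| + 1) * (c * w.im) := by
        calc |φ z'.im - φ (Z w).im| = |(φ z'.im - φ (Z w).im - m * (z'.im - (Z w).im)) + m * (z'.im - (Z w).im)| := by congr 1; ring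
          _ ≤ ε * |z'.im - (Z w).im| + |m| * |z'.im - (Z w).im| := (abs_add_le _ _).trans (add_le_add f1 (abs_mul _ _).le)
          _ = (|m| + ε) * |z'.im - (Z w).im| := by ring
          _ ≤ _ := by have := h.ε_one; have := h.ε_pos; gcongr
      have f3 := abs_le.mp f2
      have f4 := abs_lt.mp d2
      have g1 : (|m| + 2) * (c * w.im) ≤ φ (Z w).im - (Z w).re := by
        have : K * ((|m| + 2) * (c * w.im)) ≤ K * (φ (Z w).im - (Z w).re) := by nlinarith
        exact le_of_mul_le_mul_left this hK
      have g2 : (|m| + 2) * (c * w.im) ≤ l / 2 := by nlinarith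
      refine ⟨i1, by linarith, by linarith⟩
    · intro x hx
      have sc : ContinuousOn s (Icc (y0 - 1/2) (y0 + 1/2)) := fun y hy => (h.s_der y (by linarith [hy.2])).continuousAt.continuousWithinAt
      have b1 := h.s_mono (show y0 - 1/2 ≤ y0 by linarith) (by linarith)
      have b2 := h.s_mono (show y0 ≤ y0 + 1/2 by linarith) (by linarith)
      have b5 := abs_lt.mp hx
      obtain ⟨ys, hys, hse⟩ := intermediate_value_Icc (by linarith) sc (show x + s y0 ∈ Icc _ _ from ⟨by linarith, by linarith⟩)
      have hx2 : s ys - s y0 = x := by linarith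
      have := hlim ys (by linarith [hys.2]) (by rw [hx2]; exact hx)
      rw [hx2] at this
      have := (Complex.continuous_im.tendsto _).comp this
      rwa [Complex.ofReal_im] at this
  obtain ⟨q0, q1, q2, -, -, -, hq⟩ := hexp _ _ _ _ hset
  refine ⟨q0, q1, q2, fun y hy hyr => ?_⟩
  set x := s y - s y0 with hx
  have hl0 := hlim y hy (by linarith)
  rw [← hx] at hl0
  have hl1 := (hl0.sub_const ((q0 : ℂ) + q1 * x + q2 * x ^ 2)).norm
  have hl2 : Tendsto (fun p : ℝ => C * (‖(x + p * I : ℂ)‖ ^ (5/2:ℝ) + p)) (𝓝[>] 0) (𝓝 (C * (|x| ^ (5/2:ℝ)))) := by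
    have : Tendsto (fun p : ℝ => C * (‖(x + p * I : ℂ)‖ ^ (5/2:ℝ) + p)) (𝓝 0) (𝓝 (C * (‖(x + (0:ℝ) * I : ℂ)‖ ^ (5/2:ℝ) + 0))) := by
      have hcn : Continuous (fun p : ℝ => C * (‖(x + p * I : ℂ)‖ ^ (5/2:ℝ) + p)) := by
        have : Continuous (fun p : ℝ => ‖(x + p * I : ℂ)‖) := by fun_prop
        exact continuous_const.mul ((this.rpow_const (fun _ => Or.inr (by norm_num))).add continuous_id)
      exact hcn.tendsto 0
    simp only [Complex.ofReal_zero, zero_mul, add_zero, Complex.norm_real, Real.norm_eq_abs] at this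
    exact this.mono_left nhdsWithin_le_nhds
  have hfin := le_of_tendsto_of_tendsto hl1 hl2 (by
    filter_upwards [Ioo_mem_nhdsGT (show (0:ℝ) < r / 512 - |x| by linarith)] with p hp
    have hw : (x + p * I : ℂ) ∈ hDisc (r / 512) := by
      refine ⟨(norm_add_le _ _).trans_lt ?_, by simpa using hp.1⟩
      rw [norm_mul, Complex.norm_I, mul_one, Complex.norm_real, Complex.norm_real, Real.norm_eq_abs, Real.norm_eq_abs, abs_of_pos hp.1]
      linarith [hp.2]
    have := hq _ hw
    simpa using this)
  have e : (arctan (deriv φ y) : ℂ) - (q0 + q1 * x + q2 * x ^ 2) = ((arctan (deriv φ y) - (q0 + q1 * x + q2 * x ^ 2) : ℝ) : ℂ) := by push_cast; ring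
  rwa [e, Complex.norm_real, Real.norm_eq_abs] at hfin
end B7
end ModB7

section ModB8
open MeasureTheory
open Complex (I)

section B8
variable {k K m ε c0 l Y : ℝ} {φ : ℝ → ℝ} {U P Q ψ : ℂ → ℝ} {s : ℝ → ℝ}

lemma flat_aux {f f1 : ℝ → ℝ} {a L : ℝ} (hf : ∀ᶠ t in 𝓝 (0:ℝ), HasDerivAt f (f1 t) t) (hf1 : HasDerivAt f1 a 0)
    (h : ∀ᶠ t : ℝ in 𝓝 0, |f t| ≤ L * |t| ^ (5/2:ℝ)) : f1 0 = 0 ∧ 0 ≤ a := by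
  have h0 : f 0 = 0 := by
    have := h.self_of_nhds
    rw [abs_zero, Real.zero_rpow (by norm_num), mul_zero] at this
    exact abs_nonpos_iff.mp this
  have key : ∀ β > 0, f1 0 = 0 ∧ 0 ≤ a + 2 * β := by
    intro β hβ
    have hd : ∀ᶠ t in 𝓝 (0:ℝ), HasDerivAt (fun t => f t + β * t ^ 2) (f1 t + 2 * β * t) t := by
      filter_upwards [hf] with t ht
      exact (ht.add (((hasDerivAt_id t).pow 2).const_mul β)).congr_deriv (by simp; ring)
    have hd1 : HasDerivAt (fun t => f1 t + 2 * β * t) (a + 2 * β) 0 :=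
      (hf1.add ((hasDerivAt_id (0:ℝ)).const_mul (2 * β))).congr_deriv (by simp)
    have hsm : ∀ᶠ t : ℝ in 𝓝 0, L * |t| ^ (1/2:ℝ) < β := by
      have hc : Continuous (fun t : ℝ => L * |t| ^ (1/2:ℝ)) :=
        continuous_const.mul (continuous_abs.rpow_const (fun _ => Or.inr (by norm_num)))
      apply (hc.tendsto 0).eventually_lt_const
      rw [abs_zero, Real.zero_rpow (by norm_num), mul_zero]; exact hβ
    have := sec_min hd hd1 (by
      filter_upwards [h, hsm] with t ht h2
      have e : |t| ^ (5/2:ℝ) = |t| ^ (1/2:ℝ) * t ^ 2 := by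
        rw [show (5/2:ℝ) = 1/2 + (2:ℕ) by norm_num, Real.rpow_add' (abs_nonneg t) (by norm_num), Real.rpow_natCast, sq_abs]
      rw [e, ← mul_assoc] at ht
      have := mul_le_mul_of_nonneg_right h2.le (sq_nonneg t)
      simp only [h0]
      linarith [neg_abs_le (f t)])
    simpa using this
  refine ⟨(key 1 one_pos).1, ?_⟩
  by_contra! hneg
  linarith [(key (-a/4) (by linarith)).2]

lemma flat {f f1 : ℝ → ℝ} {a L y0 : ℝ} (hf : ∀ᶠ t in 𝓝 y0, HasDerivAt f (f1 t) t) (hf1 : HasDerivAt f1 a y0)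
    (h : ∀ᶠ t : ℝ in 𝓝 y0, |f t| ≤ L * |t - y0| ^ (5/2:ℝ)) : f1 y0 = 0 ∧ a = 0 := by
  have ht : Tendsto (fun t : ℝ => y0 + t) (𝓝 0) (𝓝 y0) := by
    have : Continuous (fun t : ℝ => y0 + t) := by fun_prop
    simpa using this.tendsto 0
  have a1 : ∀ᶠ t in 𝓝 (0:ℝ), HasDerivAt (fun t => f (y0 + t)) (f1 (y0 + t)) t := by
    filter_upwards [ht.eventually hf] with t h1 using h1.comp_const_add y0 t
  have a2 : HasDerivAt (fun t => f1 (y0 + t)) a 0 := HasDerivAt.comp_const_add y0 0 (by simpa using hf1)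
  have a3 : ∀ᶠ t : ℝ in 𝓝 0, |f (y0 + t)| ≤ L * |t| ^ (5/2:ℝ) := by
    filter_upwards [ht.eventually h] with t h1
    simpa using h1
  have b1 := flat_aux a1 a2 a3
  have b2 := flat_aux (f := fun t => - f (y0 + t)) (f1 := fun t => - f1 (y0 + t)) (by filter_upwards [a1] with t h1 using h1.neg) a2.neg (by simpa using a3)
  simp only [add_zero] at b1
  exact ⟨b1.1, by linarith [b1.2, b2.2]⟩

lemma coef_small {C δ τ q1 q2 q0 a t0 tp tm η : ℝ} (hδ : 0 < δ) (hδ1 : δ ≤ 1) (hη : 0 < η)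
    (h0 : |t0 - a| ≤ τ) (hp : |tp - a| ≤ τ) (hm : |tm - a| ≤ τ) (hτ : τ = η * δ ^ 2 / 4) (hC : C ≤ η / 2 * δ ^ 2)
    (e0 : t0 = q0) (ep : |tp - (q0 + q1 * δ + q2 * δ ^ 2)| ≤ C) (em : |tm - (q0 + q1 * (-δ) + q2 * (-δ) ^ 2)| ≤ C) :
    |q1| ≤ η ∧ |q2| ≤ η + η := by
  subst e0
  rw [abs_le] at *
  have d2 : 0 < δ ^ 2 := by positivity
  have dd : δ ^ 2 ≤ δ := by nlinarith
  have e2 : (-δ) ^ 2 = δ ^ 2 := by ring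
  rw [e2] at em
  have x1 : |q1| * δ ≤ η * δ := by
    rw [← abs_of_pos hδ, ← abs_mul, abs_of_pos hδ, abs_le]
    constructor <;> nlinarith
  have x2 : |q2| * δ ^ 2 ≤ (η + η) * δ ^ 2 := by
    rw [← abs_of_pos d2, ← abs_mul, abs_of_pos d2, abs_le]
    constructor <;> nlinarith
  exact ⟨abs_le.mp (le_of_mul_le_mul_right x1 hδ), le_of_mul_le_mul_right x2 d2⟩

lemma Strip.final (h : Strip k K m ε c0 l Y φ U P Q ψ s) (hlim : Tendsto (deriv φ) atBot (𝓝 m)) :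
    Tendsto (deriv (deriv φ)) atBot (𝓝 0) ∧ Tendsto (deriv (deriv (deriv φ))) atBot (𝓝 0) := by
  obtain ⟨C, hC, r, hr, hex⟩ := h.expansion
  have hYn := h.Y_neg
  have hex' : ∀ y0, ∃ q0 q1 q2 : ℝ, y0 < Y - 1 → ∀ y < 0, |s y - s y0| < r →
      |arctan (deriv φ y) - (q0 + q1 * (s y - s y0) + q2 * (s y - s y0) ^ 2)| ≤ C * |s y - s y0| ^ (5/2:ℝ) := by
    intro y0
    by_cases hy : y0 < Y - 1
    · obtain ⟨q0, q1, q2, hq⟩ := hex y0 hy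
      exact ⟨q0, q1, q2, fun _ => hq⟩
    · exact ⟨0, 0, 0, fun hh => absurd hh hy⟩
  choose q0 q1 q2 hq using hex'
  have hTl : Tendsto (fun y => arctan (deriv φ y)) atBot (𝓝 (arctan m)) := (continuous_arctan.tendsto m).comp hlim
  have hsm : ∀ η > 0, ∀ᶠ y in atBot, |q1 y| ≤ η ∧ |q2 y| ≤ η + η := by
    intro η hη
    obtain ⟨δ, hδ, hδ1, hδr, hδC⟩ : ∃ δ : ℝ, 0 < δ ∧ δ ≤ 1 ∧ δ < r ∧ C * δ ^ (1/2:ℝ) ≤ η / 2 := by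
      have hc : Continuous (fun t : ℝ => C * t ^ (1/2:ℝ)) :=
        continuous_const.mul (continuous_id.rpow_const (fun _ => Or.inr (by norm_num)))
      have hs : ∀ᶠ t : ℝ in 𝓝[>] 0, C * t ^ (1/2:ℝ) < η / 2 := by
        apply ((hc.tendsto 0).mono_left nhdsWithin_le_nhds).eventually_lt_const
        rw [Real.zero_rpow (by norm_num), mul_zero]; linarith
      obtain ⟨δ, hd1, hd2⟩ := (hs.and (Ioo_mem_nhdsGT (lt_min one_pos hr))).exists
      exact ⟨δ, hd2.1, (hd2.2.trans_le (min_le_left _ _)).le, hd2.2.trans_le (min_le_right _ _), hd1.le⟩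
    have hτ : 0 < η * δ ^ 2 / 4 := by positivity
    obtain ⟨Y2, hY2⟩ := eventually_atBot.mp (hTl.eventually (Metric.closedBall_mem_nhds _ hτ))
    have hball : ∀ y ≤ Y2, |arctan (deriv φ y) - arctan m| ≤ η * δ ^ 2 / 4 := fun y hy => hY2 y hy
    filter_upwards [eventually_lt_atBot (Y - 1), eventually_lt_atBot (Y2 - 1)] with y0 hy0 hy02
    have sc : ContinuousOn s (Icc (y0 - 1) (y0 + 1)) := fun y hy => (h.s_der y (by linarith [hy.2])).continuousAt.continuousWithinAt
    have b1 := h.s_mono (show y0 - 1 ≤ y0 by linarith) (by linarith)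
    have b2 := h.s_mono (show y0 ≤ y0 + 1 by linarith) (by linarith)
    have hpt : ∀ σ : ℝ, |σ| ≤ δ → ∃ y, |arctan (deriv φ y) - arctan m| ≤ η * δ ^ 2 / 4 ∧
        |arctan (deriv φ y) - (q0 y0 + q1 y0 * σ + q2 y0 * σ ^ 2)| ≤ C * |σ| ^ (5/2:ℝ) := by
      intro σ hσ
      have := abs_le.mp hσ
      obtain ⟨y, hy, hys⟩ := intermediate_value_Icc (by linarith) sc (show s y0 + σ ∈ Icc _ _ from ⟨by linarith, by linarith⟩)
      refine ⟨y, hball y (by linarith [hy.2]), ?_⟩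
      have e : s y - s y0 = σ := by linarith
      have := hq y0 hy0 y (by linarith [hy.2]) (by rw [e]; linarith)
      rwa [e] at this
    obtain ⟨yp, p1, p2⟩ := hpt δ (abs_of_pos hδ).le
    obtain ⟨ym, m1, m2⟩ := hpt (-δ) (by rw [abs_neg, abs_of_pos hδ])
    have z := hq y0 hy0 y0 (by linarith) (by simpa using hr)
    rw [sub_self, abs_zero, Real.zero_rpow (by norm_num), mul_zero, mul_zero] at z
    have z2 := abs_nonpos_iff.mp z
    rw [abs_of_pos hδ] at p2
    rw [abs_neg, abs_of_pos hδ] at m2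
    refine coef_small hδ hδ1 hη (hball y0 (by linarith)) p1 m1 rfl ?_ (by linarith) p2 m2
    rw [show (5/2:ℝ) = 1/2 + (2:ℕ) by norm_num, Real.rpow_add hδ, Real.rpow_natCast, ← mul_assoc]
    gcongr
  have hq1 : Tendsto q1 atBot (𝓝 0) := by
    rw [Metric.tendsto_nhds]
    intro e he
    filter_upwards [hsm (e/4) (by positivity)] with y hy
    rw [Real.dist_eq, sub_zero]; linarith [hy.1]
  have hq2 : Tendsto q2 atBot (𝓝 0) := by
    rw [Metric.tendsto_nhds]
    intro e he
    filter_upwards [hsm (e/4) (by positivity)] with y hy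
    rw [Real.dist_eq, sub_zero]; linarith [hy.2]
  set f := deriv φ with hf
  set f1 := deriv f with hf1
  set f2 := deriv f1 with hf2
  have df : ∀ y < 0, HasDerivAt f (f1 y) y := fun y hy => h.fb.φdd hy
  have df1 : ∀ y < 0, HasDerivAt f1 (f2 y) y := fun y hy => ((h.fb.φa y hy).deriv.deriv).differentiableAt.hasDerivAt
  set S := fun y => √(1 + f y ^ 2) with hS
  have hSp : ∀ y, 0 < S y := fun y => by simp only [hS]; positivity
  have hS2 : ∀ y, S y ^ 2 = 1 + f y ^ 2 := fun y => Real.sq_sqrt (by positivity)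
  have dS : ∀ y < 0, HasDerivAt S (f y * f1 y / S y) y := by
    intro y hy
    have h1 : HasDerivAt (fun y => 1 + f y ^ 2) (2 * f y * f1 y) y :=
      (((df y hy).pow 2).const_add 1).congr_deriv (by simp)
    refine (h1.sqrt (by positivity)).congr_deriv ?_
    have := (hSp y).ne'
    simp only [hS] at this ⊢
    field_simp
  have hkey : ∀ y0 < Y - 1, f1 y0 = q1 y0 * S y0 ^ 3 ∧
      f2 y0 = S y0 ^ 2 * (2 * f y0 * f1 y0 ^ 2 / (S y0 ^ 2) ^ 2 + q1 y0 * (f y0 * f1 y0 / S y0) + 2 * q2 y0 * S y0 ^ 2) := by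
    intro y0 hy0
    have hy0n : y0 < 0 := by linarith
    have hev : ∀ᶠ y in 𝓝 y0, y < 0 := isOpen_Iio.mem_nhds hy0n
    have dσ : ∀ y < 0, HasDerivAt (fun y => s y - s y0) (S y) y := fun y hy => (h.s_der y hy).sub_const _
    have d1 : ∀ᶠ y in 𝓝 y0, HasDerivAt (fun y => arctan (f y) - (q0 y0 + q1 y0 * (s y - s y0) + q2 y0 * (s y - s y0) ^ 2))
        (f1 y / (1 + f y ^ 2) - q1 y0 * S y - 2 * q2 y0 * ((s y - s y0) * S y)) y := by
      filter_upwards [hev] with y hy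
      refine ((df y hy).arctan.sub ((((dσ y hy).const_mul (q1 y0)).const_add (q0 y0)).add (((dσ y hy).pow 2).const_mul (q2 y0)))).congr_deriv ?_
      simp; ring
    have d2 : HasDerivAt (fun y => f1 y / (1 + f y ^ 2) - q1 y0 * S y - 2 * q2 y0 * ((s y - s y0) * S y))
        ((f2 y0 * (1 + f y0 ^ 2) - f1 y0 * (2 * f y0 * f1 y0)) / (1 + f y0 ^ 2) ^ 2 - q1 y0 * (f y0 * f1 y0 / S y0) - 2 * q2 y0 * S y0 ^ 2) y0 := by
      have h1 : HasDerivAt (fun y => 1 + f y ^ 2) (2 * f y0 * f1 y0) y0 :=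
        (((df y0 hy0n).pow 2).const_add 1).congr_deriv (by simp)
      refine ((((df1 y0 hy0n).div h1 (by positivity)).sub ((dS y0 hy0n).const_mul (q1 y0))).sub
        (((dσ y0 hy0n).mul (dS y0 hy0n)).const_mul (2 * q2 y0))).congr_deriv ?_
      simp only [sub_self, zero_mul, add_zero]; ring
    have hσ : Tendsto (fun y => |s y - s y0|) (𝓝 y0) (𝓝 0) := by
      have := (dσ y0 hy0n).continuousAt.abs.tendsto
      simpa using this
    obtain ⟨L, hL⟩ := (dσ y0 hy0n).isBigO_sub.bound
    have d3 : ∀ᶠ y in 𝓝 y0, |arctan (f y) - (q0 y0 + q1 y0 * (s y - s y0) + q2 y0 * (s y - s y0) ^ 2)| ≤ (C * |L| ^ (5/2:ℝ)) * |y - y0| ^ (5/2:ℝ) := by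
      filter_upwards [hev, hσ.eventually_lt_const hr, hL] with y hy hyr hyL
      refine (hq y0 hy0 y hy hyr).trans ?_
      rw [mul_assoc, ← Real.mul_rpow (abs_nonneg _) (abs_nonneg _)]
      gcongr
      simp only [sub_self, sub_zero, Real.norm_eq_abs] at hyL
      exact hyL.trans (mul_le_mul_of_nonneg_right (le_abs_self L) (abs_nonneg _))
    obtain ⟨g1, g2⟩ := flat d1 d2 d3
    have hp := (hSp y0).ne'
    simp only [sub_self, zero_mul, mul_zero, sub_zero] at g1
    rw [← hS2] at g1 g2
    constructor
    · field_simp at g1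
      linear_combination g1
    · field_simp at g2 ⊢
      linear_combination g2
  have hSl : Tendsto S atBot (𝓝 (√(1 + m ^ 2))) := ((hlim.pow 2).const_add 1).sqrt
  have hSm : √(1 + m ^ 2) ≠ 0 := by positivity
  have l1 : Tendsto f1 atBot (𝓝 0) := by
    have := hq1.mul (hSl.pow 3)
    rw [zero_mul] at this
    refine this.congr' ?_
    filter_upwards [eventually_lt_atBot (Y - 1)] with y hy using (hkey y hy).1.symm
  refine ⟨l1, ?_⟩
  have t1 := ((hlim.const_mul 2).mul (l1.pow 2)).div ((hSl.pow 2).pow 2) (by positivity)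
  have t2 := hq1.mul ((hlim.mul l1).div hSl hSm)
  have t3 := (hq2.const_mul 2).mul (hSl.pow 2)
  have := (hSl.pow 2).mul ((t1.add t2).add t3)
  simp only [ne_eq, OfNat.ofNat_ne_zero, not_false_eq_true, zero_pow, mul_zero, zero_mul, zero_div, add_zero] at this
  refine this.congr' ?_
  filter_upwards [eventually_lt_atBot (Y - 1)] with y hy using (hkey y hy).2.symm
end B8

theorem main_red {d D μ c : ℝ} (hd : 0 < d)
    {u : ℝ → ℝ → ℝ} (hu : OneSpeciesTW d D μ c u)
    (hLip : ∃ K : NNReal, LipschitzOnWith K (fun p : ℝ × ℝ => u p.1 p.2) lowerH)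
    (hmono : ∀ p ∈ posSet u, pdx u p.1 p.2 < 0)
    {φ : ℝ → ℝ}
    (hφa : AnalyticOnNhd ℝ φ (Iio 0))
    (hΓ : freeBdry u = {p : ℝ × ℝ | ∃ y < (0:ℝ), p = (φ y, y)})
    {m : ℝ} (hφ' : Tendsto (deriv φ) atBot (𝓝 m)) :
    Tendsto (deriv (deriv φ)) atBot (𝓝 0) ∧
      Tendsto (deriv (deriv (deriv φ))) atBot (𝓝 0) := by
  obtain ⟨K, U, P, Q, h⟩ := tw_FB hd hu hLip hmono hφa hΓ
  obtain ⟨ε, c0, l, Y, ψ, s, hS⟩ := exists_strip h hφ'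
  exact hS.final hφ'
end ModB8

/-- Proposition 5.1: flattening of higher derivatives of the graph.
For a travelling wave `(c,u)` of the one-species problem with `u` globally Lipschitz,
`∂ₓu < 0` on `Ω`, free boundary the locally Lipschitz analytic graph
`Γ = {(φ(y),y) : y < 0}`, and `φ'(y) → -cotan α` (with `α ∈ (0,π/2)`) as `y → -∞`:
then `φ''(y) → 0` and `φ'''(y) → 0` as `y → -∞`. -/
theorem higher_derivatives_vanish_at_infinity
    (d D μ c : ℝ) (hd : 0 < d) (hD : 0 < D) (hμ : 0 < μ)
    (u : ℝ → ℝ → ℝ) (hu : OneSpeciesTW d D μ c u)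
    (hLip : ∃ K : NNReal, LipschitzOnWith K (fun p : ℝ × ℝ => u p.1 p.2) lowerH)
    (hmono : ∀ p ∈ posSet u, pdx u p.1 p.2 < 0)
    (φ : ℝ → ℝ)
    (hφa : AnalyticOnNhd ℝ φ (Iio 0))
    (hφl : ∀ y < (0:ℝ), ∃ ε > 0, ∃ K : NNReal, LipschitzOnWith K φ (Metric.ball y ε))
    (hΓ : freeBdry u = {p : ℝ × ℝ | ∃ y < (0:ℝ), p = (φ y, y)})
    (α : ℝ) (hα : α ∈ Ioo 0 (π/2))
    (hφ' : Tendsto (deriv φ) atBot (𝓝 (-(Real.cos α / Real.sin α)))) :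
    Tendsto (deriv (deriv φ)) atBot (𝓝 0) ∧
      Tendsto (deriv (deriv (deriv φ))) atBot (𝓝 0) := by
  exact main_red hd hu hLip hmono hφa hΓ hφ'
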